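/- arXiv:1512.04869 — 4 statements merged into one kernel-verified Lean document; each statement's English description precedes it below -/
import Mathlib

section
/- Let $K$ be a number field with ring of integers $\mathcal{O}_K$ and let $\xi \in \mathcal{O}_K$ be a nonzero non-unit. Then the series $\sum_{e=1}^{\infty} \frac{1}{e} \sum_{\mathfrak{a}} \frac{1}{\mathcal{N}(\mathfrak{a})}$ converges, where the inner sum runs over all nonzero squarefree ideals $\mathfrak{a}$ of $\mathcal{O}_K$ that are coprime to the principal ideal $(\xi)$, contain $\xi^k - 1$ for some positive integer $k$, and satisfy $\operatorname{ord}_{\xi}(\mathfrak{a}) = e$. Equivalently, the function $\mathfrak{a} \mapsto 1/(\mathcal{N}(\mathfrak{a}) \cdot \operatorname{ord}_{\xi}(\mathfrak{a}))$ is summable over all nonzero squarefree ideals of $\mathcal{O}_K$ coprime to $(\xi)$ containing $\xi^k - 1$ for some $k \ge 1$. -/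
open NumberField

/-- `ordXi ξ 𝔞` is the least `k ≥ 1` with `ξ^k - 1 ∈ 𝔞` (junk value `0` if no such `k`). -/
noncomputable def ordXi {K : Type*} [Field K] [NumberField K]
    (ξ : 𝓞 K) (𝔞 : Ideal (𝓞 K)) : ℕ :=
  sInf {k : ℕ | 1 ≤ k ∧ ξ ^ k - 1 ∈ 𝔞}

section PrimeReciprocals

/-- The number of primes in the dyadic interval `[2 ^ J, 2 ^ (J + 1))` is at most
`2 ^ (J + 2) / J`. -/
theorem card_primes_dyadic_mul_le (J : ℕ) :
    J * ((Finset.Ico (2 ^ J) (2 ^ (J + 1))).filter Nat.Prime).card ≤ 2 ^ (J + 2) := by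
  set s := (Finset.Ico (2 ^ J) (2 ^ (J + 1))).filter Nat.Prime with hs
  have h1 : (2 ^ J) ^ s.card ≤ ∏ p ∈ s, p :=
    Finset.pow_card_le_prod s (fun p => p) (2 ^ J) fun p hp => by
      simp only [hs, Finset.mem_filter, Finset.mem_Ico] at hp
      exact hp.1.1
  have h2 : ∏ p ∈ s, p ≤ primorial (2 ^ (J + 1)) := by
    refine Finset.prod_le_prod_of_subset_of_one_le' (fun p hp => ?_) fun p hp _ => ?_
    · simp only [hs, Finset.mem_filter, Finset.mem_Ico, Finset.mem_range] at hp ⊢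
      exact ⟨by omega, hp.2⟩
    · exact (Finset.mem_filter.mp hp).2.one_le
  have h3 := h1.trans (h2.trans (primorial_le_four_pow _))
  rw [← pow_mul, show (4 : ℕ) = 2 ^ 2 by norm_num, ← pow_mul] at h3
  have h4 := (Nat.pow_le_pow_iff_right (by norm_num : 1 < 2)).mp h3
  calc J * s.card ≤ 2 * 2 ^ (J + 1) := h4
    _ = 2 ^ (J + 2) := by ring

theorem sum_primes_dyadic_le (J : ℕ) :
    ∑ p ∈ (Finset.Ico (2 ^ J) (2 ^ (J + 1))).filter Nat.Prime, (1 / p : ℝ) ≤ 4 / J := by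
  rcases Nat.eq_zero_or_pos J with rfl | hJ
  · have : (Finset.Ico (2 ^ 0) (2 ^ (0 + 1))).filter Nat.Prime = ∅ := by decide
    rw [this]; simp
  have hJ' : (0 : ℝ) < J := by exact_mod_cast hJ
  have h1 : ∑ p ∈ (Finset.Ico (2 ^ J) (2 ^ (J + 1))).filter Nat.Prime, (1 / p : ℝ) ≤
      ((Finset.Ico (2 ^ J) (2 ^ (J + 1))).filter Nat.Prime).card • (1 / 2 ^ J : ℝ) := by
    refine Finset.sum_le_card_nsmul _ _ _ fun p hp => ?_
    simp only [Finset.mem_filter, Finset.mem_Ico] at hp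
    exact one_div_le_one_div_of_le (by positivity) (by exact_mod_cast hp.1.1)
  have h2 : (J : ℝ) * ((Finset.Ico (2 ^ J) (2 ^ (J + 1))).filter Nat.Prime).card ≤ 2 ^ (J + 2) := by
    exact_mod_cast card_primes_dyadic_mul_le J
  refine h1.trans ?_
  rw [nsmul_eq_mul, mul_one_div, div_le_div_iff₀ (by positivity) hJ']
  calc _ = (J : ℝ) * ((Finset.Ico (2 ^ J) (2 ^ (J + 1))).filter Nat.Prime).card := mul_comm _ _
    _ ≤ _ := h2
    _ = _ := by ring

/-- A weak form of Mertens' second theorem. -/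
theorem sum_one_div_primes_lt_two_pow_le (J : ℕ) :
    ∑ p ∈ (Finset.range (2 ^ J)).filter Nat.Prime, (1 / p : ℝ) ≤ 4 * (harmonic J : ℝ) := by
  have key : ∀ J : ℕ, ∑ p ∈ (Finset.range (2 ^ (J + 1))).filter Nat.Prime, (1 / p : ℝ) ≤
      4 * (harmonic J : ℝ) := by
    intro J
    induction J with
    | zero =>
      have : (Finset.range (2 ^ (0 + 1))).filter Nat.Prime = ∅ := by decide
      rw [this]; simp
    | succ J ih =>
      rw [Finset.sum_filter] at ih ⊢
      rw [← Finset.sum_range_add_sum_Ico _ (Nat.pow_le_pow_right two_pos (Nat.le_succ (J + 1))),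
        ← Finset.sum_filter (s := Finset.Ico _ _), harmonic_succ]
      have := sum_primes_dyadic_le (J + 1)
      push_cast at this ⊢
      rw [mul_add, ← div_eq_mul_inv]
      exact add_le_add ih this
  refine le_trans (Finset.sum_le_sum_of_subset_of_nonneg ?_ fun _ _ _ => by positivity) (key J)
  exact Finset.filter_subset_filter _
    (Finset.range_subset_range.mpr (Nat.pow_le_pow_right two_pos (Nat.le_succ J)))

theorem two_pow_card_primeFactors_le {n : ℕ} (hn : n ≠ 0) : 2 ^ n.primeFactors.card ≤ n :=
  (Finset.pow_card_le_prod n.primeFactors (fun p => p) 2 fun _ hp =>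
    (Nat.prime_of_mem_primeFactors hp).two_le).trans
    (Nat.le_of_dvd (Nat.pos_of_ne_zero hn) (Nat.prod_primeFactors_dvd n))

theorem sum_one_div_primeFactors_le {n : ℕ} (hn : n ≠ 0) (C J : ℕ) (h : n ≤ 2 ^ (C * 2 ^ J)) :
    ∑ p ∈ n.primeFactors, (1 / p : ℝ) ≤ 4 * (harmonic J : ℝ) + C := by
  have hcard : n.primeFactors.card ≤ C * 2 ^ J :=
    (Nat.pow_le_pow_iff_right (by norm_num : 1 < 2)).mp ((two_pow_card_primeFactors_le hn).trans h)
  rw [← Finset.sum_filter_add_sum_filter_not _ (fun p => p < 2 ^ J)]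
  refine add_le_add ?_ ?_
  · refine le_trans (Finset.sum_le_sum_of_subset_of_nonneg (fun p hp => ?_)
      fun _ _ _ => by positivity) (sum_one_div_primes_lt_two_pow_le J)
    simp only [Finset.mem_filter, Finset.mem_range] at hp ⊢
    exact ⟨hp.2, Nat.prime_of_mem_primeFactors hp.1⟩
  · have h1 : ∑ p ∈ n.primeFactors with ¬ p < 2 ^ J, (1 / p : ℝ) ≤
        (n.primeFactors.filter (fun p => ¬ p < 2 ^ J)).card • (1 / 2 ^ J : ℝ) := by
      refine Finset.sum_le_card_nsmul _ _ _ fun p hp => ?_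
      simp only [Finset.mem_filter, not_lt] at hp
      exact one_div_le_one_div_of_le (by positivity) (by exact_mod_cast hp.2)
    have h2 : ((n.primeFactors.filter (fun p => ¬ p < 2 ^ J)).card : ℝ) ≤ C * 2 ^ J := by
      exact_mod_cast (Finset.card_filter_le _ _).trans hcard
    refine h1.trans ?_
    rw [nsmul_eq_mul, mul_one_div, div_le_iff₀ (by positivity)]
    exact h2

end PrimeReciprocals

section IdealSums

open UniqueFactorizationMonoid

variable {K : Type*} [Field K] [NumberField K]

theorem card_primeIdeals_containing_prime_le {p : ℕ} (hp : p.Prime) (s : Finset (Ideal (𝓞 K)))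
    (hs : ∀ P ∈ s, Prime P ∧ Ideal.absNorm (Ideal.under ℤ P) = p) :
    s.card ≤ Module.finrank ℤ (𝓞 K) := by
  have hdvd : ∏ P ∈ s, P ∣ Ideal.span {(p : 𝓞 K)} := by
    refine Finset.prod_primes_dvd _ (fun P hP => (hs P hP).1) fun P hP => ?_
    rw [Ideal.dvd_span_singleton, ← (hs P hP).2]
    exact Int.absNorm_under_mem P
  have h1 : Ideal.absNorm (∏ P ∈ s, P) ∣ p ^ Module.finrank ℤ (𝓞 K) := by
    rw [← Ideal.absNorm_span_natCast]
    exact map_dvd Ideal.absNorm hdvd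
  have h2 := Nat.le_of_dvd (pow_pos hp.pos _) h1
  rw [map_prod] at h2
  have h3 : p ^ s.card ≤ ∏ P ∈ s, Ideal.absNorm P := by
    refine Finset.pow_card_le_prod s _ p fun P hP => ?_
    rw [← (hs P hP).2]
    exact Nat.le_of_dvd (Nat.pos_of_ne_zero (Ideal.absNorm_eq_zero_iff.not.mpr (hs P hP).1.ne_zero))
      (Int.absNorm_under_dvd_absNorm P)
  exact (Nat.pow_le_pow_iff_right hp.one_lt).mp (h3.trans h2)

theorem sum_one_div_absNorm_primeFactors_le {I : Ideal (𝓞 K)} (hI : I ≠ ⊥) :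
    ∑ P ∈ primeFactors I, (1 / Ideal.absNorm P : ℝ) ≤
      Module.finrank ℤ (𝓞 K) * ∑ p ∈ (Ideal.absNorm I).primeFactors, (1 / p : ℝ) := by
  classical
  have hprime : ∀ P ∈ primeFactors I, Prime P := fun P hP =>
    prime_of_normalized_factor P (mem_primeFactors.mp hP)
  have hunder : ∀ P ∈ primeFactors I, (Ideal.absNorm (Ideal.under ℤ P)).Prime := by
    intro P hP
    have := Ideal.isPrime_of_prime (hprime P hP)
    have : NeZero P := ⟨(hprime P hP).ne_zero⟩
    exact Nat.absNorm_under_prime P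
  have hmaps : ∀ P ∈ primeFactors I,
      Ideal.absNorm (Ideal.under ℤ P) ∈ (Ideal.absNorm I).primeFactors := by
    intro P hP
    refine Nat.mem_primeFactors.mpr ⟨hunder P hP, ?_, Ideal.absNorm_eq_zero_iff.not.mpr hI⟩
    exact (Int.absNorm_under_dvd_absNorm P).trans
      (map_dvd Ideal.absNorm (dvd_of_mem_normalizedFactors (mem_primeFactors.mp hP)))
  rw [← Finset.sum_fiberwise_of_maps_to hmaps, Finset.mul_sum]
  refine Finset.sum_le_sum fun p hp => ?_
  have hpp := Nat.prime_of_mem_primeFactors hp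
  have hp0 : (0 : ℝ) < p := by exact_mod_cast hpp.pos
  have h1 : ∑ P ∈ primeFactors I with Ideal.absNorm (Ideal.under ℤ P) = p,
      (1 / Ideal.absNorm P : ℝ) ≤
      ((primeFactors I).filter fun P => Ideal.absNorm (Ideal.under ℤ P) = p).card •
        (1 / p : ℝ) := by
    refine Finset.sum_le_card_nsmul _ _ _ fun P hP => ?_
    obtain ⟨hP, hPp⟩ := Finset.mem_filter.mp hP
    refine one_div_le_one_div_of_le hp0 ?_
    rw [← hPp]
    exact_mod_cast Nat.le_of_dvd
      (Nat.pos_of_ne_zero (Ideal.absNorm_eq_zero_iff.not.mpr (hprime P hP).ne_zero))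
      (Int.absNorm_under_dvd_absNorm P)
  refine h1.trans ?_
  rw [nsmul_eq_mul]
  gcongr
  refine card_primeIdeals_containing_prime_le hpp _ fun P hP => ?_
  obtain ⟨hP, hPp⟩ := Finset.mem_filter.mp hP
  exact ⟨hprime P hP, hPp⟩

theorem prod_primeFactors_of_squarefree {I : Ideal (𝓞 K)} (hI : I ≠ ⊥) (hsq : Squarefree I) :
    ∏ P ∈ primeFactors I, P = I := by
  classical
  have hnodup := (squarefree_iff_nodup_normalizedFactors (x := I) hI).mp hsq
  conv_rhs => rw [← Ideal.prod_normalizedFactors_eq_self hI]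
  rw [Finset.prod_eq_multiset_prod, Multiset.map_id']
  congr 1
  unfold primeFactors
  convert! (Multiset.toFinset_val _).trans hnodup.dedup

theorem sum_one_div_absNorm_squarefree_dvd_le {I : Ideal (𝓞 K)} (hI : I ≠ ⊥)
    (s : Finset (Ideal (𝓞 K))) (hs : ∀ 𝔞 ∈ s, Squarefree 𝔞 ∧ 𝔞 ∣ I) :
    ∑ 𝔞 ∈ s, (1 / Ideal.absNorm 𝔞 : ℝ) ≤ ∏ P ∈ primeFactors I, (1 + 1 / Ideal.absNorm P : ℝ) := by
  classical
  have hne : ∀ 𝔞 ∈ s, 𝔞 ≠ ⊥ := fun 𝔞 h𝔞 => ne_zero_of_dvd_ne_zero hI (hs 𝔞 h𝔞).2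
  have hprod : ∀ 𝔞 ∈ s, ∏ P ∈ primeFactors 𝔞, P = 𝔞 := fun 𝔞 h𝔞 =>
    prod_primeFactors_of_squarefree (hne 𝔞 h𝔞) (hs 𝔞 h𝔞).1
  have hinj : Set.InjOn (primeFactors : Ideal (𝓞 K) → _) s := by
    intro 𝔞 h𝔞 𝔟 h𝔟 h
    rw [← hprod 𝔞 h𝔞, ← hprod 𝔟 h𝔟, h]
  rw [Finset.prod_one_add]
  calc ∑ 𝔞 ∈ s, (1 / Ideal.absNorm 𝔞 : ℝ)
      = ∑ 𝔞 ∈ s, ∏ P ∈ primeFactors 𝔞, (1 / Ideal.absNorm P : ℝ) := by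
        refine Finset.sum_congr rfl fun 𝔞 h𝔞 => ?_
        conv_lhs => rw [← hprod 𝔞 h𝔞]
        rw [map_prod]
        simp
    _ = ∑ t ∈ s.image primeFactors, ∏ P ∈ t, (1 / Ideal.absNorm P : ℝ) :=
        (Finset.sum_image (f := fun t => ∏ P ∈ t, (1 / Ideal.absNorm P : ℝ)) hinj).symm
    _ ≤ _ := by
        refine Finset.sum_le_sum_of_subset_of_nonneg (fun t ht => ?_)
          fun _ _ _ => Finset.prod_nonneg fun _ _ => by positivity
        obtain ⟨𝔞, h𝔞, rfl⟩ := Finset.mem_image.mp ht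
        refine Finset.mem_powerset.mpr fun P hP => ?_
        rw [mem_primeFactors] at hP ⊢
        exact Multiset.mem_of_le
          ((dvd_iff_normalizedFactors_le_normalizedFactors (hne 𝔞 h𝔞) hI).mp (hs 𝔞 h𝔞).2) hP

theorem sum_one_div_absNorm_squarefree_dvd_le_exp {I : Ideal (𝓞 K)} (hI : I ≠ ⊥) (C J : ℕ)
    (hC : Ideal.absNorm I ≤ 2 ^ (C * 2 ^ J))
    (s : Finset (Ideal (𝓞 K))) (hs : ∀ 𝔞 ∈ s, Squarefree 𝔞 ∧ 𝔞 ∣ I) :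
    ∑ 𝔞 ∈ s, (1 / Ideal.absNorm 𝔞 : ℝ) ≤
      Real.exp (Module.finrank ℤ (𝓞 K) * (4 * (1 + Real.log J) + C)) := by
  refine (sum_one_div_absNorm_squarefree_dvd_le hI s hs).trans ?_
  calc ∏ P ∈ primeFactors I, (1 + 1 / Ideal.absNorm P : ℝ)
      ≤ ∏ P ∈ primeFactors I, Real.exp (1 / Ideal.absNorm P : ℝ) := by
        refine Finset.prod_le_prod (fun _ _ => by positivity) fun P _ => ?_
        rw [add_comm]
        exact Real.add_one_le_exp _
    _ = Real.exp (∑ P ∈ primeFactors I, (1 / Ideal.absNorm P : ℝ)) := (Real.exp_sum _ _).symm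
    _ ≤ _ := by
        refine Real.exp_le_exp.mpr ((sum_one_div_absNorm_primeFactors_le hI).trans ?_)
        gcongr
        refine (sum_one_div_primeFactors_le (Ideal.absNorm_eq_zero_iff.not.mpr hI) C J hC).trans ?_
        gcongr
        exact harmonic_le_one_add_log J

end IdealSums

section Norms

theorem span_pow_sub_one_ne_bot {R : Type*} [CommRing R] {ξ : R} (hξ : ¬ IsUnit ξ) {k : ℕ}
    (hk : 1 ≤ k) :
    Ideal.span {ξ ^ k - 1} ≠ ⊥ := by
  rw [Ne, Ideal.span_singleton_eq_bot, sub_eq_zero]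
  exact fun h => hξ (IsUnit.of_pow_eq_one h (by omega))

variable {K : Type*} [Field K] [NumberField K]

/-- The norms of the elements `ξ ^ k - 1` grow at most exponentially in `k`. -/
theorem exists_absNorm_span_pow_sub_one_le (ξ : 𝓞 K) :
    ∃ C : ℕ, ∀ k : ℕ, 1 ≤ k → Ideal.absNorm (Ideal.span {ξ ^ k - 1}) ≤ 2 ^ (C * k) := by
  obtain ⟨M, hM⟩ := pow_unbounded_of_one_lt (∑ σ : K →ₐ[ℚ] ℂ, ‖σ ξ‖ + 1) (one_lt_two (α := ℝ))
  refine ⟨M * Fintype.card (K →ₐ[ℚ] ℂ), fun k hk => ?_⟩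
  have hσ : ∀ σ : K →ₐ[ℚ] ℂ, ‖σ ((ξ : K) ^ k - 1)‖ ≤ 2 ^ (M * k) := by
    intro σ
    have h0 : ‖σ ξ‖ ≤ ∑ τ : K →ₐ[ℚ] ℂ, ‖τ ξ‖ :=
      Finset.single_le_sum (f := fun τ : K →ₐ[ℚ] ℂ => ‖τ ξ‖) (fun _ _ => norm_nonneg _)
        (Finset.mem_univ σ)
    calc ‖σ ((ξ : K) ^ k - 1)‖ = ‖σ ξ ^ k - 1‖ := by rw [map_sub, map_pow, map_one]
      _ ≤ ‖σ ξ ^ k‖ + ‖(1 : ℂ)‖ := norm_sub_le _ _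
      _ = ‖σ ξ‖ ^ k + 1 ^ k := by rw [norm_pow, norm_one, one_pow]
      _ ≤ (‖σ ξ‖ + 1) ^ k := pow_add_pow_le (norm_nonneg _) zero_le_one (by omega)
      _ ≤ (2 ^ M) ^ k := by
        gcongr
        linarith
      _ = 2 ^ (M * k) := (pow_mul _ _ _).symm
  have hnorm : ((Ideal.absNorm (Ideal.span {ξ ^ k - 1}) : ℕ) : ℝ) =
      ∏ σ : K →ₐ[ℚ] ℂ, ‖σ ((ξ : K) ^ k - 1)‖ := by
    rw [← norm_prod, ← Algebra.norm_eq_prod_embeddings, Ideal.absNorm_span_singleton]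
    have := Algebra.coe_norm_int (ξ ^ k - 1)
    push_cast at this
    rw [← this, Nat.cast_natAbs]
    simp
  have : ((Ideal.absNorm (Ideal.span {ξ ^ k - 1}) : ℕ) : ℝ) ≤
      2 ^ (M * Fintype.card (K →ₐ[ℚ] ℂ) * k) := by
    rw [hnorm]
    refine (Finset.prod_le_prod (fun _ _ => norm_nonneg _) fun σ _ => hσ σ).trans_eq ?_
    rw [Finset.prod_const, Finset.card_univ, ← pow_mul]
    ring_nf
  exact_mod_cast this

theorem ordXi_mem {ξ : 𝓞 K} {𝔞 : Ideal (𝓞 K)} (h : ∃ k : ℕ, 1 ≤ k ∧ ξ ^ k - 1 ∈ 𝔞) :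
    1 ≤ ordXi ξ 𝔞 ∧ ξ ^ ordXi ξ 𝔞 - 1 ∈ 𝔞 :=
  Nat.sInf_mem (s := {k : ℕ | 1 ≤ k ∧ ξ ^ k - 1 ∈ 𝔞}) h

/-- The squarefree ideals of order at most `2 ^ j` have reciprocal norms summing to a quantity
that is at most polynomial in `j`. -/
theorem exists_sum_one_div_absNorm_le {ξ : 𝓞 K} (hξ : ¬ IsUnit ξ) :
    ∃ C : ℝ, 0 ≤ C ∧ ∃ m : ℕ, ∀ j : ℕ, 1 ≤ j → ∀ s : Finset (Ideal (𝓞 K)),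
      (∀ 𝔞 ∈ s, Squarefree 𝔞 ∧ (∃ k : ℕ, 1 ≤ k ∧ ξ ^ k - 1 ∈ 𝔞) ∧ ordXi ξ 𝔞 ≤ 2 ^ j) →
      ∑ 𝔞 ∈ s, (1 / Ideal.absNorm 𝔞 : ℝ) ≤ C * (j : ℝ) ^ m := by
  obtain ⟨C, hC⟩ := exists_absNorm_span_pow_sub_one_le ξ
  let d := Module.finrank ℤ (𝓞 K)
  refine ⟨Real.exp (d * (4 * (1 + Real.log 2) + C)), (Real.exp_pos _).le, d * 4,
    fun j hj s hs => ?_⟩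
  have hj' : (j : ℝ) ≠ 0 := by positivity
  let I : Ideal (𝓞 K) := ∏ k ∈ Finset.Icc 1 (2 ^ j), Ideal.span {ξ ^ k - 1}
  have hI : I ≠ ⊥ := Finset.prod_ne_zero_iff.mpr fun k hk =>
    span_pow_sub_one_ne_bot hξ (Finset.mem_Icc.mp hk).1
  have hnorm : Ideal.absNorm I ≤ 2 ^ (C * 2 ^ (2 * j)) := by
    rw [map_prod]
    refine (Finset.prod_le_pow_card _ _ (2 ^ (C * 2 ^ j)) fun k hk => ?_).trans_eq ?_
    · obtain ⟨h1, h2⟩ := Finset.mem_Icc.mp hk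
      exact (hC k h1).trans (Nat.pow_le_pow_right two_pos (Nat.mul_le_mul_left C h2))
    · rw [Nat.card_Icc, Nat.add_sub_cancel, ← pow_mul]
      ring_nf
  refine (sum_one_div_absNorm_squarefree_dvd_le_exp hI C (2 * j) hnorm s fun 𝔞 h𝔞 => ?_).trans_eq ?_
  · obtain ⟨hsq, hex, hle⟩ := hs 𝔞 h𝔞
    obtain ⟨h1, h2⟩ := ordXi_mem hex
    refine ⟨hsq, (Ideal.dvd_span_singleton.mpr h2).trans ?_⟩
    exact Finset.dvd_prod_of_mem (fun k => Ideal.span {ξ ^ k - 1}) (Finset.mem_Icc.mpr ⟨h1, hle⟩)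
  · have hexp : (j : ℝ) ^ (d * 4) = Real.exp ((d * 4 : ℕ) * Real.log j) := by
      rw [Real.exp_nat_mul, Real.exp_log (by positivity)]
    rw [hexp, ← Real.exp_add]
    push_cast
    rw [Real.log_mul two_ne_zero hj']
    congr 1
    ring

end Norms

/-- **Convergence of Romanov's sum for number fields.** The function
`𝔞 ↦ 1/(𝒩(𝔞)·ord_ξ(𝔞))` is summable over the nonzero squarefree ideals of `𝒪_K` coprime
to `(ξ)` which contain `ξ^k - 1` for some `k ≥ 1`. -/
theorem romanov_sum_convergence (K : Type*) [Field K] [NumberField K]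
    (ξ : 𝓞 K) (hξ0 : ξ ≠ 0) (hξ : ¬ IsUnit ξ) :
    Summable (fun 𝔞 : {𝔞 : Ideal (𝓞 K) // 𝔞 ≠ ⊥ ∧ Squarefree 𝔞 ∧
        IsCoprime 𝔞 (Ideal.span {ξ}) ∧ ∃ k : ℕ, 1 ≤ k ∧ ξ ^ k - 1 ∈ 𝔞} =>
      1 / ((Ideal.absNorm 𝔞.1 : ℝ) * (ordXi ξ 𝔞.1 : ℝ))) := by
  classical
  obtain ⟨C, hC0, m, hC⟩ := exists_sum_one_div_absNorm_le hξ
  have hsummable : Summable fun j : ℕ => 2 * C * (((j + 1 : ℕ) : ℝ) ^ m * (1 / 2 : ℝ) ^ (j + 1)) :=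
    (((summable_nat_add_iff 1).mpr
      (summable_pow_mul_geometric_of_norm_lt_one (R := ℝ) m (r := 1 / 2) (by norm_num)))).mul_left _
  refine summable_of_sum_le (c := ∑' j : ℕ, 2 * C * (((j + 1 : ℕ) : ℝ) ^ m * (1 / 2) ^ (j + 1)))
    (fun 𝔞 => by positivity) fun u => ?_
  let g := fun 𝔞 : {𝔞 : Ideal (𝓞 K) // 𝔞 ≠ ⊥ ∧ Squarefree 𝔞 ∧
    IsCoprime 𝔞 (Ideal.span {ξ}) ∧ ∃ k : ℕ, 1 ≤ k ∧ ξ ^ k - 1 ∈ 𝔞} => Nat.log 2 (ordXi ξ 𝔞.1)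
  rw [← Finset.sum_fiberwise_of_maps_to (t := u.image g) fun 𝔞 h => Finset.mem_image_of_mem g h]
  refine le_trans (Finset.sum_le_sum fun j _ => ?_)
    (hsummable.sum_le_tsum (u.image g) fun j _ => by positivity)
  have hpow : ∀ 𝔞 ∈ u.filter (fun 𝔞 => g 𝔞 = j),
      2 ^ j ≤ ordXi ξ 𝔞.1 ∧ ordXi ξ 𝔞.1 ≤ 2 ^ (j + 1) := by
    intro 𝔞 h
    obtain ⟨-, rfl⟩ := Finset.mem_filter.mp h
    have h1 := (ordXi_mem 𝔞.2.2.2.2).1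
    exact ⟨Nat.pow_log_le_self 2 (by omega), (Nat.lt_pow_succ_log_self one_lt_two _).le⟩
  calc ∑ 𝔞 ∈ u with g 𝔞 = j, 1 / ((Ideal.absNorm 𝔞.1 : ℝ) * (ordXi ξ 𝔞.1 : ℝ))
      ≤ ∑ 𝔞 ∈ u with g 𝔞 = j, (1 / Ideal.absNorm 𝔞.1 : ℝ) * (1 / 2) ^ j := by
        refine Finset.sum_le_sum fun 𝔞 h => ?_
        rw [one_div_pow, ← one_div_mul_one_div]
        gcongr
        exact_mod_cast (hpow 𝔞 h).1
    _ = (∑ 𝔞 ∈ (u.filter fun 𝔞 => g 𝔞 = j).map (Function.Embedding.subtype _),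
          (1 / Ideal.absNorm 𝔞 : ℝ)) * (1 / 2) ^ j := by
        rw [← Finset.sum_mul, Finset.sum_map]
        rfl
    _ ≤ (C * ((j + 1 : ℕ) : ℝ) ^ m) * (1 / 2) ^ j := by
        gcongr
        refine hC (j + 1) (by omega) _ fun 𝔞 h => ?_
        obtain ⟨𝔟, h𝔟, rfl⟩ := Finset.mem_map.mp h
        exact ⟨𝔟.2.2.1, 𝔟.2.2.2.2, (hpow 𝔟 h𝔟).2⟩
    _ = 2 * C * (((j + 1 : ℕ) : ℝ) ^ m * (1 / 2) ^ (j + 1)) := by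
        rw [pow_succ (1 / 2 : ℝ)]
        ring
end

section
/- Let $\zeta \in \mathbb{Z}[i]$ satisfy the congruences $\zeta \equiv 1 \pmod{2+i}$, $\zeta \equiv 1 \pmod{2+3i}$, $\zeta \equiv 1+i \pmod{1+2i}$, $\zeta \equiv -2+2i \pmod{3}$, $\zeta \equiv 8-8i \pmod{3+2i}$, $\zeta \equiv 2048-2048i \pmod{7}$, and $\zeta \equiv 1 \pmod{1+i}$. Then the norm $N(\zeta)$ is odd, and for every integer $k \ge 1$ the element $\zeta - (1+i)^k$ is divisible in $\mathbb{Z}[i]$ by at least one of the six primes $2+i$, $2+3i$, $1+2i$, $3$, $3+2i$, $7$. Consequently, if $\zeta = \pi + (1+i)^k$ for some prime element $\pi \in \mathbb{Z}[i]$ and some $k \ge 1$, then $\pi$ is an associate of one of $2+i$, $2+3i$, $1+2i$, $3$, $3+2i$, $7$. -/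
open GaussianInt

/-- The six Gaussian primes `2+i`, `2+3i`, `1+2i`, `3`, `3+2i`, `7` used in the covering
congruence construction. -/
def sixPrimes : List GaussianInt := [⟨2, 1⟩, ⟨2, 3⟩, ⟨1, 2⟩, ⟨3, 0⟩, ⟨3, 2⟩, ⟨7, 0⟩]

/-- If `x ^ m ≡ 1` and `z ≡ x ^ r` modulo `q`, then `z ≡ x ^ k` modulo `q` whenever
`k % m = r`. -/
theorem dvd_sub_pow_of_mod_eq {R : Type*} [CommRing R] {q x z : R} {m r k : ℕ}
    (hm : q ∣ x ^ m - 1) (hr : q ∣ z - x ^ r) (hk : k % m = r) : q ∣ z - x ^ k := by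
  have hpow : q ∣ (x ^ m) ^ (k / m) - 1 :=
    hm.trans (by simpa using sub_dvd_pow_sub_pow (x ^ m) 1 (k / m))
  have hsplit : x ^ k = x ^ r * (x ^ m) ^ (k / m) := by
    rw [← pow_mul, ← pow_add, ← hk, Nat.mod_add_div]
  have hz : z - x ^ k = (z - x ^ r) - x ^ r * ((x ^ m) ^ (k / m) - 1) := by
    rw [hsplit]; ring
  rw [hz]
  exact dvd_sub hr (hpow.mul_left _)

theorem odd_norm_of_one_add_I_dvd_sub_one {ζ : GaussianInt}
    (h : (⟨1, 1⟩ : GaussianInt) ∣ ζ - 1) : Odd (Zsqrtd.norm ζ) := by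
  obtain ⟨⟨a, b⟩, hab⟩ := h
  have hre : ζ.re = 1 + a - b := by
    have := congrArg Zsqrtd.re hab
    simp at this
    linarith
  have him : ζ.im = a + b := by
    have := congrArg Zsqrtd.im hab
    simp at this
    linarith
  refine ⟨a ^ 2 + b ^ 2 + a - b, ?_⟩
  rw [Zsqrtd.norm_def, hre, him]
  ring

theorem not_isUnit_of_mem_sixPrimes {q : GaussianInt} (hq : q ∈ sixPrimes) : ¬ IsUnit q := by
  rw [← Zsqrtd.norm_eq_one_iff]
  revert q
  decide

/-- The residue classes `0 mod 2`, `0 mod 3`, `1 mod 4`, `3 mod 8`, `7 mod 12`, `23 mod 24`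
cover the integers. -/
theorem covering_system (k : ℕ) :
    k % 2 = 0 ∨ k % 3 = 0 ∨ k % 4 = 1 ∨ k % 8 = 3 ∨ k % 12 = 7 ∨ k % 24 = 23 := by
  omega

/-- Any `ζ ∈ ℤ[i]` satisfying the seven congruences below has odd norm, every difference
`ζ - (1+i)^k` with `k ≥ 1` is divisible by one of the six primes `2+i`, `2+3i`, `1+2i`,
`3`, `3+2i`, `7`, and hence any representation `ζ = π + (1+i)^k` with `π` prime forces `π`
to be an associate of one of these six primes. -/
theorem gaussian_progression_not_representable (ζ : GaussianInt)
    (h1 : (⟨2, 1⟩ : GaussianInt) ∣ ζ - 1)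
    (h2 : (⟨2, 3⟩ : GaussianInt) ∣ ζ - 1)
    (h3 : (⟨1, 2⟩ : GaussianInt) ∣ ζ - ⟨1, 1⟩)
    (h4 : (⟨3, 0⟩ : GaussianInt) ∣ ζ - ⟨-2, 2⟩)
    (h5 : (⟨3, 2⟩ : GaussianInt) ∣ ζ - ⟨8, -8⟩)
    (h6 : (⟨7, 0⟩ : GaussianInt) ∣ ζ - ⟨2048, -2048⟩)
    (h7 : (⟨1, 1⟩ : GaussianInt) ∣ ζ - 1) :
    Odd (Zsqrtd.norm ζ) ∧
    (∀ k : ℕ, 1 ≤ k → ∃ q ∈ sixPrimes, q ∣ ζ - (⟨1, 1⟩ : GaussianInt) ^ k) ∧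
    (∀ (π : GaussianInt) (k : ℕ), Prime π → 1 ≤ k →
      ζ = π + (⟨1, 1⟩ : GaussianInt) ^ k → ∃ q ∈ sixPrimes, Associated π q) := by
  have hdvd : ∀ k : ℕ, ∃ q ∈ sixPrimes, q ∣ ζ - (⟨1, 1⟩ : GaussianInt) ^ k := by
    intro k
    rcases covering_system k with hk | hk | hk | hk | hk | hk
    · exact ⟨⟨2, 1⟩, by simp [sixPrimes],
        dvd_sub_pow_of_mod_eq ⟨⟨0, 1⟩, by decide⟩ h1 hk⟩
    · exact ⟨⟨2, 3⟩, by simp [sixPrimes],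
        dvd_sub_pow_of_mod_eq ⟨⟨0, 1⟩, by decide⟩ h2 hk⟩
    · exact ⟨⟨1, 2⟩, by simp [sixPrimes],
        dvd_sub_pow_of_mod_eq ⟨⟨-1, 2⟩, by decide⟩ h3 hk⟩
    · exact ⟨⟨3, 0⟩, by simp [sixPrimes],
        dvd_sub_pow_of_mod_eq ⟨⟨5, 0⟩, by decide⟩ h4 hk⟩
    · exact ⟨⟨3, 2⟩, by simp [sixPrimes],
        dvd_sub_pow_of_mod_eq ⟨⟨-15, 10⟩, by decide⟩ h5 hk⟩
    · exact ⟨⟨7, 0⟩, by simp [sixPrimes],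
        dvd_sub_pow_of_mod_eq ⟨⟨585, 0⟩, by decide⟩ h6 hk⟩
  refine ⟨odd_norm_of_one_add_I_dvd_sub_one h7, fun k _ => hdvd k, ?_⟩
  rintro π k hπ - rfl
  obtain ⟨q, hq, hqπ⟩ := hdvd k
  rw [add_sub_cancel_right] at hqπ
  exact ⟨q, hq, (hπ.irreducible.dvd_iff.mp hqπ).resolve_left (not_isUnit_of_mem_sixPrimes hq)⟩
end

section
/- Let $K$ be a number field of degree $n$ with ring of integers $\mathcal{O}_K$ and let $\xi \in \mathcal{O}_K$ be a nonzero non-unit. Then there exist a constant $C > 0$ and $x_0$ such that for all $x \ge x_0$, $\sum_{\zeta \in \mathcal{O}_K,\ \operatorname{house}(\zeta) \le x} r_x(\zeta,\xi)^2 \le C\, x^n$. -/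
open NumberField Filter

/-- `repCount ξ x ζ` is the number of pairs `(π, k)` with `π` a prime element of `𝒪_K`,
`k ≥ 1`, `ζ = π + ξ^k`, `house π ≤ x` and `k ≤ log(√x/2)/log(house ξ)`. -/
noncomputable def repCount {K : Type*} [Field K] [NumberField K]
    (ξ : 𝓞 K) (x : ℝ) (ζ : 𝓞 K) : ℕ :=
  Nat.card {pk : 𝓞 K × ℕ // Prime pk.1 ∧ 1 ≤ pk.2 ∧ ζ = pk.1 + ξ ^ pk.2 ∧
    house ((pk.1 : K)) ≤ x ∧
    (pk.2 : ℝ) ≤ Real.log (Real.sqrt x / 2) / Real.log (house (ξ : K))}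

section SelbergSieve

open Finset

variable {ι α : Type*} [DecidableEq ι]

/-- Alternating sum over an interval of finite sets. -/
lemma sum_Icc_neg_one_pow_card (E F : Finset ι) (h : E ⊆ F) :
    ∑ D ∈ Finset.Icc E F, (-1 : ℝ) ^ #D = if E = F then (-1) ^ #E else 0 := by
  rw [Finset.Icc_eq_image_powerset h, Finset.sum_image]
  · have h1 : ∀ D ∈ (F \ E).powerset, (-1 : ℝ) ^ #(E ∪ D) = (-1) ^ #E * (-1) ^ #D := by
      intro D hD
      rw [Finset.card_union_of_disjoint, pow_add]
      exact (Finset.disjoint_sdiff).mono_right (Finset.mem_powerset.1 hD)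
    rw [Finset.sum_congr rfl h1, ← Finset.mul_sum]
    have h2 := Finset.sum_powerset_neg_one_pow_card (x := F \ E)
    have h3 : ∑ D ∈ (F \ E).powerset, (-1 : ℝ) ^ #D = if F \ E = ∅ then 1 else 0 := by
      exact_mod_cast h2
    rw [h3]
    by_cases hEF : E = F
    · simp [hEF]
    · have : F \ E ≠ ∅ := fun h' => hEF (h.antisymm (Finset.sdiff_eq_empty_iff_subset.1 h'))
      simp [hEF, this]
  · intro D hD D' hD' hh
    have hD := Finset.mem_powerset.1 hD
    have hD' := Finset.mem_powerset.1 hD'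
    ext p
    have := congrArg (p ∈ ·) hh
    simp only [Finset.mem_union, eq_iff_iff] at this
    have a := @hD p
    have b := @hD' p
    simp only [Finset.mem_sdiff] at a b
    tauto

/-- The Selberg weights `λ_D g(D)` attached to a family `𝒟` of finite sets of primes. -/
noncomputable def selbergWeight (𝒟 : Finset (Finset ι)) (g : ι → ℝ) (D : Finset ι) : ℝ :=
  (-1) ^ #D * (∑ F ∈ 𝒟 with D ⊆ F, ∏ p ∈ F, g p / (1 - g p)) /
    ∑ F ∈ 𝒟, ∏ p ∈ F, g p / (1 - g p)

lemma sum_selbergWeight_superset {𝒟 : Finset (Finset ι)} {g : ι → ℝ}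
    (hdown : ∀ D ∈ 𝒟, ∀ E ⊆ D, E ∈ 𝒟) {E : Finset ι} (hE : E ∈ 𝒟) :
    ∑ D ∈ 𝒟 with E ⊆ D, selbergWeight 𝒟 g D =
      (-1) ^ #E * (∏ p ∈ E, g p / (1 - g p)) / ∑ F ∈ 𝒟, ∏ p ∈ F, g p / (1 - g p) := by
  unfold selbergWeight
  rw [← Finset.sum_div]
  congr 1
  simp_rw [Finset.mul_sum, Finset.sum_filter]
  have h1 : ∀ D ∈ 𝒟, (if E ⊆ D then ∑ F ∈ 𝒟, (if D ⊆ F then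
      (-1 : ℝ) ^ #D * ∏ p ∈ F, g p / (1 - g p) else 0) else 0) =
      ∑ F ∈ 𝒟, if E ⊆ D ∧ D ⊆ F then (-1 : ℝ) ^ #D * ∏ p ∈ F, g p / (1 - g p) else 0 := by
    intro D _
    split_ifs with h <;> simp [h]
  rw [Finset.sum_congr rfl h1, Finset.sum_comm]
  have h2 : ∀ F ∈ 𝒟, ∑ D ∈ 𝒟, (if E ⊆ D ∧ D ⊆ F then
      (-1 : ℝ) ^ #D * ∏ p ∈ F, g p / (1 - g p) else 0) =
      if F = E then (-1 : ℝ) ^ #E * ∏ p ∈ E, g p / (1 - g p) else 0 := by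
    intro F hF
    rw [← Finset.sum_filter]
    have : 𝒟.filter (fun D => E ⊆ D ∧ D ⊆ F) = Finset.Icc E F := by
      ext D
      simp only [Finset.mem_filter, Finset.mem_Icc]
      exact ⟨fun h => h.2, fun h => ⟨hdown F hF D h.2, h⟩⟩
    rw [this, ← Finset.sum_mul]
    by_cases hEF : E ⊆ F
    · rw [sum_Icc_neg_one_pow_card E F hEF]
      by_cases h : E = F
      · simp [h]
      · simp [h, Ne.symm h]
    · have : F ≠ E := fun h => hEF h.ge
      rw [Finset.Icc_eq_empty (by simpa using hEF)]
      simp [this]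
  rw [Finset.sum_congr rfl h2]
  simp [hE]

variable {𝒟 : Finset (Finset ι)} {g : ι → ℝ}

lemma prod_union_eq_sum (hg : ∀ D ∈ 𝒟, ∀ p ∈ D, 0 < g p ∧ g p < 1)
    (hdown : ∀ D ∈ 𝒟, ∀ E ⊆ D, E ∈ 𝒟) {D₁ D₂ : Finset ι} (h₁ : D₁ ∈ 𝒟) :
    ∏ p ∈ D₁ ∪ D₂, g p = ∑ E ∈ 𝒟, if E ⊆ D₁ ∧ E ⊆ D₂ then
      (∏ p ∈ D₁, g p) * (∏ p ∈ D₂, g p) * (∏ p ∈ E, g p / (1 - g p))⁻¹ else 0 := by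
  rw [← Finset.sum_filter]
  have : 𝒟.filter (fun E => E ⊆ D₁ ∧ E ⊆ D₂) = (D₁ ∩ D₂).powerset := by
    ext E
    simp only [Finset.mem_filter, Finset.mem_powerset, Finset.subset_inter_iff]
    exact ⟨fun h => h.2, fun h => ⟨hdown D₁ h₁ E h.1, h⟩⟩
  rw [this, ← Finset.mul_sum, ← Finset.prod_union_inter, mul_assoc]
  simp_rw [← Finset.prod_inv_distrib]
  rw [← Finset.prod_one_add, ← Finset.prod_mul_distrib]
  symm
  convert mul_one _
  apply Finset.prod_eq_one
  intro p hp
  obtain ⟨h0, h1⟩ := hg D₁ h₁ p (Finset.mem_inter.1 hp).1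
  have : 1 - g p ≠ 0 := by linarith
  field_simp
  ring

lemma selbergWeight_quadratic_form (hempty : ∅ ∈ 𝒟) (hdown : ∀ D ∈ 𝒟, ∀ E ⊆ D, E ∈ 𝒟)
    (hg : ∀ D ∈ 𝒟, ∀ p ∈ D, 0 < g p ∧ g p < 1) :
    ∑ D₁ ∈ 𝒟, ∑ D₂ ∈ 𝒟, (selbergWeight 𝒟 g D₁ / ∏ p ∈ D₁, g p) *
      (selbergWeight 𝒟 g D₂ / ∏ p ∈ D₂, g p) * ∏ p ∈ D₁ ∪ D₂, g p =
      (∑ F ∈ 𝒟, ∏ p ∈ F, g p / (1 - g p))⁻¹ := by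
  have hpos : ∀ D ∈ 𝒟, 0 < ∏ p ∈ D, g p := fun D hD => Finset.prod_pos fun p hp => (hg D hD p hp).1
  have hkpos : ∀ D ∈ 𝒟, 0 < ∏ p ∈ D, g p / (1 - g p) := fun D hD =>
    Finset.prod_pos fun p hp => div_pos (hg D hD p hp).1 (by linarith [(hg D hD p hp).2])
  have hG : 0 < ∑ F ∈ 𝒟, ∏ p ∈ F, g p / (1 - g p) := Finset.sum_pos hkpos ⟨_, hempty⟩
  set G := ∑ F ∈ 𝒟, ∏ p ∈ F, g p / (1 - g p) with hGdef
  have h1 : ∀ D₁ ∈ 𝒟, ∀ D₂ ∈ 𝒟, (selbergWeight 𝒟 g D₁ / ∏ p ∈ D₁, g p) *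
      (selbergWeight 𝒟 g D₂ / ∏ p ∈ D₂, g p) * ∏ p ∈ D₁ ∪ D₂, g p =
      ∑ E ∈ 𝒟, (∏ p ∈ E, g p / (1 - g p))⁻¹ * ((if E ⊆ D₁ then selbergWeight 𝒟 g D₁ else 0) *
        (if E ⊆ D₂ then selbergWeight 𝒟 g D₂ else 0)) := by
    intro D₁ h₁ D₂ h₂
    rw [prod_union_eq_sum hg hdown h₁, Finset.mul_sum]
    refine Finset.sum_congr rfl fun E _ => ?_
    have a := (hpos D₁ h₁).ne'
    have b := (hpos D₂ h₂).ne'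
    by_cases hE1 : E ⊆ D₁ <;> by_cases hE2 : E ⊆ D₂ <;> simp [hE1, hE2]
    field_simp
  rw [Finset.sum_congr rfl fun D₁ h₁ => Finset.sum_congr rfl fun D₂ h₂ => h1 D₁ h₁ D₂ h₂]
  simp_rw [Finset.sum_comm (s := 𝒟) (t := 𝒟) (f := fun D₂ E => (∏ p ∈ E, g p / (1 - g p))⁻¹ * _)]
  rw [Finset.sum_comm]
  simp_rw [← Finset.mul_sum, ← Finset.sum_mul, ← Finset.sum_filter]
  have h2 : ∀ E ∈ 𝒟, (∏ p ∈ E, g p / (1 - g p))⁻¹ *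
      ((∑ D ∈ 𝒟 with E ⊆ D, selbergWeight 𝒟 g D) * ∑ D ∈ 𝒟 with E ⊆ D, selbergWeight 𝒟 g D) =
      (∏ p ∈ E, g p / (1 - g p)) / G ^ 2 := by
    intro E hE
    rw [sum_selbergWeight_superset hdown hE, ← hGdef]
    have a := (hkpos E hE).ne'
    have s : ((-1 : ℝ) ^ #E) * (-1) ^ #E = 1 := by rw [← mul_pow]; simp
    calc _ = ((-1 : ℝ) ^ #E * (-1) ^ #E) * ((∏ p ∈ E, g p / (1 - g p))⁻¹ *
          (∏ p ∈ E, g p / (1 - g p))) * (∏ p ∈ E, g p / (1 - g p)) / G ^ 2 := by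
          field_simp
      _ = _ := by rw [s, inv_mul_cancel₀ a]; ring
  rw [Finset.sum_congr rfl h2, ← Finset.sum_div, ← hGdef]
  field_simp

open Classical in
/-- **Selberg's upper bound sieve**, for an arbitrary downward closed family `𝒟` of finite sets
of primes. -/
theorem selberg_sieve (hempty : ∅ ∈ 𝒟) (hdown : ∀ D ∈ 𝒟, ∀ E ⊆ D, E ∈ 𝒟)
    (hg : ∀ D ∈ 𝒟, ∀ p ∈ D, 0 < g p ∧ g p < 1) (A : Finset α) (Ω : ι → α → Prop) (X R : ℝ)
    (hR : ∀ D₁ ∈ 𝒟, ∀ D₂ ∈ 𝒟,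
      |(#{a ∈ A | ∀ p ∈ D₁ ∪ D₂, Ω p a} : ℝ) - X * ∏ p ∈ D₁ ∪ D₂, g p| ≤ R) :
    (#{a ∈ A | ∀ D ∈ 𝒟, ∀ p ∈ D, ¬ Ω p a} : ℝ) ≤
      X / (∑ F ∈ 𝒟, ∏ p ∈ F, g p / (1 - g p)) + R * (∑ D ∈ 𝒟, ∏ p ∈ D, (g p)⁻¹) ^ 2 := by
  have hpos : ∀ D ∈ 𝒟, 0 < ∏ p ∈ D, g p := fun D hD => Finset.prod_pos fun p hp => (hg D hD p hp).1
  have hkpos : ∀ D ∈ 𝒟, 0 < ∏ p ∈ D, g p / (1 - g p) := fun D hD =>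
    Finset.prod_pos fun p hp => div_pos (hg D hD p hp).1 (by linarith [(hg D hD p hp).2])
  have hG : 0 < ∑ F ∈ 𝒟, ∏ p ∈ F, g p / (1 - g p) := Finset.sum_pos hkpos ⟨_, hempty⟩
  set l : Finset ι → ℝ := fun D => selbergWeight 𝒟 g D / ∏ p ∈ D, g p with hl
  have hl0 : l ∅ = 1 := by
    simp only [hl, selbergWeight]
    simp only [Finset.empty_subset, Finset.filter_true, Finset.card_empty, pow_zero, one_mul,
      Finset.prod_empty, div_one]
    exact div_self hG.ne'
  have hlabs : ∀ D ∈ 𝒟, |l D| ≤ ∏ p ∈ D, (g p)⁻¹ := by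
    intro D hD
    simp only [hl, selbergWeight]
    rw [abs_div, abs_div, abs_mul, abs_pow, abs_neg, abs_one, one_pow, one_mul,
      Finset.prod_inv_distrib, div_eq_mul_inv _ (|∏ p ∈ D, g p|), abs_of_pos (hpos D hD)]
    refine mul_le_of_le_one_left (inv_nonneg.2 (hpos D hD).le) ?_
    rw [abs_of_pos hG, div_le_one hG, abs_of_nonneg]
    · exact Finset.sum_le_sum_of_subset_of_nonneg (Finset.filter_subset _ _)
        fun i hi _ => (hkpos i hi).le
    · exact Finset.sum_nonneg fun i hi => (hkpos i (Finset.mem_filter.1 hi).1).le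
  have hexp : ∀ a, (∑ D ∈ 𝒟, if ∀ p ∈ D, Ω p a then l D else 0) ^ 2 =
      ∑ D₁ ∈ 𝒟, ∑ D₂ ∈ 𝒟, l D₁ * l D₂ * (if ∀ p ∈ D₁ ∪ D₂, Ω p a then 1 else 0) := by
    intro a
    rw [sq, Finset.sum_mul_sum]
    refine Finset.sum_congr rfl fun D₁ _ => Finset.sum_congr rfl fun D₂ _ => ?_
    have : (∀ p ∈ D₁ ∪ D₂, Ω p a) ↔ (∀ p ∈ D₁, Ω p a) ∧ (∀ p ∈ D₂, Ω p a) := by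
      simp only [Finset.mem_union, or_imp, forall_and]
    simp only [this]
    split_ifs <;> first | tauto | simp
  calc (#{a ∈ A | ∀ D ∈ 𝒟, ∀ p ∈ D, ¬ Ω p a} : ℝ)
      = ∑ a ∈ A, if ∀ D ∈ 𝒟, ∀ p ∈ D, ¬ Ω p a then (1 : ℝ) else 0 := by
        rw [Finset.sum_boole]
    _ ≤ ∑ a ∈ A, (∑ D ∈ 𝒟, if ∀ p ∈ D, Ω p a then l D else 0) ^ 2 := by
        refine Finset.sum_le_sum fun a _ => ?_
        split_ifs with h
        · rw [Finset.sum_eq_single ∅]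
          · simp [hl0]
          · intro D hD hne
            obtain ⟨p, hp⟩ := Finset.nonempty_iff_ne_empty.2 hne
            exact if_neg fun h' => h D hD p hp (h' p hp)
          · exact fun h' => (h' hempty).elim
        · positivity
    _ = ∑ D₁ ∈ 𝒟, ∑ D₂ ∈ 𝒟, l D₁ * l D₂ * #{a ∈ A | ∀ p ∈ D₁ ∪ D₂, Ω p a} := by
        simp_rw [hexp]
        rw [Finset.sum_comm]
        refine Finset.sum_congr rfl fun D₁ _ => ?_
        rw [Finset.sum_comm]
        refine Finset.sum_congr rfl fun D₂ _ => ?_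
        rw [← Finset.mul_sum, Finset.sum_boole]
    _ ≤ ∑ D₁ ∈ 𝒟, ∑ D₂ ∈ 𝒟, (X * (l D₁ * l D₂ * ∏ p ∈ D₁ ∪ D₂, g p) +
          R * ((∏ p ∈ D₁, (g p)⁻¹) * ∏ p ∈ D₂, (g p)⁻¹)) := by
        refine Finset.sum_le_sum fun D₁ h₁ => Finset.sum_le_sum fun D₂ h₂ => ?_
        have h3 := hR D₁ h₁ D₂ h₂
        set N : ℝ := (#{a ∈ A | ∀ p ∈ D₁ ∪ D₂, Ω p a} : ℝ)
        have h4 : l D₁ * l D₂ * (N - X * ∏ p ∈ D₁ ∪ D₂, g p) ≤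
            R * ((∏ p ∈ D₁, (g p)⁻¹) * ∏ p ∈ D₂, (g p)⁻¹) := by
          refine (le_abs_self _).trans ?_
          rw [abs_mul, abs_mul, mul_comm R]
          have := hlabs D₁ h₁
          have := hlabs D₂ h₂
          gcongr
          exact mul_nonneg ((abs_nonneg _).trans (hlabs D₁ h₁)) ((abs_nonneg _).trans (hlabs D₂ h₂))
          exact (abs_nonneg _).trans (hlabs D₁ h₁)
        linarith
    _ = _ := by
        simp_rw [Finset.sum_add_distrib, ← Finset.mul_sum]
        rw [selbergWeight_quadratic_form hempty hdown hg, ← Finset.sum_mul, sq, div_eq_mul_inv]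

end SelbergSieve

section BoxEquidistribution

open Finset

variable {κ : Type*} [Fintype κ] [DecidableEq κ]

/-- The integer box `[b, b + L)^κ`. -/
noncomputable def intBox (κ : Type*) [Fintype κ] [DecidableEq κ] (b : ℤ) (L : ℕ) : Finset (κ → ℤ) :=
  Fintype.piFinset fun _ => Finset.Ico b (b + L)

lemma mem_intBox {b : ℤ} {L : ℕ} {v : κ → ℤ} :
    v ∈ intBox κ b L ↔ ∀ i, b ≤ v i ∧ v i < b + L := by
  simp [intBox]

lemma card_intBox (b : ℤ) (L : ℕ) : #(intBox κ b L) = L ^ Fintype.card κ := by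
  simp [intBox]

variable {G : Type*} [AddCommGroup G] [DecidableEq G]

lemma card_fiber_le_card_fiber {φ : (κ → ℤ) →+ G} (hφ : Function.Surjective φ) {M : ℕ}
    (hM : 0 < M) (hMG : ∀ c : G, M • c = 0) (b : ℤ) (L : ℕ) (c c' : G) :
    #{v ∈ intBox κ b L | φ v = c} ≤ #{v ∈ intBox κ b (L + M) | φ v = c'} := by
  obtain ⟨w, hw⟩ := hφ (c' - c)
  have hM' : (0 : ℤ) < M := by exact_mod_cast hM
  set t : κ → ℤ := fun i => w i % M with ht
  have htw : φ t = c' - c := by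
    have : w = t + M • (fun i => w i / M) := by
      ext i
      simp only [ht, Pi.add_apply, nsmul_eq_mul]
      exact (Int.emod_add_mul_ediv (w i) M).symm
    rw [← hw, this, map_add, map_nsmul, hMG, add_zero]
  refine Finset.card_le_card_of_injOn (fun v => v + t) ?_ (add_left_injective t).injOn
  intro v hv
  simp only [coe_filter, Set.mem_ofPred_eq, mem_intBox] at hv ⊢
  refine ⟨fun i => ?_, by rw [map_add, htw, hv.2]; abel⟩
  have h1 := Int.emod_nonneg (w i) hM'.ne'
  have h2 := Int.emod_lt_of_pos (w i) hM'
  have h3 := hv.1 i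
  simp only [Pi.add_apply, ht, Nat.cast_add]
  constructor <;> linarith

variable [Fintype G]

lemma sum_card_fiber (φ : (κ → ℤ) →+ G) (b : ℤ) (L : ℕ) :
    ∑ c : G, #{v ∈ intBox κ b L | φ v = c} = L ^ Fintype.card κ := by
  rw [← card_intBox (κ := κ) b L]
  exact (Finset.card_eq_sum_card_fiberwise fun _ _ => Finset.mem_univ _).symm

/-- Points of a box whose image under a homomorphism to a finite group lies in a given set. -/
lemma abs_card_box_preimage_sub_le {φ : (κ → ℤ) →+ G} (hφ : Function.Surjective φ) {M : ℕ}
    (hM : 0 < M) (hMG : ∀ c : G, M • c = 0) (b : ℤ) {L : ℕ} (hML : M ≤ L) (S : Finset G) :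
    |(#{v ∈ intBox κ b L | φ v ∈ S} : ℝ) - (L : ℝ) ^ Fintype.card κ * (#S / Fintype.card G)| ≤
      2 * Fintype.card κ * M * (2 * L) ^ (Fintype.card κ - 1) := by
  set n := Fintype.card κ
  have hG : (0 : ℝ) < Fintype.card G := by exact_mod_cast Fintype.card_pos
  have hup : ∀ c : G, (Fintype.card G : ℝ) * #{v ∈ intBox κ b L | φ v = c} ≤ (L + M : ℝ) ^ n := by
    intro c
    have := Finset.sum_le_sum fun (c' : G) (_ : c' ∈ Finset.univ) =>
      card_fiber_le_card_fiber hφ hM hMG b L c c'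
    rw [sum_card_fiber, Finset.sum_const, smul_eq_mul, Finset.card_univ] at this
    exact_mod_cast this
  have hlow : ∀ c : G, (L - M : ℝ) ^ n ≤ (Fintype.card G : ℝ) * #{v ∈ intBox κ b L | φ v = c} := by
    intro c
    have := Finset.sum_le_sum fun (c' : G) (_ : c' ∈ Finset.univ) =>
      card_fiber_le_card_fiber hφ hM hMG b (L - M) c' c
    rw [sum_card_fiber, Finset.sum_const, smul_eq_mul, Finset.card_univ, Nat.sub_add_cancel hML]
      at this
    rw [← Nat.cast_sub hML]
    exact_mod_cast this
  have hL0 : (M : ℝ) ≤ L := by exact_mod_cast hML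
  have hM0 : (0 : ℝ) < M := by exact_mod_cast hM
  have hcard : (#{v ∈ intBox κ b L | φ v ∈ S} : ℝ) =
      ∑ c ∈ S, (#{v ∈ intBox κ b L | φ v = c} : ℝ) := by
    rw [← Nat.cast_sum, Finset.card_eq_sum_card_fiberwise (f := φ) (t := S)]
    · congr 1
      refine Finset.sum_congr rfl fun c hc => ?_
      rw [Finset.filter_filter]
      congr 1
      refine Finset.filter_congr fun v _ => ⟨fun h => h.2, fun h => ⟨h ▸ hc, h⟩⟩
    · intro v hv
      exact (Finset.mem_filter.1 hv).2
  have hpt : ∀ c : G, |(#{v ∈ intBox κ b L | φ v = c} : ℝ) - (L : ℝ) ^ n / Fintype.card G| ≤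
      (2 * n * M * (2 * L) ^ (n - 1)) / Fintype.card G := by
    intro c
    have e1 := abs_pow_sub_pow_le (L + M : ℝ) (L : ℝ) n
    have e2 := abs_pow_sub_pow_le (L : ℝ) (L - M : ℝ) n
    have m1 : max |(L + M : ℝ)| |(L : ℝ)| ≤ 2 * L := by
      rw [abs_of_nonneg (by linarith), abs_of_nonneg (by linarith)]
      exact max_le (by linarith) (by linarith)
    have m2 : max |(L : ℝ)| |(L - M : ℝ)| ≤ 2 * L := by
      rw [abs_of_nonneg (by linarith), abs_of_nonneg (by linarith)]
      exact max_le (by linarith) (by linarith)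
    have a1 : |(L + M : ℝ) - L| = M := by rw [add_sub_cancel_left, abs_of_pos hM0]
    have a2 : |(L : ℝ) - (L - M)| = M := by rw [sub_sub_cancel, abs_of_pos hM0]
    rw [a1] at e1
    rw [a2] at e2
    have p1 : max |(L + M : ℝ)| |(L : ℝ)| ^ (n - 1) ≤ (2 * L) ^ (n - 1) := by gcongr
    have p2 : max |(L : ℝ)| |(L - M : ℝ)| ^ (n - 1) ≤ (2 * L) ^ (n - 1) := by gcongr
    have q1 : (M : ℝ) * n * max |(L + M : ℝ)| |(L : ℝ)| ^ (n - 1) ≤ M * n * (2 * L) ^ (n - 1) := by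
      gcongr
    have q2 : (M : ℝ) * n * max |(L : ℝ)| |(L - M : ℝ)| ^ (n - 1) ≤ M * n * (2 * L) ^ (n - 1) := by
      gcongr
    have r1 := (le_abs_self _).trans (e1.trans q1)
    have r2 := (le_abs_self _).trans (e2.trans q2)
    have h0 : (0 : ℝ) ≤ M * n * (2 * L) ^ (n - 1) := by positivity
    have u := hup c
    have l := hlow c
    rw [le_div_iff₀ hG, ← abs_of_pos hG, ← abs_mul, abs_of_pos hG, sub_mul, div_mul_cancel₀ _ hG.ne',
      abs_le]
    constructor <;> nlinarith
  have hS : (#S : ℝ) ≤ Fintype.card G := by exact_mod_cast Finset.card_le_univ S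
  calc _ = |∑ c ∈ S, ((#{v ∈ intBox κ b L | φ v = c} : ℝ) - (L : ℝ) ^ n / Fintype.card G)| := by
        rw [hcard, Finset.sum_sub_distrib, Finset.sum_const, nsmul_eq_mul]
        congr 2
        ring
    _ ≤ ∑ c ∈ S, (2 * n * M * (2 * L) ^ (n - 1)) / (Fintype.card G : ℝ) :=
        (Finset.abs_sum_le_sum_abs _ _).trans (Finset.sum_le_sum fun c _ => hpt c)
    _ = (2 * n * M * (2 * L) ^ (n - 1)) * (#S / Fintype.card G) := by
        rw [Finset.sum_const, nsmul_eq_mul]; ring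
    _ ≤ _ := mul_le_of_le_one_right (by positivity) ((div_le_one hG).2 hS)

end BoxEquidistribution

section PrimeIdeals

open Finset IsDedekindDomain

variable {K : Type*} [Field K] [NumberField K]

/-- The absolute norm of a prime ideal of the ring of integers. -/
noncomputable def primeNorm (v : HeightOneSpectrum (𝓞 K)) : ℕ := Ideal.absNorm v.asIdeal

lemma two_le_primeNorm (v : HeightOneSpectrum (𝓞 K)) : 2 ≤ primeNorm v := by
  have h0 : Ideal.absNorm v.asIdeal ≠ 0 := fun h => v.ne_bot (Ideal.absNorm_eq_zero_iff.1 h)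
  have h1 : Ideal.absNorm v.asIdeal ≠ 1 := fun h =>
    v.isPrime.ne_top (Ideal.absNorm_eq_one_iff.1 h)
  unfold primeNorm
  omega

lemma two_le_cast_primeNorm (v : HeightOneSpectrum (𝓞 K)) : (2 : ℝ) ≤ primeNorm v := by
  exact_mod_cast two_le_primeNorm v

lemma cast_primeNorm_pos (v : HeightOneSpectrum (𝓞 K)) : (0 : ℝ) < primeNorm v := by
  linarith [two_le_cast_primeNorm v]

lemma prod_asIdeal_dvd {I : Ideal (𝓞 K)} (B : Finset (HeightOneSpectrum (𝓞 K)))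
    (h : ∀ v ∈ B, v.asIdeal ∣ I) : ∏ v ∈ B, v.asIdeal ∣ I := by
  classical
  rw [← Finset.prod_image (f := fun J => J) (g := fun v : HeightOneSpectrum (𝓞 K) => v.asIdeal)]
  · refine Finset.prod_primes_dvd I ?_ ?_ <;>
    · intro J hJ
      obtain ⟨v, hv, rfl⟩ := Finset.mem_image.1 hJ
      first | exact v.prime | exact h v hv
  · exact fun v _ w _ hvw => HeightOneSpectrum.ext hvw

lemma prod_primeNorm_le {α : 𝓞 K} (hα : α ≠ 0) (B : Finset (HeightOneSpectrum (𝓞 K)))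
    (h : ∀ v ∈ B, α ∈ v.asIdeal) : ∏ v ∈ B, primeNorm v ≤ Ideal.absNorm (Ideal.span {α}) := by
  have h1 : ∏ v ∈ B, v.asIdeal ∣ Ideal.span {α} :=
    prod_asIdeal_dvd B fun v hv => Ideal.dvd_span_singleton.2 (h v hv)
  have h2 := map_dvd Ideal.absNorm h1
  rw [map_prod] at h2
  refine Nat.le_of_dvd (Nat.pos_of_ne_zero fun h0 => hα ?_) h2
  simpa using Ideal.absNorm_eq_zero_iff.1 h0

lemma finite_setOf_mem_asIdeal {α : 𝓞 K} (hα : α ≠ 0) :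
    {v : HeightOneSpectrum (𝓞 K) | α ∈ v.asIdeal}.Finite := by
  have := Ideal.finite_factors (I := Ideal.span {α}) (by simpa using hα)
  simpa only [Ideal.dvd_span_singleton] using this

open Classical in
/-- The prime ideals containing a given nonzero element. -/
noncomputable def primesOf (α : 𝓞 K) : Finset (HeightOneSpectrum (𝓞 K)) :=
  if hα : α ≠ 0 then (finite_setOf_mem_asIdeal hα).toFinset else ∅

lemma mem_primesOf {α : 𝓞 K} (hα : α ≠ 0) {v : HeightOneSpectrum (𝓞 K)} :
    v ∈ primesOf α ↔ α ∈ v.asIdeal := by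
  simp [primesOf, hα]

lemma finite_setOf_primeNorm_le (z : ℕ) :
    {v : HeightOneSpectrum (𝓞 K) | primeNorm v ≤ z}.Finite :=
  Set.Finite.of_finite_image (f := fun v => v.asIdeal)
    ((Ideal.finite_setOfPred_absNorm_le (S := 𝓞 K) z).subset (by rintro _ ⟨v, hv, rfl⟩; exact hv))
    fun _ _ _ _ h => HeightOneSpectrum.ext h

variable (K) in
/-- The prime ideals of norm at most `z`. -/
noncomputable def primesLE (z : ℕ) : Finset (HeightOneSpectrum (𝓞 K)) :=
  (finite_setOf_primeNorm_le z).toFinset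

@[simp] lemma mem_primesLE {z : ℕ} {v : HeightOneSpectrum (𝓞 K)} :
    v ∈ primesLE K z ↔ primeNorm v ≤ z := by
  simp [primesLE]

lemma primeNorm_le_prod {D : Finset (HeightOneSpectrum (𝓞 K))} {v : HeightOneSpectrum (𝓞 K)}
    (hv : v ∈ D) : primeNorm v ≤ ∏ w ∈ D, primeNorm w :=
  Finset.single_le_prod' (f := primeNorm) (fun w _ => (two_le_primeNorm w).trans' one_le_two) hv

variable (K) in
/-- Squarefree ideals of norm at most `z`, given as finite sets of primes. -/
noncomputable def sqfreeLE (z : ℕ) : Finset (Finset (HeightOneSpectrum (𝓞 K))) :=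
  {D ∈ (primesLE K z).powerset | ∏ v ∈ D, primeNorm v ≤ z}

lemma mem_sqfreeLE {z : ℕ} {D : Finset (HeightOneSpectrum (𝓞 K))} :
    D ∈ sqfreeLE K z ↔ ∏ v ∈ D, primeNorm v ≤ z := by
  simp only [sqfreeLE, Finset.mem_filter, Finset.mem_powerset, and_iff_right_iff_imp]
  exact fun h v hv => mem_primesLE.2 ((primeNorm_le_prod hv).trans h)

lemma prod_primeNorm_mono {D E : Finset (HeightOneSpectrum (𝓞 K))} (h : E ⊆ D) :
    ∏ v ∈ E, primeNorm v ≤ ∏ v ∈ D, primeNorm v :=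
  Finset.prod_le_prod_of_subset_of_one_le' h
    fun w _ _ => (two_le_primeNorm w).trans' one_le_two

open Classical in
/-- Number of points of an integer box (in coordinates of an integral basis) for which one of
`a`, `a + h` lies in each of the given prime ideals. -/
lemma abs_card_box_shift_sub_le (h : 𝓞 K) (D : Finset (HeightOneSpectrum (𝓞 K)))
    (hD : ∀ v ∈ D, h ∉ v.asIdeal) (b : ℤ) {L : ℕ} (hL : ∏ v ∈ D, primeNorm v ≤ L) :
    |(#{a ∈ intBox (Module.Free.ChooseBasisIndex ℤ (𝓞 K)) b L | ∀ v ∈ D,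
        (RingOfIntegers.basis K).equivFun.symm a ∈ v.asIdeal ∨
        (RingOfIntegers.basis K).equivFun.symm a + h ∈ v.asIdeal} : ℝ) -
      (L : ℝ) ^ Module.finrank ℚ K * ∏ v ∈ D, (2 / primeNorm v : ℝ)| ≤
      2 * Module.finrank ℚ K * (∏ v ∈ D, primeNorm v : ℕ) * (2 * L) ^ (Module.finrank ℚ K - 1) := by
  have hcard : Fintype.card (Module.Free.ChooseBasisIndex ℤ (𝓞 K)) = Module.finrank ℚ K := by
    rw [← Module.finrank_eq_card_chooseBasisIndex, RingOfIntegers.rank]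
  have hfin : ∀ v : D, Finite (𝓞 K ⧸ v.1.asIdeal) := fun v =>
    (Ideal.absNorm_ne_zero_iff _).1 (by have := two_le_primeNorm v.1; unfold primeNorm at this; omega)
  have := fun v : D => Fintype.ofFinite (𝓞 K ⧸ v.1.asIdeal)
  let φ : (Module.Free.ChooseBasisIndex ℤ (𝓞 K) → ℤ) →+ ((v : D) → 𝓞 K ⧸ v.1.asIdeal) :=
    (RingHom.toAddMonoidHom (RingHom.pi fun v : D => Ideal.Quotient.mk v.1.asIdeal)).comp
      (RingOfIntegers.basis K).equivFun.symm.toLinearMap.toAddMonoidHom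
  have hφapp : ∀ a v, φ a v = Ideal.Quotient.mk v.1.asIdeal
    ((RingOfIntegers.basis K).equivFun.symm a) := fun a v => rfl
  have hφ : Function.Surjective φ := by
    intro c
    obtain ⟨r, hr⟩ := Ideal.pi_quotient_surjective (I := fun v : D => v.1.asIdeal)
      (fun v w hvw => HeightOneSpectrum.isCoprime_of_ne v.1 w.1 fun h => hvw (Subtype.ext h)) c
    refine ⟨(RingOfIntegers.basis K).equivFun r, ?_⟩
    ext v
    rw [hφapp, LinearEquiv.symm_apply_apply]
    exact hr v
  have hM : 0 < ∏ v ∈ D, primeNorm v :=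
    Finset.prod_pos fun v _ => two_pos.trans_le (two_le_primeNorm v)
  have hMG : ∀ c : (v : D) → 𝓞 K ⧸ v.1.asIdeal, (∏ v ∈ D, primeNorm v) • c = 0 := by
    intro c
    ext v
    obtain ⟨r, hr⟩ := Ideal.Quotient.mk_surjective (c v)
    rw [Pi.smul_apply, ← hr, ← map_nsmul, Pi.zero_apply, Ideal.Quotient.eq_zero_iff_mem,
      nsmul_eq_mul]
    apply Ideal.mul_mem_right
    obtain ⟨q, hq⟩ := Finset.dvd_prod_of_mem primeNorm v.2
    rw [hq, Nat.cast_mul]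
    exact Ideal.mul_mem_right _ _ (Ideal.absNorm_mem _)
  have key := abs_card_box_preimage_sub_le hφ hM hMG b hL
    (Fintype.piFinset fun v : D => {0, -Ideal.Quotient.mk v.1.asIdeal h})
  rw [hcard] at key
  have hS : #(Fintype.piFinset fun v : D => {0, -Ideal.Quotient.mk v.1.asIdeal h}) = 2 ^ #D := by
    rw [Fintype.card_piFinset, Finset.prod_congr rfl (g := fun _ => 2)]
    · simp
    · intro v _
      refine Finset.card_pair fun h0 => hD v.1 v.2 ?_
      rw [eq_comm, neg_eq_zero, Ideal.Quotient.eq_zero_iff_mem] at h0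
      exact h0
  have hG : Fintype.card ((v : D) → 𝓞 K ⧸ v.1.asIdeal) = ∏ v ∈ D, primeNorm v := by
    rw [Fintype.card_pi, ← Finset.prod_coe_sort D primeNorm]
    refine Finset.prod_congr rfl fun v _ => ?_
    rw [primeNorm, Ideal.absNorm_apply, Submodule.cardQuot_apply, Nat.card_eq_fintype_card]
  have hfilter : {a ∈ intBox (Module.Free.ChooseBasisIndex ℤ (𝓞 K)) b L | ∀ v ∈ D,
        (RingOfIntegers.basis K).equivFun.symm a ∈ v.asIdeal ∨
        (RingOfIntegers.basis K).equivFun.symm a + h ∈ v.asIdeal} =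
      {a ∈ intBox (Module.Free.ChooseBasisIndex ℤ (𝓞 K)) b L | φ a ∈
        Fintype.piFinset fun v : D => {0, -Ideal.Quotient.mk v.1.asIdeal h}} := by
    refine Finset.filter_congr fun a _ => ?_
    rw [Fintype.mem_piFinset]
    simp only [Finset.mem_insert, Finset.mem_singleton, hφapp, Subtype.forall]
    refine forall₂_congr fun v hv => ?_
    rw [Ideal.Quotient.eq_zero_iff_mem, eq_neg_iff_add_eq_zero, ← map_add,
      Ideal.Quotient.eq_zero_iff_mem]
  rw [hfilter]
  convert key using 4
  rw [hS, hG, Finset.prod_div_distrib, Finset.prod_const]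
  push_cast
  rfl

end PrimeIdeals

section SieveDimension

open Finset IsDedekindDomain

lemma sum_le_sum_of_injOn {α β : Type*} {s : Finset α} {t : Finset β} {f : α → ℝ}
    {g : β → ℝ} (i : α → β) (hi : ∀ a ∈ s, i a ∈ t) (inj : Set.InjOn i s)
    (hfg : ∀ a ∈ s, f a ≤ g (i a)) (hg : ∀ b ∈ t, 0 ≤ g b) : ∑ a ∈ s, f a ≤ ∑ b ∈ t, g b := by
  classical
  calc ∑ a ∈ s, f a ≤ ∑ a ∈ s, g (i a) := Finset.sum_le_sum hfg
    _ = ∑ b ∈ s.image i, g b := (Finset.sum_image inj).symm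
    _ ≤ _ := Finset.sum_le_sum_of_subset_of_nonneg (Finset.image_subset_iff.2 hi)
        fun b hb _ => hg b hb

variable {ι : Type*} [DecidableEq ι]

/-- Removing finitely many primes from a sum of a multiplicative function over squarefree
numbers. -/
lemma sum_prod_le_prod_mul_sum_disjoint {𝒮 : Finset (Finset ι)}
    (hdown : ∀ D ∈ 𝒮, ∀ E ⊆ D, E ∈ 𝒮) {f : ι → ℝ} (hf : ∀ p, 0 ≤ f p) (B : Finset ι) :
    ∑ D ∈ 𝒮, ∏ p ∈ D, f p ≤ (∏ p ∈ B, (1 + f p)) * ∑ D ∈ 𝒮 with Disjoint D B, ∏ p ∈ D, f p := by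
  rw [Finset.prod_one_add, Finset.sum_mul_sum, ← Finset.sum_product']
  refine sum_le_sum_of_injOn (fun D => (D ∩ B, D \ B)) ?_ ?_ ?_ ?_
  · intro D hD
    simp only [Finset.mem_product, Finset.mem_powerset, Finset.mem_filter]
    exact ⟨Finset.inter_subset_right, hdown D hD _ Finset.sdiff_subset, Finset.sdiff_disjoint⟩
  · intro D _ E _ h
    simp only [Prod.mk.injEq] at h
    rw [← Finset.sdiff_union_inter D B, ← Finset.sdiff_union_inter E B, h.1, h.2]
  · intro D _
    exact (Finset.prod_inter_mul_prod_sdiff D B f).ge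
  · intro b _
    exact mul_nonneg (Finset.prod_nonneg fun p _ => hf p) (Finset.prod_nonneg fun p _ => hf p)

/-- The square of a sum of a multiplicative function over squarefree numbers. -/
lemma sq_sum_prod_le {𝒮 𝒯 : Finset (Finset ι)} (h𝒯 : ∀ D ∈ 𝒮, ∀ E ∈ 𝒮, D ∪ E ∈ 𝒯)
    {f : ι → ℝ} (hf : ∀ p, 0 ≤ f p) :
    (∑ D ∈ 𝒮, ∏ p ∈ D, f p) ^ 2 ≤ ∑ U ∈ 𝒯, ∏ p ∈ U, f p * (2 + f p) := by
  have h0 : ∀ D : Finset ι, 0 ≤ ∏ p ∈ D, f p := fun D => Finset.prod_nonneg fun p _ => hf p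
  have h1 : ∀ U : Finset ι, ∏ p ∈ U, f p * (2 + f p) =
      ∑ x ∈ U.powerset.sigma (fun D => D.powerset), (∏ p ∈ U, f p) * ∏ p ∈ x.2, f p := by
    intro U
    rw [Finset.prod_mul_distrib, ← Finset.mul_sum, Finset.sum_sigma]
    simp_rw [← Finset.prod_one_add]
    congr 1
    exact Finset.prod_congr rfl fun p _ => by ring
  simp_rw [h1]
  rw [Finset.sum_sigma', sq, Finset.sum_mul_sum, ← Finset.sum_product']
  refine sum_le_sum_of_injOn (fun x => ⟨x.1 ∪ x.2, ⟨x.1, x.1 ∩ x.2⟩⟩) ?_ ?_ ?_ ?_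
  · rintro ⟨D, E⟩ h
    simp only [Finset.mem_product] at h
    simp only [Finset.mem_sigma, Finset.mem_powerset]
    exact ⟨h𝒯 D h.1 E h.2, Finset.subset_union_left, Finset.inter_subset_left⟩
  · rintro ⟨D, E⟩ _ ⟨D', E'⟩ _ h
    simp only [Sigma.mk.injEq, heq_eq_eq] at h
    obtain ⟨h1, rfl, h3⟩ := h
    simp only [Prod.mk.injEq, true_and]
    ext p
    have a := congrArg (p ∈ ·) h1
    have b := congrArg (p ∈ ·) h3
    simp only [Finset.mem_union, Finset.mem_inter, eq_iff_iff] at a b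
    tauto
  · rintro ⟨D, E⟩ _
    exact (Finset.prod_union_inter).ge
  · intro x _
    exact mul_nonneg (h0 _) (h0 _)

variable {K : Type*} [Field K] [NumberField K]

variable (K) in
/-- The nonzero ideals of norm at most `z`. -/
noncomputable def idealsLE (z : ℕ) : Finset (Ideal (𝓞 K)) :=
  {I ∈ (Ideal.finite_setOfPred_absNorm_le (S := 𝓞 K) z).toFinset | Ideal.absNorm I ≠ 0}

lemma mem_idealsLE {z : ℕ} {I : Ideal (𝓞 K)} :
    I ∈ idealsLE K z ↔ Ideal.absNorm I ≤ z ∧ Ideal.absNorm I ≠ 0 := by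
  simp [idealsLE]

lemma ne_zero_of_mem_idealsLE {z : ℕ} {I : Ideal (𝓞 K)} (h : I ∈ idealsLE K z) : I ≠ 0 := by
  rintro rfl
  simp [mem_idealsLE] at h

open Classical in
/-- The set of prime ideals dividing an ideal. -/
noncomputable def primeSupport (I : Ideal (𝓞 K)) : Finset (HeightOneSpectrum (𝓞 K)) :=
  if hI : I ≠ 0 then (Ideal.finite_factors hI).toFinset else ∅

lemma mem_primeSupport {I : Ideal (𝓞 K)} (hI : I ≠ 0) {v : HeightOneSpectrum (𝓞 K)} :
    v ∈ primeSupport I ↔ v.asIdeal ∣ I := by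
  rw [primeSupport, dif_pos hI]
  simp

/-- The exponent of a prime ideal in the factorization of an ideal. -/
noncomputable def primeExponent (I : Ideal (𝓞 K)) (v : HeightOneSpectrum (𝓞 K)) : ℕ :=
  open Classical in (Associates.mk v.asIdeal).count (Associates.mk I).factors

lemma prod_pow_primeExponent {I : Ideal (𝓞 K)} (hI : I ≠ 0) :
    ∏ v ∈ primeSupport I, v.asIdeal ^ primeExponent I v = I := by
  classical
  conv_rhs => rw [← Ideal.finprod_heightOneSpectrum_factorization hI]
  rw [finprod_eq_prod_of_mulSupport_subset (s := primeSupport I)]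
  · rfl
  · intro v hv
    rw [Finset.mem_coe, mem_primeSupport hI, ← Associates.count_ne_zero_iff_dvd hI v.irreducible]
    intro h0
    refine hv ?_
    change v.asIdeal ^ _ = 1
    rw [h0, pow_zero]

lemma one_le_primeExponent {I : Ideal (𝓞 K)} (hI : I ≠ 0) {v : HeightOneSpectrum (𝓞 K)}
    (hv : v ∈ primeSupport I) : 1 ≤ primeExponent I v := by
  classical
  rw [mem_primeSupport hI, ← Associates.count_ne_zero_iff_dvd hI v.irreducible] at hv
  exact Nat.one_le_iff_ne_zero.2 hv

lemma prod_pow_primeNorm {I : Ideal (𝓞 K)} (hI : I ≠ 0) :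
    ∏ v ∈ primeSupport I, primeNorm v ^ primeExponent I v = Ideal.absNorm I := by
  conv_rhs => rw [← prod_pow_primeExponent hI]
  simp [primeNorm]

lemma primeExponent_le {z : ℕ} {I : Ideal (𝓞 K)} (hI : I ∈ idealsLE K z)
    {v : HeightOneSpectrum (𝓞 K)} (hv : v ∈ primeSupport I) : primeExponent I v ≤ z := by
  have hI0 := ne_zero_of_mem_idealsLE hI
  have h1 : primeNorm v ^ primeExponent I v ≤ Ideal.absNorm I := by
    rw [← prod_pow_primeNorm hI0]
    exact Finset.single_le_prod' (f := fun v => primeNorm v ^ primeExponent I v)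
      (fun w _ => Nat.one_le_pow _ _ (two_pos.trans_le (two_le_primeNorm w))) hv
  have h2 : 2 ^ primeExponent I v ≤ primeNorm v ^ primeExponent I v :=
    Nat.pow_le_pow_left (two_le_primeNorm v) _
  have h3 := Nat.lt_two_pow_self (n := primeExponent I v)
  have h4 := (mem_idealsLE.1 hI).1
  omega

lemma primeSupport_mem_sqfreeLE {z : ℕ} {I : Ideal (𝓞 K)} (hI : I ∈ idealsLE K z) :
    primeSupport I ∈ sqfreeLE K z := by
  have hI0 := ne_zero_of_mem_idealsLE hI
  rw [mem_sqfreeLE]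
  refine le_trans ?_ (mem_idealsLE.1 hI).1
  have h := map_dvd Ideal.absNorm
    (prod_asIdeal_dvd (primeSupport I) fun v hv => (mem_primeSupport hI0).1 hv)
  rw [map_prod] at h
  exact Nat.le_of_dvd (Nat.pos_of_ne_zero (mem_idealsLE.1 hI).2) h

lemma sum_inv_pow_le (v : HeightOneSpectrum (𝓞 K)) (z : ℕ) :
    ∑ j ∈ Finset.Icc 1 z, ((primeNorm v : ℝ)⁻¹) ^ j ≤ ((primeNorm v : ℝ) - 1)⁻¹ := by
  have h := two_le_cast_primeNorm v
  have h1 : (primeNorm v : ℝ)⁻¹ < 1 := inv_lt_one_of_one_lt₀ (by linarith)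
  have h2 := geom_sum_Ico_le_of_lt_one (m := 1) (n := z + 1) (x := (primeNorm v : ℝ)⁻¹)
    (by positivity) h1
  have h3 : Finset.Icc 1 z = Finset.Ico 1 (z + 1) := by ext; simp
  rw [h3]
  refine h2.trans (le_of_eq ?_)
  have : (primeNorm v : ℝ) - 1 ≠ 0 := by linarith
  field_simp
  
open Classical in
/-- Comparison of the harmonic sum over ideals with a sum over squarefree ideals. -/
lemma sum_inv_absNorm_le (z : ℕ) :
    ∑ I ∈ idealsLE K z, ((Ideal.absNorm I : ℝ))⁻¹ ≤
      ∑ D ∈ sqfreeLE K z, ∏ v ∈ D, ((primeNorm v : ℝ) - 1)⁻¹ := by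
  rw [← Finset.sum_fiberwise_of_maps_to (g := primeSupport) (t := sqfreeLE K z)
    fun I hI => primeSupport_mem_sqfreeLE hI]
  refine Finset.sum_le_sum fun D _ => ?_
  calc _ ≤ ∑ e ∈ Fintype.piFinset fun _ : D => Finset.Icc 1 z,
        ∏ v : D, ((primeNorm v.1 : ℝ)⁻¹) ^ (e v) := by
        refine sum_le_sum_of_injOn (fun I v => primeExponent I v.1) ?_ ?_ ?_ ?_
        · intro I hI
          obtain ⟨hI', hID⟩ := Finset.mem_filter.1 hI
          subst hID
          simp only [Fintype.mem_piFinset, Finset.mem_Icc]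
          exact fun v => ⟨one_le_primeExponent (ne_zero_of_mem_idealsLE hI') v.2,
            primeExponent_le hI' v.2⟩
        · intro I hI J hJ hIJ
          obtain ⟨hI', hID⟩ := Finset.mem_filter.1 hI
          obtain ⟨hJ', hJD⟩ := Finset.mem_filter.1 hJ
          have hIe := prod_pow_primeExponent (ne_zero_of_mem_idealsLE hI')
          have hJe := prod_pow_primeExponent (ne_zero_of_mem_idealsLE hJ')
          rw [hID] at hIe
          rw [hJD] at hJe
          rw [← hIe, ← hJe]
          refine Finset.prod_congr rfl fun v hv => ?_
          have hv' : primeExponent I v = primeExponent J v := congrFun hIJ ⟨v, hv⟩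
          exact congrArg _ hv'
        · intro I hI
          obtain ⟨hI', hID⟩ := Finset.mem_filter.1 hI
          subst hID
          rw [← prod_pow_primeNorm (ne_zero_of_mem_idealsLE hI'),
            Finset.prod_coe_sort (primeSupport I)
              (fun v => ((primeNorm v : ℝ)⁻¹) ^ primeExponent I v)]
          push_cast
          rw [← Finset.prod_inv_distrib]
          exact le_of_eq (Finset.prod_congr rfl fun v _ => (inv_pow _ _).symm)
        · intro e _
          positivity
    _ = ∏ v : D, ∑ j ∈ Finset.Icc 1 z, ((primeNorm v.1 : ℝ)⁻¹) ^ j :=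
        (Finset.prod_univ_sum _ _).symm
    _ ≤ ∏ v : D, ((primeNorm v.1 : ℝ) - 1)⁻¹ :=
        Finset.prod_le_prod (fun v _ => by positivity) fun v _ => sum_inv_pow_le v.1 z
    _ = _ := Finset.prod_coe_sort D fun v => ((primeNorm v : ℝ) - 1)⁻¹

end SieveDimension

section IdealCounts

open Finset IsDedekindDomain

variable (K : Type*) [Field K] [NumberField K]

lemma card_idealsLE_eq (z : ℕ) : #(idealsLE K z) =
    Nat.card {I : nonZeroDivisors (Ideal (𝓞 K)) // (Ideal.absNorm (I : Ideal (𝓞 K)) : ℝ) ≤ z} := by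
  rw [← Nat.card_eq_finsetCard]
  refine Nat.card_congr
    { toFun := fun I => ⟨⟨I.1, mem_nonZeroDivisors_of_ne_zero (ne_zero_of_mem_idealsLE I.2)⟩,
        by exact_mod_cast (mem_idealsLE.1 I.2).1⟩
      invFun := fun I => ⟨I.1.1, mem_idealsLE.2 ⟨by exact_mod_cast I.2,
        Ideal.absNorm_ne_zero_of_nonZeroDivisors I.1⟩⟩
      left_inv := fun _ => rfl
      right_inv := fun _ => rfl }

lemma idealsLE_mono {y z : ℕ} (h : y ≤ z) : idealsLE K y ⊆ idealsLE K z := fun I hI => by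
  rw [mem_idealsLE] at hI ⊢
  exact ⟨hI.1.trans h, hI.2⟩

lemma exists_card_idealsLE_bounds : ∃ c : ℝ, 0 < c ∧ ∃ C : ℝ, 0 < C ∧ ∀ z : ℕ, 1 ≤ z →
    c * z ≤ #(idealsLE K z) ∧ (#(idealsLE K z) : ℝ) ≤ C * z := by
  have hlim := (NumberField.Ideal.tendsto_norm_le_div_atTop₀ K).comp tendsto_natCast_atTop_atTop
  set κ := ((2 ^ InfinitePlace.nrRealPlaces K * (2 * Real.pi) ^ InfinitePlace.nrComplexPlaces K *
    Units.regulator K * classNumber K) / (Units.torsionOrder K * Real.sqrt |discr K|)) with hκ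
  have hκ0 : 0 < κ := by
    have h1 := Units.regulator_pos K
    have h2 : (0 : ℝ) < classNumber K := by exact_mod_cast Nat.pos_of_ne_zero (classNumber_ne_zero K)
    have h3 : (0 : ℝ) < Units.torsionOrder K := by
      exact_mod_cast Nat.pos_of_ne_zero (Units.torsionOrder_ne_zero K)
    have h4 : (0 : ℝ) < |(discr K : ℝ)| := by
      simpa using discr_ne_zero K
    have := Real.pi_pos
    rw [hκ]
    positivity
  obtain ⟨z₀, hz₀⟩ := eventually_atTop.1 (hlim.eventually
    (Ioo_mem_nhds (show κ / 2 < κ by linarith) (show κ < 2 * κ by linarith)))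
  have hpos : ∀ z : ℕ, 1 ≤ z → 1 ≤ #(idealsLE K z) := fun z hz =>
    Finset.card_pos.2 ⟨1, by simp [mem_idealsLE, hz]⟩
  refine ⟨min (κ / 2) (1 / (z₀ + 1)), by positivity, 2 * κ + #(idealsLE K z₀), by positivity,
    fun z hz => ?_⟩
  have hz1 : (1 : ℝ) ≤ z := by exact_mod_cast hz
  rcases le_or_gt z₀ z with h | h
  · obtain ⟨h1, h2⟩ := hz₀ z h
    simp only [Function.comp_apply, ← card_idealsLE_eq] at h1 h2
    rw [lt_div_iff₀ (by linarith)] at h1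
    rw [div_lt_iff₀ (by linarith)] at h2
    refine ⟨(mul_le_mul_of_nonneg_right (min_le_left _ _) (by linarith)).trans h1.le,
      h2.le.trans ?_⟩
    gcongr
    linarith [(Nat.cast_nonneg #(idealsLE K z₀) : (0 : ℝ) ≤ _)]
  · have hzz : (z : ℝ) ≤ z₀ := by exact_mod_cast h.le
    have hp : (1 : ℝ) ≤ #(idealsLE K z) := by exact_mod_cast hpos z hz
    have hm : (#(idealsLE K z) : ℝ) ≤ #(idealsLE K z₀) := by
      exact_mod_cast Finset.card_le_card (idealsLE_mono K h.le)
    constructor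
    · refine (mul_le_mul_of_nonneg_right (min_le_right _ _) (by linarith)).trans (le_trans ?_ hp)
      rw [one_div, inv_mul_le_iff₀ (by positivity)]
      linarith
    · nlinarith

lemma sum_Icc_inv_mul_succ (m z : ℕ) (hm : 1 ≤ m) (hmz : m ≤ z + 1) :
    ∑ t ∈ Finset.Icc m z, ((t : ℝ) * (t + 1))⁻¹ = (m : ℝ)⁻¹ - ((z : ℝ) + 1)⁻¹ := by
  have hm0 : (0 : ℝ) < m := by exact_mod_cast hm
  induction z with
  | zero =>
    obtain rfl : m = 1 := by omega
    simp
  | succ z ih =>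
    rcases Nat.lt_or_ge (z + 1) m with h | h
    · obtain rfl : m = z + 1 + 1 := by omega
      simp
    · rw [Finset.sum_Icc_succ_top h, ih h]
      push_cast
      field_simp
      ring

/-- The harmonic sum over ideals grows at least logarithmically. -/
lemma exists_log_le_sum_inv_absNorm : ∃ c : ℝ, 0 < c ∧ ∀ z : ℕ,
    c * Real.log z ≤ ∑ I ∈ idealsLE K z, ((Ideal.absNorm I : ℝ))⁻¹ := by
  obtain ⟨c, hc, C, -, h⟩ := exists_card_idealsLE_bounds K
  refine ⟨c / 2, by positivity, fun z => ?_⟩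
  have h1 : ∀ I ∈ idealsLE K z, ∑ t ∈ Finset.Icc 1 z with Ideal.absNorm I ≤ t,
      ((t : ℝ) * (t + 1))⁻¹ ≤ ((Ideal.absNorm I : ℝ))⁻¹ := by
    intro I hI
    rw [mem_idealsLE] at hI
    have : {t ∈ Finset.Icc 1 z | Ideal.absNorm I ≤ t} = Finset.Icc (Ideal.absNorm I) z := by
      ext t
      simp only [Finset.mem_filter, Finset.mem_Icc]
      omega
    rw [this, sum_Icc_inv_mul_succ _ _ (by omega) (by omega)]
    have : (0 : ℝ) ≤ ((z : ℝ) + 1)⁻¹ := by positivity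
    linarith
  refine le_trans ?_ (Finset.sum_le_sum h1)
  have h2 : ∑ I ∈ idealsLE K z, ∑ t ∈ Finset.Icc 1 z with Ideal.absNorm I ≤ t,
      ((t : ℝ) * (t + 1))⁻¹ = ∑ t ∈ Finset.Icc 1 z, #(idealsLE K t) * ((t : ℝ) * (t + 1))⁻¹ := by
    simp_rw [Finset.sum_filter]
    rw [Finset.sum_comm]
    refine Finset.sum_congr rfl fun t ht => ?_
    rw [← Finset.sum_filter, Finset.sum_const, nsmul_eq_mul]
    congr 3
    ext I
    simp only [Finset.mem_filter, mem_idealsLE]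
    rw [Finset.mem_Icc] at ht
    constructor
    · tauto
    · exact fun h => ⟨⟨h.1.trans ht.2, h.2⟩, h.1⟩
  rw [h2]
  have h3 : Real.log z ≤ ∑ t ∈ Finset.Icc 1 z, ((t : ℝ))⁻¹ := by
    have := log_le_harmonic_floor (z : ℝ) (by positivity)
    simpa [harmonic_eq_sum_Icc] using this
  calc c / 2 * Real.log z ≤ c / 2 * ∑ t ∈ Finset.Icc 1 z, ((t : ℝ))⁻¹ := by gcongr
    _ = ∑ t ∈ Finset.Icc 1 z, c / 2 * ((t : ℝ))⁻¹ := Finset.mul_sum _ _ _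
    _ ≤ _ := by
      refine Finset.sum_le_sum fun t ht => ?_
      rw [Finset.mem_Icc] at ht
      have ht1 : (1 : ℝ) ≤ t := by exact_mod_cast ht.1
      refine le_trans ?_ (mul_le_mul_of_nonneg_right (h t ht.1).1 (by positivity))
      rw [mul_inv, mul_assoc, mul_inv_cancel_left₀ (by positivity), div_mul_eq_mul_div,
        div_eq_mul_inv, mul_assoc]
      gcongr
      rw [← mul_inv]
      gcongr
      linarith

lemma card_sqfreeLE_le (z : ℕ) : #(sqfreeLE K z) ≤ #(idealsLE K z) := by
  classical
  refine Finset.card_le_card_of_injOn (fun D => ∏ v ∈ D, v.asIdeal) ?_ ?_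
  · intro D hD
    rw [Finset.mem_coe, mem_sqfreeLE] at hD
    rw [Finset.mem_coe, mem_idealsLE, map_prod]
    exact ⟨hD, Finset.prod_ne_zero_iff.2 fun v _ => by
      have := two_le_primeNorm v; unfold primeNorm at this; omega⟩
  · have key : ∀ (D : Finset (HeightOneSpectrum (𝓞 K))) v, v ∈ D ↔
        v.asIdeal ∣ ∏ w ∈ D, w.asIdeal := by
      intro D v
      refine ⟨fun h => Finset.dvd_prod_of_mem _ h, fun h => ?_⟩
      obtain ⟨w, hw, hvw⟩ := (Prime.dvd_finsetProd_iff v.prime _).1 h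
      have : w.asIdeal = v.asIdeal :=
        w.isMaximal.eq_of_le v.isPrime.ne_top (Ideal.dvd_iff_le.1 hvw)
      rwa [← HeightOneSpectrum.ext this]
    intro D _ E _ hDE
    ext v
    rw [key, key]
    exact iff_of_eq (congrArg _ hDE)

open Classical in
/-- Lower bound for the main term of the two-dimensional sieve. -/
lemma exists_sq_log_le_sieve_sum : ∃ c : ℝ, 0 < c ∧ ∀ (B : Finset (HeightOneSpectrum (𝓞 K))),
    (∀ v, primeNorm v ≤ 2 → v ∈ B) → ∀ z : ℕ, c * Real.log z ^ 2 ≤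
      (∏ v ∈ B, (1 + ((primeNorm v : ℝ) - 1)⁻¹) ^ 2) *
        ∑ D ∈ sqfreeLE K (z ^ 2) with Disjoint D B,
          ∏ v ∈ D, (2 / primeNorm v : ℝ) / (1 - 2 / primeNorm v) := by
  obtain ⟨c, hc, h⟩ := exists_log_le_sum_inv_absNorm K
  refine ⟨c ^ 2, by positivity, fun B hB z => ?_⟩
  have hf : ∀ v : HeightOneSpectrum (𝓞 K), 0 ≤ ((primeNorm v : ℝ) - 1)⁻¹ := fun v => by
    have := two_le_cast_primeNorm v
    exact inv_nonneg.2 (by linarith)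
  have h1 := (h z).trans ((sum_inv_absNorm_le z).trans (sum_prod_le_prod_mul_sum_disjoint
    (fun D hD E hE => by
      rw [mem_sqfreeLE] at hD ⊢
      exact (prod_primeNorm_mono hE).trans hD) hf B))
  rw [← mul_pow]
  have h2 := pow_le_pow_left₀ (mul_nonneg hc.le (Real.log_natCast_nonneg z)) h1 2
  refine h2.trans ?_
  rw [mul_pow, Finset.prod_pow]
  refine mul_le_mul_of_nonneg_left ?_ (sq_nonneg _)
  refine (sq_sum_prod_le (𝒯 := {D ∈ sqfreeLE K (z ^ 2) | Disjoint D B}) ?_ hf).trans ?_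
  · intro D hD E hE
    rw [Finset.mem_filter, mem_sqfreeLE] at hD hE ⊢
    refine ⟨?_, Finset.disjoint_union_left.2 ⟨hD.2, hE.2⟩⟩
    calc ∏ v ∈ D ∪ E, primeNorm v ≤ (∏ v ∈ D ∪ E, primeNorm v) * ∏ v ∈ D ∩ E, primeNorm v :=
          Nat.le_mul_of_pos_right _ (Finset.prod_pos fun v _ => two_pos.trans_le (two_le_primeNorm v))
      _ = (∏ v ∈ D, primeNorm v) * ∏ v ∈ E, primeNorm v := Finset.prod_union_inter
      _ ≤ z ^ 2 := by rw [sq]; exact Nat.mul_le_mul hD.1 hE.1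
  · refine Finset.sum_le_sum fun D hD => Finset.prod_le_prod
      (fun v _ => mul_nonneg (hf v) (by linarith [hf v])) fun v hv => ?_
    have hvB : v ∉ B := Finset.disjoint_left.1 (Finset.mem_filter.1 hD).2 hv
    have h3 : (3 : ℝ) ≤ primeNorm v := by
      have : 3 ≤ primeNorm v := by
        by_contra h
        exact hvB (hB v (by omega))
      exact_mod_cast this
    have e1 : (2 / primeNorm v : ℝ) / (1 - 2 / primeNorm v) = 2 / ((primeNorm v : ℝ) - 2) := by
      have : (primeNorm v : ℝ) - 2 ≠ 0 := by linarith
      have : (primeNorm v : ℝ) ≠ 0 := by linarith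
      field_simp
    have e2 : ((primeNorm v : ℝ) - 1)⁻¹ * (2 + ((primeNorm v : ℝ) - 1)⁻¹) =
        (2 * (primeNorm v : ℝ) - 1) / ((primeNorm v : ℝ) - 1) ^ 2 := by
      have : (primeNorm v : ℝ) - 1 ≠ 0 := by linarith
      field_simp
      ring
    rw [e1, e2, div_le_div_iff₀ (by nlinarith) (by linarith)]
    nlinarith

end IdealCounts

section PrimePairs

open Finset IsDedekindDomain

lemma card_le_of_abs_sub_le {S : Finset ℤ} {T : ℝ} (hT : 0 ≤ T)
    (h : ∀ s ∈ S, ∀ t ∈ S, |(s : ℝ) - t| ≤ T) : (#S : ℝ) ≤ T + 1 := by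
  rcases S.eq_empty_or_nonempty with rfl | hS
  · simp
    linarith
  have h1 : S ⊆ Finset.Icc (S.min' hS) (S.max' hS) := fun s hs =>
    Finset.mem_Icc.2 ⟨S.min'_le s hs, S.le_max' s hs⟩
  have h2 := Finset.card_le_card h1
  rw [Int.card_Icc] at h2
  have h3 : S.min' hS ≤ S.max' hS := S.min'_le _ (S.max'_mem hS)
  have h4 := (le_abs_self _).trans (h _ (S.max'_mem hS) _ (S.min'_mem hS))
  have h5 : ((#S : ℕ) : ℤ) ≤ S.max' hS + 1 - S.min' hS := by omega
  have h6 : ((#S : ℕ) : ℝ) ≤ S.max' hS + 1 - S.min' hS := by exact_mod_cast h5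
  linarith

variable (K : Type*) [Field K] [NumberField K]

lemma card_chooseBasisIndex :
    Fintype.card (Module.Free.ChooseBasisIndex ℤ (𝓞 K)) = Module.finrank ℚ K := by
  rw [← Module.finrank_eq_card_chooseBasisIndex, RingOfIntegers.rank]

open Classical in
/-- In a box, few points have a given conjugate near a given point. -/
lemma card_box_embedding_le (σ : K →+* ℂ) (i₀ : Module.Free.ChooseBasisIndex ℤ (𝓞 K))
    (h : 𝓞 K) (b : ℤ) (L : ℕ) {y : ℝ} (hy : 0 ≤ y) :
    (#{a ∈ intBox (Module.Free.ChooseBasisIndex ℤ (𝓞 K)) b L |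
        ‖σ ((RingOfIntegers.basis K).equivFun.symm a + h : 𝓞 K)‖ ≤ y} : ℝ) ≤
      (2 * y / ‖σ (RingOfIntegers.basis K i₀ : 𝓞 K)‖ + 1) * (L : ℝ) ^ (Module.finrank ℚ K - 1) := by
  set w := σ (RingOfIntegers.basis K i₀ : 𝓞 K) with hw
  have hw0 : 0 < ‖w‖ := by
    rw [norm_pos_iff, hw, map_ne_zero]
    exact_mod_cast (RingOfIntegers.basis K).ne_zero i₀
  set S := {a ∈ intBox (Module.Free.ChooseBasisIndex ℤ (𝓞 K)) b L |
        ‖σ ((RingOfIntegers.basis K).equivFun.symm a + h : 𝓞 K)‖ ≤ y} with hS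
  set T := Fintype.piFinset (fun i : Module.Free.ChooseBasisIndex ℤ (𝓞 K) =>
    if i = i₀ then {0} else Finset.Ico b (b + L)) with hTdef
  have hT : #T = L ^ (Module.finrank ℚ K - 1) := by
    rw [hTdef, Fintype.card_piFinset, ← Finset.mul_prod_erase _ _ (Finset.mem_univ i₀),
      Finset.prod_congr rfl (g := fun _ => L)]
    · simp [Finset.card_erase_of_mem, card_chooseBasisIndex]
    · intro i hi
      simp [Finset.ne_of_mem_erase hi]
  have hmaps : ∀ a ∈ S, Function.update a i₀ 0 ∈ T := by
    intro a ha
    have ha' := mem_intBox.1 (Finset.mem_filter.1 ha).1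
    rw [hTdef, Fintype.mem_piFinset]
    intro i
    by_cases hi : i = i₀
    · subst hi; simp
    · simpa [hi] using ha' i
  have hfib : ∀ f ∈ T, (#{a ∈ S | Function.update a i₀ 0 = f} : ℝ) ≤ 2 * y / ‖w‖ + 1 := by
    intro f _
    have hinj : Set.InjOn (fun a : Module.Free.ChooseBasisIndex ℤ (𝓞 K) → ℤ => a i₀)
        ({a ∈ S | Function.update a i₀ 0 = f} : Finset _) := by
      intro a ha a' ha' h
      have e := (Finset.mem_filter.1 ha).2.trans (Finset.mem_filter.1 ha').2.symm
      ext i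
      by_cases hi : i = i₀
      · rw [hi]; exact h
      · simpa [hi] using congrFun e i
    rw [← Finset.card_image_of_injOn hinj]
    refine card_le_of_abs_sub_le (by positivity) ?_
    simp only [Finset.mem_image]
    rintro _ ⟨a, ha, rfl⟩ _ ⟨a', ha', rfl⟩
    obtain ⟨haS, haf⟩ := Finset.mem_filter.1 ha
    obtain ⟨haS', haf'⟩ := Finset.mem_filter.1 ha'
    have e1 := (Finset.mem_filter.1 haS).2
    have e2 := (Finset.mem_filter.1 haS').2
    have e := haf.trans haf'.symm
    have e3 : a - a' = (a i₀ - a' i₀) • Pi.single i₀ 1 := by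
      ext i
      by_cases hi : i = i₀
      · subst hi; simp
      · have := congrFun e i
        simp only [hi, ne_eq, not_false_eq_true, Function.update_of_ne] at this
        simp [hi, this]
    have e4 : (RingOfIntegers.basis K).equivFun.symm a - (RingOfIntegers.basis K).equivFun.symm a'
        = (a i₀ - a' i₀) • RingOfIntegers.basis K i₀ := by
      rw [← map_sub, e3, map_zsmul]
      simp [Module.Basis.equivFun_symm_apply, Pi.single_apply]
    have e5 : ((a i₀ : ℂ) - a' i₀) * w =
        σ ((RingOfIntegers.basis K).equivFun.symm a + h : 𝓞 K) -
        σ ((RingOfIntegers.basis K).equivFun.symm a' + h : 𝓞 K) := by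
      rw [← map_sub, ← map_sub, add_sub_add_right_eq_sub, e4]
      simp [hw]
    have e6 : |(a i₀ : ℝ) - a' i₀| * ‖w‖ ≤ 2 * y := by
      have : ‖((a i₀ : ℂ) - a' i₀) * w‖ = |(a i₀ : ℝ) - a' i₀| * ‖w‖ := by
        rw [norm_mul]
        congr 1
        rw [← Real.norm_eq_abs, ← Complex.norm_real]
        simp
      rw [← this, e5]
      exact (norm_sub_le _ _).trans (by linarith)
    rwa [le_div_iff₀ hw0]
  have h1 : (#S : ℝ) = ∑ f ∈ T, (#{a ∈ S | Function.update a i₀ 0 = f} : ℝ) := by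
    exact_mod_cast Finset.card_eq_sum_card_fiberwise hmaps
  rw [h1]
  refine (Finset.sum_le_sum hfib).trans ?_
  rw [Finset.sum_const, hT, nsmul_eq_mul]
  push_cast
  rw [mul_comm]

open Classical in
lemma exists_card_box_small_conjugate_le : ∃ C : ℝ, 0 < C ∧ ∀ (h : 𝓞 K) (b : ℤ) (L : ℕ) (y : ℝ),
    1 ≤ y → (#{a ∈ intBox (Module.Free.ChooseBasisIndex ℤ (𝓞 K)) b L |
        ∃ σ : K →+* ℂ, ‖σ ((RingOfIntegers.basis K).equivFun.symm a + h : 𝓞 K)‖ ≤ y} : ℝ) ≤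
      C * y * (L : ℝ) ^ (Module.finrank ℚ K - 1) := by
  obtain ⟨i₀⟩ : Nonempty (Module.Free.ChooseBasisIndex ℤ (𝓞 K)) := by
    rw [← Fintype.card_pos_iff, card_chooseBasisIndex]
    exact Module.finrank_pos
  refine ⟨∑ σ : K →+* ℂ, (2 / ‖σ (RingOfIntegers.basis K i₀ : 𝓞 K)‖ + 1), by
    exact Finset.sum_pos (fun σ _ => by positivity) Finset.univ_nonempty, fun h b L y hy => ?_⟩
  have h1 : {a ∈ intBox (Module.Free.ChooseBasisIndex ℤ (𝓞 K)) b L |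
        ∃ σ : K →+* ℂ, ‖σ ((RingOfIntegers.basis K).equivFun.symm a + h : 𝓞 K)‖ ≤ y} ⊆
      Finset.univ.biUnion fun σ : K →+* ℂ =>
        {a ∈ intBox (Module.Free.ChooseBasisIndex ℤ (𝓞 K)) b L |
          ‖σ ((RingOfIntegers.basis K).equivFun.symm a + h : 𝓞 K)‖ ≤ y} := by
    intro a ha
    obtain ⟨ha, σ, hσ⟩ := Finset.mem_filter.1 ha
    exact Finset.mem_biUnion.2 ⟨σ, Finset.mem_univ _, Finset.mem_filter.2 ⟨ha, hσ⟩⟩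
  have h2 := (Finset.card_le_card h1).trans Finset.card_biUnion_le
  refine (Nat.cast_le (α := ℝ).2 h2).trans ?_
  push_cast
  rw [Finset.sum_mul, Finset.sum_mul]
  refine Finset.sum_le_sum fun σ _ => ?_
  refine (card_box_embedding_le K σ i₀ h b L (by linarith)).trans ?_
  gcongr
  have : (0 : ℝ) ≤ 2 / ‖σ (RingOfIntegers.basis K i₀ : 𝓞 K)‖ := by positivity
  rw [add_mul, mul_div_right_comm]
  linarith

variable {K}

lemma absNorm_span_eq_prod_norm (α : 𝓞 K) :
    (Ideal.absNorm (Ideal.span {α}) : ℝ) = ∏ σ : K →+* ℂ, ‖σ (α : K)‖ := by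
  have h1 := Algebra.norm_eq_prod_embeddings ℚ ℂ (α : K)
  rw [← Algebra.coe_norm_int] at h1
  have h2 := congrArg norm h1
  rw [norm_prod, eq_ratCast, Rat.cast_intCast, Complex.norm_intCast] at h2
  rw [Ideal.absNorm_span_singleton, Nat.cast_natAbs, Int.cast_abs, h2]
  exact Fintype.prod_equiv (RingHom.equivRatAlgHom K ℂ).symm _ _ fun _ => rfl

/-- A prime element lying in a prime ideal of small norm has a small conjugate. -/
lemma exists_norm_embedding_le_of_prime {π : 𝓞 K} (hπ : Prime π) {v : HeightOneSpectrum (𝓞 K)}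
    (hv : π ∈ v.asIdeal) {y : ℕ} (hy : primeNorm v ≤ y) : ∃ σ : K →+* ℂ, ‖σ (π : K)‖ ≤ y := by
  have h1 : (Ideal.span {π}).IsPrime := (Ideal.span_singleton_prime hπ.ne_zero).2 hπ
  have h2 : (Ideal.span {π}).IsMaximal := h1.isMaximal (by simpa using hπ.ne_zero)
  have h3 : Ideal.span {π} = v.asIdeal :=
    h2.eq_of_le v.isPrime.ne_top ((Ideal.span_singleton_le_iff_mem _).2 hv)
  by_contra! hσ
  have hy1 : (1 : ℝ) ≤ y := by
    exact_mod_cast (one_le_two.trans (two_le_primeNorm v)).trans hy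
  have h4 : ((primeNorm v : ℕ) : ℝ) = ∏ σ : K →+* ℂ, ‖σ (π : K)‖ := by
    rw [primeNorm, ← h3, absNorm_span_eq_prod_norm]
  obtain ⟨σ₀⟩ := (inferInstance : Nonempty (K →+* ℂ))
  have h5 : ‖σ₀ (π : K)‖ ≤ ∏ σ : K →+* ℂ, ‖σ (π : K)‖ := by
    classical
    rw [← Finset.mul_prod_erase _ _ (Finset.mem_univ σ₀)]
    refine le_mul_of_one_le_right (norm_nonneg _) ?_
    calc (1 : ℝ) = ∏ σ ∈ Finset.univ.erase σ₀, (1 : ℝ) := by simp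
      _ ≤ _ := Finset.prod_le_prod (fun _ _ => zero_le_one) fun σ _ => hy1.trans (hσ σ).le
  have h6 : ((primeNorm v : ℕ) : ℝ) ≤ y := by exact_mod_cast hy
  linarith [hσ σ₀]

end PrimePairs

section PrimePairsSieve

open Finset IsDedekindDomain

variable (K : Type*) [Field K] [NumberField K]

/-- The Euler factor attached to a finite set of prime ideals. -/
noncomputable def eulerFactor {K : Type*} [Field K] [NumberField K]
    (B : Finset (HeightOneSpectrum (𝓞 K))) : ℝ :=
  ∏ v ∈ B, (1 + ((primeNorm v : ℝ) - 1)⁻¹) ^ 2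

lemma one_le_eulerFactor_term {K : Type*} [Field K] [NumberField K]
    (v : HeightOneSpectrum (𝓞 K)) : 1 ≤ (1 + ((primeNorm v : ℝ) - 1)⁻¹) ^ 2 := by
  have := two_le_cast_primeNorm v
  have h : 0 ≤ ((primeNorm v : ℝ) - 1)⁻¹ := inv_nonneg.2 (by linarith)
  exact one_le_pow₀ (by linarith)

lemma one_le_eulerFactor {K : Type*} [Field K] [NumberField K]
    (B : Finset (HeightOneSpectrum (𝓞 K))) : 1 ≤ eulerFactor B := by
  calc (1 : ℝ) = ∏ v ∈ B, 1 := by simp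
    _ ≤ _ := Finset.prod_le_prod (fun _ _ => zero_le_one) fun v _ => one_le_eulerFactor_term v

lemma mem_primesOf_two_mul {K : Type*} [Field K] [NumberField K] {h : 𝓞 K} (hh : h ≠ 0)
    {v : HeightOneSpectrum (𝓞 K)} (hv : primeNorm v ≤ 2) : v ∈ primesOf (2 * h) := by
  rw [mem_primesOf (mul_ne_zero two_ne_zero hh)]
  apply Ideal.mul_mem_right
  have h2 : Ideal.absNorm v.asIdeal = 2 := le_antisymm hv (two_le_primeNorm v)
  have := Ideal.absNorm_mem v.asIdeal
  rw [h2] at this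
  exact_mod_cast this

open Classical in
/-- Sieve bound for the elements `a` of a box not divisible, together with `a + h`, by any
good prime of small norm. -/
lemma exists_card_box_sifted_le : ∃ C : ℝ, 0 < C ∧ ∀ (h : 𝓞 K), h ≠ 0 → ∀ (b : ℤ) (L z : ℕ),
    2 ≤ z → z ^ 4 ≤ L →
    (#{a ∈ intBox (Module.Free.ChooseBasisIndex ℤ (𝓞 K)) b L | ∀ v, primeNorm v ≤ z ^ 2 →
        v ∉ primesOf (2 * h) → (RingOfIntegers.basis K).equivFun.symm a ∉ v.asIdeal ∧
        (RingOfIntegers.basis K).equivFun.symm a + h ∉ v.asIdeal} : ℝ) ≤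
      C * ((L : ℝ) ^ Module.finrank ℚ K * eulerFactor (primesOf (2 * h)) / Real.log z ^ 2 +
        (z : ℝ) ^ 12 * (L : ℝ) ^ (Module.finrank ℚ K - 1)) := by
  obtain ⟨c, hc, hG⟩ := exists_sq_log_le_sieve_sum K
  obtain ⟨_, _, C, hC, hI⟩ := exists_card_idealsLE_bounds K
  set n := Module.finrank ℚ K with hn
  refine ⟨c⁻¹ + 2 * n * 2 ^ (n - 1) * C ^ 2, by positivity, fun h hh b L z hz hL => ?_⟩
  set B := primesOf (2 * h) with hB
  have hz0 : 0 < z := by omega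
  have hlog : 0 < Real.log z := Real.log_pos (by exact_mod_cast hz)
  set 𝒟 := {D ∈ sqfreeLE K (z ^ 2) | Disjoint D B} with h𝒟
  set G := ∑ D ∈ 𝒟, ∏ v ∈ D, (2 / primeNorm v : ℝ) / (1 - 2 / primeNorm v) with hGdef
  have hP := one_le_eulerFactor B
  have hGB : c * Real.log z ^ 2 ≤ eulerFactor B * G := hG B (fun v hv => mem_primesOf_two_mul hh hv) z
  have hG0 : 0 < G := by
    have : 0 < c * Real.log z ^ 2 := by positivity
    exact pos_of_mul_pos_right (this.trans_le hGB) (by linarith)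
  have hgood : ∀ v, v ∉ B → 3 ≤ primeNorm v ∧ h ∉ v.asIdeal := by
    intro v hv
    refine ⟨?_, fun hvh => hv ?_⟩
    · by_contra h3
      exact hv (mem_primesOf_two_mul hh (by omega))
    · rw [hB, mem_primesOf (mul_ne_zero two_ne_zero hh)]
      exact Ideal.mul_mem_left _ _ hvh
  have hmem : ∀ D, D ∈ 𝒟 ↔ ∏ v ∈ D, primeNorm v ≤ z ^ 2 ∧ Disjoint D B := fun D => by
    rw [h𝒟, Finset.mem_filter, mem_sqfreeLE]
  obtain ⟨Ω, hΩ⟩ : ∃ Ω : HeightOneSpectrum (𝓞 K) →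
      (Module.Free.ChooseBasisIndex ℤ (𝓞 K) → ℤ) → Prop, ∀ v a, Ω v a ↔
      ((RingOfIntegers.basis K).equivFun.symm a ∈ v.asIdeal ∨
        (RingOfIntegers.basis K).equivFun.symm a + h ∈ v.asIdeal) := ⟨_, fun _ _ => Iff.rfl⟩
  have hR : ∀ D₁ ∈ 𝒟, ∀ D₂ ∈ 𝒟,
      |(#{a ∈ intBox (Module.Free.ChooseBasisIndex ℤ (𝓞 K)) b L | ∀ v ∈ D₁ ∪ D₂, Ω v a} : ℝ) -
      (L : ℝ) ^ n * ∏ v ∈ D₁ ∪ D₂, (2 / primeNorm v : ℝ)| ≤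
        2 * n * (z : ℝ) ^ 4 * (2 * L) ^ (n - 1) := by
    intro D₁ h₁ D₂ h₂
    rw [hmem] at h₁ h₂
    have hU : ∏ v ∈ D₁ ∪ D₂, primeNorm v ≤ z ^ 4 := by
      calc ∏ v ∈ D₁ ∪ D₂, primeNorm v
          ≤ (∏ v ∈ D₁ ∪ D₂, primeNorm v) * ∏ v ∈ D₁ ∩ D₂, primeNorm v :=
            Nat.le_mul_of_pos_right _
              (Finset.prod_pos fun v _ => two_pos.trans_le (two_le_primeNorm v))
        _ = (∏ v ∈ D₁, primeNorm v) * ∏ v ∈ D₂, primeNorm v := Finset.prod_union_inter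
        _ ≤ z ^ 2 * z ^ 2 := Nat.mul_le_mul h₁.1 h₂.1
        _ = z ^ 4 := by ring
    have hshift := abs_card_box_shift_sub_le h (D₁ ∪ D₂) (fun v hv => (hgood v
      (Finset.disjoint_left.1 (Finset.disjoint_union_left.2 ⟨h₁.2, h₂.2⟩) hv)).2) b (hU.trans hL)
    have hfilter : {a ∈ intBox (Module.Free.ChooseBasisIndex ℤ (𝓞 K)) b L |
        ∀ v ∈ D₁ ∪ D₂, Ω v a} = {a ∈ intBox (Module.Free.ChooseBasisIndex ℤ (𝓞 K)) b L |
        ∀ v ∈ D₁ ∪ D₂, (RingOfIntegers.basis K).equivFun.symm a ∈ v.asIdeal ∨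
        (RingOfIntegers.basis K).equivFun.symm a + h ∈ v.asIdeal} :=
      Finset.filter_congr fun a _ => forall₂_congr fun v _ => hΩ v a
    rw [hfilter]
    refine hshift.trans ?_
    · gcongr
      exact_mod_cast hU
  have hsel := selberg_sieve (𝒟 := 𝒟) (g := fun v => (2 / primeNorm v : ℝ))
    ((hmem ∅).2 ⟨by simpa using Nat.one_le_pow _ _ hz0, Finset.disjoint_empty_left _⟩)
    (fun D hD E hE => by
      rw [hmem] at hD ⊢
      exact ⟨(prod_primeNorm_mono hE).trans hD.1, hD.2.mono_left hE⟩)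
    (fun D hD v hv => by
      have h3 := (hgood v (Finset.disjoint_left.1 ((hmem D).1 hD).2 hv)).1
      have h3' : (3 : ℝ) ≤ primeNorm v := by exact_mod_cast h3
      exact ⟨by positivity, by rw [div_lt_one (by linarith)]; linarith⟩)
    (intBox (Module.Free.ChooseBasisIndex ℤ (𝓞 K)) b L) Ω _ _ hR
  have hsub : {a ∈ intBox (Module.Free.ChooseBasisIndex ℤ (𝓞 K)) b L | ∀ v, primeNorm v ≤ z ^ 2 →
        v ∉ primesOf (2 * h) → (RingOfIntegers.basis K).equivFun.symm a ∉ v.asIdeal ∧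
        (RingOfIntegers.basis K).equivFun.symm a + h ∉ v.asIdeal} ⊆
      {a ∈ intBox (Module.Free.ChooseBasisIndex ℤ (𝓞 K)) b L | ∀ D ∈ 𝒟, ∀ v ∈ D, ¬Ω v a} := by
    intro a ha
    rw [Finset.mem_filter] at ha ⊢
    refine ⟨ha.1, fun D hD v hv => (hΩ v a).not.2 (not_or.2 (ha.2 v ?_ ?_))⟩
    · exact (primeNorm_le_prod hv).trans ((hmem D).1 hD).1
    · exact Finset.disjoint_left.1 ((hmem D).1 hD).2 hv
  refine (Nat.cast_le.2 (Finset.card_le_card hsub)).trans (hsel.trans ?_)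
  have hsum : ∑ D ∈ 𝒟, ∏ v ∈ D, (2 / primeNorm v : ℝ)⁻¹ ≤ C * (z : ℝ) ^ 4 := by
    have hterm : ∀ D ∈ 𝒟, ∏ v ∈ D, (2 / primeNorm v : ℝ)⁻¹ ≤ (z : ℝ) ^ 2 := by
      intro D hD
      have h1 : ((∏ v ∈ D, primeNorm v : ℕ) : ℝ) ≤ (z : ℝ) ^ 2 := by
        exact_mod_cast ((hmem D).1 hD).1
      refine le_trans ?_ h1
      push_cast
      refine Finset.prod_le_prod (fun v _ => by positivity) fun v _ => ?_
      rw [inv_div]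
      linarith [cast_primeNorm_pos v]
    refine (Finset.sum_le_sum hterm).trans ?_
    rw [Finset.sum_const, nsmul_eq_mul]
    have hcard : (#𝒟 : ℝ) ≤ C * (z : ℝ) ^ 2 := by
      refine le_trans ?_ (le_trans (hI (z ^ 2) (Nat.one_le_pow _ _ hz0)).2 (by push_cast; rfl))
      exact_mod_cast (Finset.card_le_card (Finset.filter_subset _ _)).trans (card_sqfreeLE_le K _)
    calc _ ≤ C * (z : ℝ) ^ 2 * (z : ℝ) ^ 2 := by gcongr
      _ = _ := by ring
  have hsum0 : 0 ≤ ∑ D ∈ 𝒟, ∏ v ∈ D, (2 / primeNorm v : ℝ)⁻¹ := by positivity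
  have hmain : (L : ℝ) ^ n / G ≤ c⁻¹ * ((L : ℝ) ^ n * eulerFactor B / Real.log z ^ 2) := by
    rw [div_le_iff₀ hG0]
    have : c⁻¹ * ((L : ℝ) ^ n * eulerFactor B / Real.log z ^ 2) * G =
      (L : ℝ) ^ n * ((eulerFactor B * G) / (c * Real.log z ^ 2)) := by
      field_simp
    rw [this]
    refine le_mul_of_one_le_right (by positivity) ?_
    rwa [one_le_div (by positivity)]
  have herr : 2 * n * (z : ℝ) ^ 4 * (2 * L) ^ (n - 1) *
      (∑ D ∈ 𝒟, ∏ v ∈ D, (2 / primeNorm v : ℝ)⁻¹) ^ 2 ≤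
      2 * n * 2 ^ (n - 1) * C ^ 2 * ((z : ℝ) ^ 12 * (L : ℝ) ^ (n - 1)) := by
    calc _ ≤ 2 * n * (z : ℝ) ^ 4 * (2 * L) ^ (n - 1) * (C * (z : ℝ) ^ 4) ^ 2 := by gcongr
      _ = _ := by rw [mul_pow 2 (L : ℝ)]; ring
  have p1 : 0 ≤ (L : ℝ) ^ n * eulerFactor B / Real.log z ^ 2 := by positivity
  have p2 : 0 ≤ (z : ℝ) ^ 12 * (L : ℝ) ^ (n - 1) := by positivity
  have p3 : 0 ≤ 2 * (n : ℝ) * 2 ^ (n - 1) * C ^ 2 := by positivity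
  have p4 : 0 ≤ c⁻¹ := by positivity
  calc _ ≤ c⁻¹ * ((L : ℝ) ^ n * eulerFactor B / Real.log z ^ 2) +
        2 * n * 2 ^ (n - 1) * C ^ 2 * ((z : ℝ) ^ 12 * (L : ℝ) ^ (n - 1)) := add_le_add hmain herr
    _ ≤ _ := by nlinarith [mul_nonneg p3 p1, mul_nonneg p4 p2]

open Classical in
/-- Sieve bound for the number of prime pairs with given difference in a box. -/
lemma exists_card_box_prime_pairs_le : ∃ C : ℝ, 0 < C ∧ ∀ (h : 𝓞 K), h ≠ 0 → ∀ (b : ℤ) (L z : ℕ),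
    2 ≤ z → z ^ 4 ≤ L →
    (#{a ∈ intBox (Module.Free.ChooseBasisIndex ℤ (𝓞 K)) b L |
        Prime ((RingOfIntegers.basis K).equivFun.symm a) ∧
        Prime ((RingOfIntegers.basis K).equivFun.symm a + h)} : ℝ) ≤
      C * ((L : ℝ) ^ Module.finrank ℚ K * eulerFactor (primesOf (2 * h)) / Real.log z ^ 2 +
        (z : ℝ) ^ 12 * (L : ℝ) ^ (Module.finrank ℚ K - 1)) := by
  obtain ⟨C₁, hC₁, hs⟩ := exists_card_box_sifted_le K
  obtain ⟨C₂, hC₂, ht⟩ := exists_card_box_small_conjugate_le K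
  refine ⟨C₁ + 2 * C₂, by positivity, fun h hh b L z hz hL => ?_⟩
  have hs' := hs h hh b L z hz hL
  have hz1 : (1 : ℝ) ≤ z := by exact_mod_cast one_le_two.trans hz
  have hy : (1 : ℝ) ≤ ((z ^ 2 : ℕ) : ℝ) := by
    push_cast
    exact one_le_pow₀ hz1
  have ht₁ := ht 0 b L ((z ^ 2 : ℕ) : ℝ) hy
  have ht₂ := ht h b L ((z ^ 2 : ℕ) : ℝ) hy
  set n := Module.finrank ℚ K with hn
  have hsub : {a ∈ intBox (Module.Free.ChooseBasisIndex ℤ (𝓞 K)) b L |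
        Prime ((RingOfIntegers.basis K).equivFun.symm a) ∧
        Prime ((RingOfIntegers.basis K).equivFun.symm a + h)} ⊆
      {a ∈ intBox (Module.Free.ChooseBasisIndex ℤ (𝓞 K)) b L | ∀ v, primeNorm v ≤ z ^ 2 →
        v ∉ primesOf (2 * h) → (RingOfIntegers.basis K).equivFun.symm a ∉ v.asIdeal ∧
        (RingOfIntegers.basis K).equivFun.symm a + h ∉ v.asIdeal} ∪
      ({a ∈ intBox (Module.Free.ChooseBasisIndex ℤ (𝓞 K)) b L | ∃ σ : K →+* ℂ,
        ‖σ ((RingOfIntegers.basis K).equivFun.symm a + 0 : 𝓞 K)‖ ≤ ((z ^ 2 : ℕ) : ℝ)} ∪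
      {a ∈ intBox (Module.Free.ChooseBasisIndex ℤ (𝓞 K)) b L | ∃ σ : K →+* ℂ,
        ‖σ ((RingOfIntegers.basis K).equivFun.symm a + h : 𝓞 K)‖ ≤ ((z ^ 2 : ℕ) : ℝ)}) := by
    intro a ha
    obtain ⟨haA, hp₁, hp₂⟩ := Finset.mem_filter.1 ha
    simp only [Finset.mem_union, Finset.mem_filter, haA, true_and]
    by_contra! hcon
    obtain ⟨⟨v, hv, -, hor⟩, hσ₁, hσ₂⟩ := hcon
    by_cases hv₁ : (RingOfIntegers.basis K).equivFun.symm a ∈ v.asIdeal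
    · obtain ⟨σ, hσ⟩ := exists_norm_embedding_le_of_prime hp₁ hv₁ hv
      have := hσ₁ σ
      rw [add_zero] at this
      exact absurd hσ this.not_ge
    · obtain ⟨σ, hσ⟩ := exists_norm_embedding_le_of_prime hp₂ (hor hv₁) hv
      exact absurd hσ (hσ₂ σ).not_ge
  have hc := (Finset.card_le_card hsub).trans
    ((Finset.card_union_le _ _).trans (Nat.add_le_add_left (Finset.card_union_le _ _) _))
  have hc' := Nat.cast_le (α := ℝ).2 hc
  push_cast only [Nat.cast_add] at hc'
  have hzz : ((z ^ 2 : ℕ) : ℝ) ≤ (z : ℝ) ^ 12 := by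
    push_cast
    exact pow_le_pow_right₀ hz1 (by norm_num)
  have hLn : 0 ≤ (L : ℝ) ^ (n - 1) := by positivity
  have hterm : C₂ * ((z ^ 2 : ℕ) : ℝ) * (L : ℝ) ^ (n - 1) ≤
      C₂ * ((z : ℝ) ^ 12 * (L : ℝ) ^ (n - 1)) := by
    rw [mul_assoc]
    gcongr
  have p1 : 0 ≤ (L : ℝ) ^ n * eulerFactor (primesOf (2 * h)) / Real.log z ^ 2 := by
    have := one_le_eulerFactor (primesOf (2 * h))
    positivity
  have p2 := mul_nonneg hC₂.le p1
  nlinarith [hc'.trans (add_le_add hs' (add_le_add (ht₁.trans hterm) (ht₂.trans hterm)))]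

end PrimePairsSieve

section HouseBall

open Finset IsDedekindDomain

variable (K : Type*) [Field K] [NumberField K]

lemma exists_abs_repr_le_house : ∃ c : ℝ, ∀ (α : 𝓞 K) i,
    |((RingOfIntegers.basis K).repr α i : ℝ)| ≤ c * house (α : K) := by
  classical
  obtain ⟨c, hc⟩ : ∃ c : ℝ, ∀ (α : 𝓞 K) (i : K →+* ℂ),
      ‖((((integralBasis K).reindex (equivReindex K).symm).repr α i : ℚ) : ℂ)‖ ≤
        c * house (algebraMap (𝓞 K) K α) :=
    ⟨_, house.basis_repr_norm_le_const_mul_house K⟩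
  refine ⟨c, fun α i => ?_⟩
  have h := hc α ((equivReindex K).symm i)
  rw [Module.Basis.repr_reindex_apply, Equiv.symm_symm, Equiv.apply_symm_apply,
    integralBasis_repr_apply] at h
  simpa using h

lemma exists_house_le_subset_box : ∃ c : ℕ, 1 ≤ c ∧ ∀ (x : ℝ) (α : 𝓞 K), house (α : K) ≤ x →
    (RingOfIntegers.basis K).equivFun α ∈ intBox (Module.Free.ChooseBasisIndex ℤ (𝓞 K))
      (-((c * ⌈x⌉₊ : ℕ) : ℤ)) (2 * (c * ⌈x⌉₊) + 1) := by
  obtain ⟨c, hc⟩ := exists_abs_repr_le_house K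
  refine ⟨⌈c⌉₊ + 1, by omega, fun x α hα => ?_⟩
  rw [mem_intBox]
  intro i
  have h0 := house_nonneg (α : K)
  have h1 : |((RingOfIntegers.basis K).repr α i : ℝ)| ≤ (((⌈c⌉₊ + 1) * ⌈x⌉₊ : ℕ) : ℝ) := by
    refine (hc α i).trans ?_
    push_cast
    gcongr
    · linarith [Nat.le_ceil c]
    · exact hα.trans (Nat.le_ceil x)
  have h2 : |(RingOfIntegers.basis K).repr α i| ≤ (((⌈c⌉₊ + 1) * ⌈x⌉₊ : ℕ) : ℤ) := by
    exact_mod_cast h1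
  rw [Module.Basis.equivFun_apply]
  rw [abs_le] at h2
  push_cast at h2 ⊢
  exact ⟨by linarith, by linarith⟩

lemma two_mul_ceil_add_one_le (c : ℕ) {x : ℝ} (hx : 1 ≤ x) :
    ((2 * (c * ⌈x⌉₊) + 1 : ℕ) : ℝ) ≤ (4 * c + 1) * x := by
  have h1 : (⌈x⌉₊ : ℝ) ≤ 2 * x := by linarith [Nat.ceil_lt_add_one (by linarith : 0 ≤ x)]
  have h2 : (c : ℝ) * ⌈x⌉₊ ≤ c * (2 * x) := by gcongr
  push_cast
  nlinarith

lemma ncard_setOf_house_le (P : 𝓞 K → Prop) {x : ℝ} {b : ℤ} {L : ℕ}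
    (h : ∀ α : 𝓞 K, house (α : K) ≤ x → (RingOfIntegers.basis K).equivFun α ∈
      intBox (Module.Free.ChooseBasisIndex ℤ (𝓞 K)) b L) [DecidablePred P] :
    {α : 𝓞 K | P α ∧ house (α : K) ≤ x}.Finite ∧ {α : 𝓞 K | P α ∧ house (α : K) ≤ x}.ncard ≤
      #{a ∈ intBox (Module.Free.ChooseBasisIndex ℤ (𝓞 K)) b L |
        P ((RingOfIntegers.basis K).equivFun.symm a)} := by
  classical
  set F := {a ∈ intBox (Module.Free.ChooseBasisIndex ℤ (𝓞 K)) b L |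
        P ((RingOfIntegers.basis K).equivFun.symm a)} with hF
  have hsub : {α : 𝓞 K | P α ∧ house (α : K) ≤ x} ⊆
      F.image (RingOfIntegers.basis K).equivFun.symm := by
    rintro α ⟨hP, hα⟩
    rw [Finset.mem_coe, Finset.mem_image]
    refine ⟨(RingOfIntegers.basis K).equivFun α, Finset.mem_filter.2 ⟨h α hα, ?_⟩, ?_⟩
    · rwa [LinearEquiv.symm_apply_apply]
    · rw [LinearEquiv.symm_apply_apply]
  refine ⟨(Finset.finite_toSet _).subset hsub, ?_⟩
  refine (Set.ncard_le_ncard hsub (Finset.finite_toSet _)).trans ?_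
  rw [Set.ncard_coe_finset]
  exact Finset.card_image_le

lemma exists_ncard_house_le : ∃ C : ℝ, 0 < C ∧ ∀ x : ℝ, 1 ≤ x →
    {α : 𝓞 K | house (α : K) ≤ x}.Finite ∧
    ({α : 𝓞 K | house (α : K) ≤ x}.ncard : ℝ) ≤ C * x ^ Module.finrank ℚ K := by
  obtain ⟨c, hc, h⟩ := exists_house_le_subset_box K
  refine ⟨(4 * c + 1) ^ Module.finrank ℚ K, by positivity, fun x hx => ?_⟩
  have key := ncard_setOf_house_le K (fun _ => True) (h x)
  simp only [true_and, Finset.filter_true] at key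
  refine ⟨key.1, (Nat.cast_le.2 key.2).trans ?_⟩
  rw [card_intBox, card_chooseBasisIndex, ← mul_pow, Nat.cast_pow]
  gcongr
  exact two_mul_ceil_add_one_le c hx

/-- Upper bound for the number of prime elements `π` with `π + h` prime. -/
lemma exists_ncard_prime_pairs_le : ∃ C : ℝ, 0 < C ∧ ∃ x₀ : ℝ, ∀ x : ℝ, x₀ ≤ x →
    ∀ h : 𝓞 K, h ≠ 0 →
    ({π : 𝓞 K | (Prime π ∧ Prime (π + h)) ∧ house (π : K) ≤ x}.ncard : ℝ) ≤
      C * (x ^ Module.finrank ℚ K / Real.log x ^ 2) * eulerFactor (primesOf (2 * h)) := by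
  classical
  obtain ⟨c, hc, hbox⟩ := exists_house_le_subset_box K
  obtain ⟨C, hC, hpairs⟩ := exists_card_box_prime_pairs_le K
  set n := Module.finrank ℚ K with hn
  refine ⟨C * (48 ^ 2 * (4 * c + 1) ^ n + 48 ^ 2 * (4 * c + 1) ^ (n - 1)), by positivity, 2 ^ 48,
    fun x hx h hh => ?_⟩
  have hn1 : 1 ≤ n := Module.finrank_pos
  have hx0 : (0 : ℝ) ≤ x := by linarith [show (0 : ℝ) ≤ 2 ^ 48 by positivity]
  have hx1 : 1 ≤ x := by linarith [show (1 : ℝ) ≤ 2 ^ 48 by norm_num]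
  set t := x ^ ((48 : ℕ) : ℝ)⁻¹ with ht
  have htx : t ^ 48 = x := Real.rpow_inv_natCast_pow hx0 (by norm_num)
  have ht0 : 0 ≤ t := Real.rpow_nonneg hx0 _
  have ht2 : 2 ≤ t := by
    rw [← htx] at hx
    exact le_of_pow_le_pow_left₀ (by norm_num) ht0 hx
  set z := ⌊t ^ 2⌋₊ with hz
  have hzle : (z : ℝ) ≤ t ^ 2 := Nat.floor_le (by positivity)
  have hzge : t ≤ z := by nlinarith [Nat.lt_floor_add_one (t ^ 2)]
  have hz2 : 2 ≤ z := by exact_mod_cast ht2.trans hzge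
  set L := 2 * (c * ⌈x⌉₊) + 1 with hL
  have hLx : (L : ℝ) ≤ (4 * c + 1) * x := two_mul_ceil_add_one_le c hx1
  have hxL : x ≤ L := by
    have h1 : (1 : ℝ) ≤ c := by exact_mod_cast hc
    have h2 := Nat.le_ceil x
    rw [hL]
    push_cast
    nlinarith
  have hzL : z ^ 4 ≤ L := by
    have : (z : ℝ) ^ 4 ≤ L := by
      calc (z : ℝ) ^ 4 ≤ (t ^ 2) ^ 4 := by gcongr
        _ = t ^ 8 := by ring
        _ ≤ t ^ 48 := pow_le_pow_right₀ (by linarith) (by norm_num)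
        _ ≤ L := by rw [htx]; exact hxL
    exact_mod_cast this
  have key := (Nat.cast_le (α := ℝ).2 (ncard_setOf_house_le K (fun π => Prime π ∧ Prime (π + h))
    (hbox x)).2).trans (hpairs h hh _ L z hz2 hzL)
  refine key.trans ?_
  set P := eulerFactor (primesOf (2 * h)) with hPdef
  have hP : 1 ≤ P := one_le_eulerFactor _
  have hlogt : 0 < Real.log t := Real.log_pos (by linarith)
  have hlogx : Real.log x = 48 * Real.log t := by rw [← htx, Real.log_pow]; norm_num
  have hlogz : Real.log t ≤ Real.log z := Real.log_le_log (by linarith) hzge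
  have hlogt' : Real.log t ≤ t := (Real.log_le_sub_one_of_pos (by linarith)).trans (by linarith)
  have hx_n : x ^ n = x ^ (n - 1) * x := by rw [← pow_succ, Nat.sub_add_cancel hn1]
  have m1 : (L : ℝ) ^ n * P / Real.log z ^ 2 ≤
      48 ^ 2 * (4 * c + 1) ^ n * (x ^ n / Real.log x ^ 2) * P := by
    calc (L : ℝ) ^ n * P / Real.log z ^ 2 ≤ ((4 * c + 1) * x) ^ n * P / Real.log t ^ 2 := by gcongr
      _ = _ := by rw [hlogx, mul_pow, mul_pow]; field_simp
  have m2 : (z : ℝ) ^ 12 * (L : ℝ) ^ (n - 1) ≤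
      48 ^ 2 * (4 * c + 1) ^ (n - 1) * (x ^ n / Real.log x ^ 2) * P := by
    have e1 : (z : ℝ) ^ 12 * Real.log x ^ 2 ≤ 48 ^ 2 * x := by
      calc (z : ℝ) ^ 12 * Real.log x ^ 2 ≤ (t ^ 2) ^ 12 * (48 * t) ^ 2 := by
            rw [hlogx]; gcongr
        _ = 48 ^ 2 * t ^ 26 := by ring
        _ ≤ 48 ^ 2 * t ^ 48 := by
            gcongr
            · linarith
            · norm_num
        _ = _ := by rw [htx]
    have hlx : 0 < Real.log x ^ 2 := by rw [hlogx]; positivity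
    calc (z : ℝ) ^ 12 * (L : ℝ) ^ (n - 1) ≤ (48 ^ 2 * x / Real.log x ^ 2) *
          ((4 * c + 1) * x) ^ (n - 1) := by
          gcongr
          rwa [le_div_iff₀ hlx]
      _ = 48 ^ 2 * (4 * c + 1) ^ (n - 1) * (x ^ n / Real.log x ^ 2) := by
          rw [hx_n, mul_pow]; ring
      _ ≤ _ := le_mul_of_one_le_right (by positivity) hP
  calc _ ≤ C * (48 ^ 2 * (4 * c + 1) ^ n * (x ^ n / Real.log x ^ 2) * P +
        48 ^ 2 * (4 * c + 1) ^ (n - 1) * (x ^ n / Real.log x ^ 2) * P) := by gcongr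
    _ = _ := by ring

end HouseBall

section ChebyshevPrimeIdeals

open Finset IsDedekindDomain

variable (K : Type*) [Field K] [NumberField K]

lemma primorial_mem_asIdeal {K : Type*} [Field K] [NumberField K] {v : HeightOneSpectrum (𝓞 K)}
    {y : ℕ} (hv : primeNorm v ≤ y) : ((primorial y : ℕ) : 𝓞 K) ∈ v.asIdeal := by
  have := v.isPrime
  have := v.isMaximal
  obtain ⟨p, k, hk, hpv, hp, h⟩ := Ideal.exists_prime_and_absNorm_eq_pow v.asIdeal
  have hpy : p ≤ y := (Nat.le_self_pow hk.ne' p).trans (h.symm.le.trans hv)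
  obtain ⟨c, hc⟩ := hp.dvd_primorial_iff.2 hpy
  rw [hc, Nat.cast_mul]
  exact Ideal.mul_mem_right _ _ hpv

/-- Chebyshev's upper bound for prime ideals. -/
lemma prod_primesLE_le (y : ℕ) :
    ∏ v ∈ primesLE K y, primeNorm v ≤ 4 ^ (y * Module.finrank ℚ K) := by
  have h0 : ((primorial y : ℕ) : 𝓞 K) ≠ 0 := by exact_mod_cast (primorial_pos y).ne'
  refine (prod_primeNorm_le h0 _ fun v hv => primorial_mem_asIdeal (mem_primesLE.1 hv)).trans ?_
  rw [Ideal.absNorm_span_natCast, RingOfIntegers.rank, pow_mul]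
  exact Nat.pow_le_pow_left (primorial_le_four_pow y) _

lemma mul_card_dyadic_le (j : ℕ) :
    j * #{v ∈ primesLE K (2 ^ (j + 1)) | 2 ^ j ≤ primeNorm v} ≤ 4 * Module.finrank ℚ K * 2 ^ j := by
  set Q := {v ∈ primesLE K (2 ^ (j + 1)) | 2 ^ j ≤ primeNorm v} with hQ
  have h1 : 2 ^ (j * #Q) ≤ 2 ^ (4 * Module.finrank ℚ K * 2 ^ j) := by
    calc 2 ^ (j * #Q) = ∏ v ∈ Q, 2 ^ j := by rw [Finset.prod_const, ← pow_mul]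
      _ ≤ ∏ v ∈ Q, primeNorm v := Finset.prod_le_prod' fun v hv => (Finset.mem_filter.1 hv).2
      _ ≤ ∏ v ∈ primesLE K (2 ^ (j + 1)), primeNorm v :=
          prod_primeNorm_mono (Finset.filter_subset _ _)
      _ ≤ 4 ^ (2 ^ (j + 1) * Module.finrank ℚ K) := prod_primesLE_le K _
      _ = _ := by
          rw [show 4 = 2 ^ 2 by norm_num, ← pow_mul]
          congr 1
          ring
  exact (Nat.pow_le_pow_iff_right (by norm_num)).1 h1

lemma mul_sum_dyadic_le (j : ℕ) :
    (j : ℝ) * ∑ v ∈ primesLE K (2 ^ (j + 1)) with 2 ^ j ≤ primeNorm v, ((primeNorm v : ℝ))⁻¹ ≤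
      4 * Module.finrank ℚ K := by
  have h1 : ∑ v ∈ primesLE K (2 ^ (j + 1)) with 2 ^ j ≤ primeNorm v, ((primeNorm v : ℝ))⁻¹ ≤
      #{v ∈ primesLE K (2 ^ (j + 1)) | 2 ^ j ≤ primeNorm v} * ((2 : ℝ) ^ j)⁻¹ := by
    rw [← nsmul_eq_mul]
    refine Finset.sum_le_card_nsmul _ _ _ fun v hv => ?_
    have : (2 : ℝ) ^ j ≤ primeNorm v := by exact_mod_cast (Finset.mem_filter.1 hv).2
    gcongr
  refine (mul_le_mul_of_nonneg_left h1 (by positivity)).trans ?_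
  rw [← mul_assoc, mul_inv_le_iff₀ (by positivity)]
  exact_mod_cast mul_card_dyadic_le K j

/-- The sum of reciprocal norms of prime ideals grows slower than any multiple of the
logarithm. -/
lemma exists_sum_inv_primeNorm_le {ε : ℝ} (hε : 0 < ε) : ∃ C : ℝ, 0 < C ∧ ∀ y : ℕ, 1 ≤ y →
    ∑ v ∈ primesLE K y, ((primeNorm v : ℝ))⁻¹ ≤ ε * Real.log y + C := by
  set n := Module.finrank ℚ K with hn
  set q : ℕ → ℝ := fun j =>
    ∑ v ∈ primesLE K (2 ^ (j + 1)) with 2 ^ j ≤ primeNorm v, ((primeNorm v : ℝ))⁻¹ with hq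
  obtain ⟨J, hJ⟩ := exists_nat_gt (4 * n / (ε / 2))
  have hq0 : ∀ j, 0 ≤ q j := fun j => Finset.sum_nonneg fun v _ => by positivity
  have hqj : ∀ j, q j ≤ ε / 2 + if j ∈ Finset.range (J + 1) then q j else 0 := by
    intro j
    split_ifs with h
    · linarith
    · rw [add_zero]
      have h1 : (J : ℝ) ≤ j := by
        rw [Finset.mem_range] at h
        exact_mod_cast (by omega : J ≤ j)
      have h2 : (j : ℝ) * q j ≤ 4 * n := mul_sum_dyadic_le K j
      rw [div_lt_iff₀ (by positivity)] at hJ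
      by_contra! h3
      nlinarith [mul_le_mul_of_nonneg_right h1 (hq0 j), (Nat.cast_nonneg J : (0 : ℝ) ≤ J)]
  refine ⟨ε + ∑ j ∈ Finset.range (J + 1), q j,
    add_pos_of_pos_of_nonneg hε (Finset.sum_nonneg fun j _ => hq0 j), fun y hy => ?_⟩
  have hmaps : ∀ v ∈ primesLE K y, Nat.log 2 (primeNorm v) ∈ Finset.range (Nat.log 2 y + 1) := by
    intro v hv
    rw [Finset.mem_range, Nat.lt_succ_iff]
    exact Nat.log_mono_right (mem_primesLE.1 hv)
  rw [← Finset.sum_fiberwise_of_maps_to hmaps]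
  have h1 : ∀ j ∈ Finset.range (Nat.log 2 y + 1),
      ∑ v ∈ primesLE K y with Nat.log 2 (primeNorm v) = j, ((primeNorm v : ℝ))⁻¹ ≤ q j := by
    intro j _
    refine Finset.sum_le_sum_of_subset_of_nonneg ?_ fun v _ _ => by positivity
    intro v hv
    obtain ⟨-, rfl⟩ := Finset.mem_filter.1 hv
    have h2 : primeNorm v ≠ 0 := by have := two_le_primeNorm v; omega
    rw [Finset.mem_filter, mem_primesLE]
    exact ⟨(Nat.lt_pow_succ_log_self (by norm_num) _).le, Nat.pow_log_le_self 2 h2⟩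
  have hlog : (Nat.log 2 y : ℝ) ≤ 2 * Real.log y := by
    have h2 : ((2 ^ Nat.log 2 y : ℕ) : ℝ) ≤ y := by exact_mod_cast Nat.pow_log_le_self 2 (by omega)
    have h3 := Real.log_le_log (by positivity) h2
    push_cast at h3
    rw [Real.log_pow] at h3
    have := Real.log_two_gt_d9
    nlinarith [(Nat.cast_nonneg (Nat.log 2 y) : (0 : ℝ) ≤ _)]
  calc _ ≤ ∑ j ∈ Finset.range (Nat.log 2 y + 1), q j := Finset.sum_le_sum h1
    _ ≤ ∑ j ∈ Finset.range (Nat.log 2 y + 1),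
        (ε / 2 + if j ∈ Finset.range (J + 1) then q j else 0) := Finset.sum_le_sum fun j _ => hqj j
    _ = (Nat.log 2 y + 1) * (ε / 2) + ∑ j ∈ Finset.range (Nat.log 2 y + 1),
          if j ∈ Finset.range (J + 1) then q j else 0 := by
        rw [Finset.sum_add_distrib]; simp
    _ ≤ (2 * Real.log y + 1) * (ε / 2) + ∑ j ∈ Finset.range (J + 1), q j := by
        gcongr
        rw [Finset.sum_ite_mem]
        exact Finset.sum_le_sum_of_subset_of_nonneg Finset.inter_subset_right fun j _ _ => hq0 j
    _ ≤ _ := by nlinarith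

end ChebyshevPrimeIdeals

section OrderSums

open Finset IsDedekindDomain

lemma card_filter_dvd_le (N d : ℕ) (hd : 0 < d) :
    (#{m ∈ Icc 1 N | d ∣ m} : ℝ) ≤ (N : ℝ) * (∑ t ∈ Icc 1 N,
      (if d ≤ t then ((t : ℝ) * (t + 1))⁻¹ else 0) + if d ≤ N then ((N : ℝ) + 1)⁻¹ else 0) := by
  by_cases h : d ≤ N
  · have h1 : #{m ∈ Icc 1 N | d ∣ m} = N / d := by
      rw [← Nat.Ioc_filter_dvd_card_eq_div]
      rfl
    have h2 : ∑ t ∈ Icc 1 N, (if d ≤ t then ((t : ℝ) * (t + 1))⁻¹ else 0) =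
        (d : ℝ)⁻¹ - ((N : ℝ) + 1)⁻¹ := by
      rw [← sum_Icc_inv_mul_succ d N hd (by omega), ← Finset.sum_filter]
      congr 1
      ext t
      simp only [Finset.mem_filter, Finset.mem_Icc]
      omega
    rw [h1, h2, if_pos h, sub_add_cancel, ← div_eq_mul_inv]
    exact Nat.cast_div_le
  · have h1 : #{m ∈ Icc 1 N | d ∣ m} = 0 := by
      rw [Finset.card_eq_zero, Finset.filter_eq_empty_iff]
      intro m hm hdm
      rw [Finset.mem_Icc] at hm
      exact h ((Nat.le_of_dvd (by omega) hdm).trans hm.2)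
    rw [h1, Nat.cast_zero]
    positivity

/-- Mean value of products over the divisors of `m` in an indexed family of integers. -/
lemma sum_prod_one_add_le {ι : Type*} (u : ι → ℝ) (hu : ∀ i, 0 ≤ u i) (o : ι → ℕ)
    (B E : ℕ → Finset ι) (hB : ∀ m, 1 ≤ m → ∀ i, i ∈ B m ↔ o i ∣ m)
    (hE : ∀ t i, i ∈ E t ↔ 0 < o i ∧ o i ≤ t) (N : ℕ) :
    ∑ m ∈ Icc 1 N, ∏ i ∈ B m, (1 + u i) ≤
      (N : ℝ) * (∑ t ∈ Icc 1 N, ((t : ℝ) * (t + 1))⁻¹ * ∏ i ∈ E t, (1 + u i) +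
        ((N : ℝ) + 1)⁻¹ * ∏ i ∈ E N, (1 + u i)) := by
  classical
  have hU : ∀ D : Finset ι, 0 ≤ ∏ i ∈ D, u i := fun D => Finset.prod_nonneg fun i _ => hu i
  have hpos : ∀ D ∈ (E N).powerset, 0 < D.lcm o := by
    intro D hD
    refine Nat.pos_of_ne_zero fun h => ?_
    obtain ⟨i, hi, hi0⟩ := Finset.lcm_eq_zero_iff.1 h
    have := ((hE N i).1 (Finset.mem_powerset.1 hD hi)).1
    omega
  have h1 : ∀ m ∈ Icc 1 N, ∏ i ∈ B m, (1 + u i) =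
      ∑ D ∈ (E N).powerset, if D.lcm o ∣ m then ∏ i ∈ D, u i else 0 := by
    intro m hm
    rw [Finset.mem_Icc] at hm
    rw [Finset.prod_one_add, ← Finset.sum_filter]
    congr 1
    ext D
    rw [Finset.mem_filter, Finset.mem_powerset, Finset.mem_powerset, Finset.lcm_dvd_iff]
    constructor
    · refine fun h => ⟨fun i hi => ?_, fun i hi => (hB m hm.1 i).1 (h hi)⟩
      have := (hB m hm.1 i).1 (h hi)
      exact (hE N i).2 ⟨Nat.pos_of_dvd_of_pos this (by omega),
        (Nat.le_of_dvd (by omega) this).trans hm.2⟩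
    · exact fun h i hi => (hB m hm.1 i).2 (h.2 i hi)
  have h2 : ∀ t ≤ N, ∑ D ∈ (E N).powerset, (if D.lcm o ≤ t then ∏ i ∈ D, u i else 0) ≤
      ∏ i ∈ E t, (1 + u i) := by
    intro t ht
    rw [Finset.prod_one_add, ← Finset.sum_filter]
    refine Finset.sum_le_sum_of_subset_of_nonneg ?_ fun D _ _ => hU D
    intro D hD
    rw [Finset.mem_filter] at hD
    rw [Finset.mem_powerset]
    intro i hi
    refine (hE t i).2 ⟨((hE N i).1 (Finset.mem_powerset.1 hD.1 hi)).1, ?_⟩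
    exact (Nat.le_of_dvd (hpos D hD.1) (Finset.dvd_lcm hi)).trans hD.2
  rw [Finset.sum_congr rfl h1, Finset.sum_comm]
  calc ∑ D ∈ (E N).powerset, ∑ m ∈ Icc 1 N, (if D.lcm o ∣ m then ∏ i ∈ D, u i else 0)
      = ∑ D ∈ (E N).powerset, #{m ∈ Icc 1 N | D.lcm o ∣ m} * ∏ i ∈ D, u i := by
        refine Finset.sum_congr rfl fun D _ => ?_
        rw [← Finset.sum_filter, Finset.sum_const, nsmul_eq_mul]
    _ ≤ ∑ D ∈ (E N).powerset, ((N : ℝ) * (∑ t ∈ Icc 1 N,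
          (if D.lcm o ≤ t then ((t : ℝ) * (t + 1))⁻¹ else 0) +
            if D.lcm o ≤ N then ((N : ℝ) + 1)⁻¹ else 0)) * ∏ i ∈ D, u i :=
        Finset.sum_le_sum fun D hD => mul_le_mul_of_nonneg_right
          (card_filter_dvd_le N _ (hpos D hD)) (hU D)
    _ = (N : ℝ) * (∑ t ∈ Icc 1 N, ((t : ℝ) * (t + 1))⁻¹ *
          (∑ D ∈ (E N).powerset, if D.lcm o ≤ t then ∏ i ∈ D, u i else 0) +
          ((N : ℝ) + 1)⁻¹ * ∑ D ∈ (E N).powerset, if D.lcm o ≤ N then ∏ i ∈ D, u i else 0) := by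
        simp_rw [mul_assoc, ← Finset.mul_sum, add_mul, Finset.sum_add_distrib, Finset.sum_mul,
          Finset.mul_sum, ite_mul, mul_ite, zero_mul, mul_zero]
        rw [Finset.sum_comm]
    _ ≤ _ := by
        gcongr with t ht
        · exact h2 t (Finset.mem_Icc.1 ht).2
        · exact h2 N le_rfl

end OrderSums

section EulerFactorMean

open Finset IsDedekindDomain

variable {K : Type*} [Field K] [NumberField K]

lemma eulerFactor_le_exp (B : Finset (HeightOneSpectrum (𝓞 K))) :
    eulerFactor B ≤ Real.exp (4 * ∑ v ∈ B, (primeNorm v : ℝ)⁻¹) := by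
  rw [Finset.mul_sum, Real.exp_sum]
  refine Finset.prod_le_prod (fun v _ => sq_nonneg _) fun v _ => ?_
  have h2 := two_le_cast_primeNorm v
  have h : ((primeNorm v : ℝ) - 1)⁻¹ ≤ 2 * (primeNorm v : ℝ)⁻¹ := by
    rw [← div_eq_mul_inv, inv_eq_one_div, div_le_div_iff₀ (by linarith) (by linarith)]
    linarith
  have h0 : 0 ≤ ((primeNorm v : ℝ) - 1)⁻¹ := inv_nonneg.2 (by linarith)
  rw [show 4 * (primeNorm v : ℝ)⁻¹ = (2 : ℕ) * (2 * (primeNorm v : ℝ)⁻¹) by push_cast; ring,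
    Real.exp_nat_mul]
  gcongr
  linarith [Real.add_one_le_exp (2 * (primeNorm v : ℝ)⁻¹)]

variable (K) in
lemma exists_eulerFactor_le_sqrt (A : ℕ) : ∃ C : ℝ, 0 < C ∧ ∀ t : ℕ, 1 ≤ t →
    ∀ E : Finset (HeightOneSpectrum (𝓞 K)), #E ≤ A * t ^ 2 → eulerFactor E ≤ C * √t := by
  classical
  obtain ⟨C, hC, h⟩ := exists_sum_inv_primeNorm_le K (ε := 1 / 16) (by norm_num)
  refine ⟨Real.exp (4 * (C + A)), Real.exp_pos _, fun t ht E hE => ?_⟩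
  have ht0 : (0 : ℝ) < t := by exact_mod_cast ht
  refine (eulerFactor_le_exp E).trans ?_
  rw [Real.sqrt_eq_rpow, Real.rpow_def_of_pos ht0, ← Real.exp_add]
  refine Real.exp_le_exp.2 ?_
  have hsmall : ∑ v ∈ E with primeNorm v ≤ t ^ 2, (primeNorm v : ℝ)⁻¹ ≤
      1 / 16 * (2 * Real.log t) + C := by
    have h1 := h (t ^ 2) (Nat.one_le_pow _ _ ht)
    rw [Nat.cast_pow, Real.log_pow, Nat.cast_ofNat] at h1
    refine le_trans (Finset.sum_le_sum_of_subset_of_nonneg ?_ fun v _ _ => by positivity) h1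
    exact fun v hv => mem_primesLE.2 (Finset.mem_filter.1 hv).2
  have hlarge : ∑ v ∈ E with ¬ primeNorm v ≤ t ^ 2, (primeNorm v : ℝ)⁻¹ ≤ A := by
    calc _ ≤ #{v ∈ E | ¬ primeNorm v ≤ t ^ 2} • ((t : ℝ) ^ 2)⁻¹ := by
          refine Finset.sum_le_card_nsmul _ _ _ fun v hv => ?_
          have : (t : ℝ) ^ 2 ≤ primeNorm v := by
            exact_mod_cast (not_le.1 (Finset.mem_filter.1 hv).2).le
          gcongr
      _ ≤ (A * (t : ℝ) ^ 2) * ((t : ℝ) ^ 2)⁻¹ := by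
          rw [nsmul_eq_mul]
          gcongr
          exact_mod_cast (Finset.card_filter_le _ _).trans hE
      _ = A := by field_simp
  rw [← Finset.sum_filter_add_sum_filter_not E (fun v => primeNorm v ≤ t ^ 2)]
  linarith

lemma pow_sub_one_ne_zero_of_not_isUnit {R : Type*} [CommRing R] {ξ : R} (hξ : ¬ IsUnit ξ)
    {m : ℕ} (hm : 1 ≤ m) : ξ ^ m - 1 ≠ 0 := fun h => hξ (IsUnit.of_pow_eq_one (sub_eq_zero.1 h) (by omega))

lemma two_pow_card_primesOf_le {α : 𝓞 K} (hα : α ≠ 0) :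
    (2 : ℝ) ^ #(primesOf α) ≤ ∏ σ : K →+* ℂ, ‖σ (α : K)‖ := by
  rw [← absNorm_span_eq_prod_norm]
  have h1 := prod_primeNorm_le hα (primesOf α) fun v hv => (mem_primesOf hα).1 hv
  have h2 : 2 ^ #(primesOf α) ≤ ∏ v ∈ primesOf α, primeNorm v :=
    Finset.pow_card_le_prod _ _ _ fun v _ => two_le_primeNorm v
  exact_mod_cast h2.trans h1

lemma exists_card_primesOf_pow_sub_one_le {ξ : 𝓞 K} (hξ : ¬ IsUnit ξ) :
    ∃ A : ℕ, ∀ m, 1 ≤ m → #(primesOf (ξ ^ m - 1)) ≤ A * m := by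
  set H := house (ξ : K)
  obtain ⟨a, ha⟩ := pow_unbounded_of_one_lt (H + 1) one_lt_two
  refine ⟨a * Module.finrank ℚ K, fun m hm => ?_⟩
  have hH : 0 ≤ H := house_nonneg _
  have h1 : ∀ σ : K →+* ℂ, ‖σ ((ξ ^ m - 1 : 𝓞 K) : K)‖ ≤ (2 : ℝ) ^ (a * m) := by
    intro σ
    have h2 : ‖σ (ξ : K)‖ ≤ H := norm_embedding_le_house _ σ
    have h3 : H ^ m + 1 ≤ (H + 1) ^ m := by
      simpa using pow_add_pow_le hH zero_le_one (by omega : m ≠ 0)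
    calc ‖σ ((ξ ^ m - 1 : 𝓞 K) : K)‖ = ‖σ (ξ : K) ^ m - 1‖ := by simp
      _ ≤ ‖σ (ξ : K)‖ ^ m + 1 := by
          refine (norm_sub_le _ _).trans ?_
          rw [norm_pow, norm_one]
      _ ≤ H ^ m + 1 := by gcongr
      _ ≤ (H + 1) ^ m := h3
      _ ≤ (2 ^ a) ^ m := by gcongr
      _ = _ := by rw [pow_mul]
  have h2 := (two_pow_card_primesOf_le (pow_sub_one_ne_zero_of_not_isUnit hξ hm)).trans
    (Finset.prod_le_prod (fun σ _ => norm_nonneg _) fun σ _ => h1 σ)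
  rw [Finset.prod_const, Finset.card_univ, Embeddings.card, ← pow_mul] at h2
  have h3 := (pow_le_pow_iff_right₀ (one_lt_two (α := ℝ))).1 h2
  calc _ ≤ _ := h3
    _ = _ := by ring

/-- The Euler factors of `ξ ^ m - 1` are bounded on average. -/
lemma exists_sum_eulerFactor_le {ξ : 𝓞 K} (hξ : ¬ IsUnit ξ) : ∃ C : ℝ, 0 < C ∧ ∀ N : ℕ,
    ∑ m ∈ Icc 1 N, eulerFactor (primesOf (ξ ^ m - 1)) ≤ C * N := by
  classical
  obtain ⟨A, hA⟩ := exists_card_primesOf_pow_sub_one_le hξ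
  obtain ⟨C, hC, hF⟩ := exists_eulerFactor_le_sqrt K A
  set E : ℕ → Finset (HeightOneSpectrum (𝓞 K)) :=
    fun t => (Icc 1 t).biUnion fun m => primesOf (ξ ^ m - 1) with hEdef
  set o : HeightOneSpectrum (𝓞 K) → ℕ := fun v => orderOf (Ideal.Quotient.mk v.asIdeal ξ)
  have hB : ∀ m, 1 ≤ m → ∀ v, v ∈ primesOf (ξ ^ m - 1) ↔ o v ∣ m := by
    intro m hm v
    rw [mem_primesOf (pow_sub_one_ne_zero_of_not_isUnit hξ hm), orderOf_dvd_iff_pow_eq_one, ← map_pow,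
      ← map_one (Ideal.Quotient.mk v.asIdeal), Ideal.Quotient.eq]
  have hE : ∀ t v, v ∈ E t ↔ 0 < o v ∧ o v ≤ t := by
    intro t v
    simp only [hEdef, Finset.mem_biUnion, Finset.mem_Icc]
    constructor
    · rintro ⟨m, hm, hv⟩
      have := (hB m hm.1 v).1 hv
      exact ⟨Nat.pos_of_dvd_of_pos this hm.1, (Nat.le_of_dvd hm.1 this).trans hm.2⟩
    · exact fun h => ⟨o v, h, (hB _ h.1 v).2 dvd_rfl⟩
  have hEcard : ∀ t, #(E t) ≤ A * t ^ 2 := by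
    intro t
    calc #(E t) ≤ #(Icc 1 t) * (A * t) := by
          refine Finset.card_biUnion_le_card_mul _ _ _ fun m hm => ?_
          rw [Finset.mem_Icc] at hm
          exact (hA m hm.1).trans (Nat.mul_le_mul_left _ hm.2)
      _ = _ := by rw [Nat.card_Icc]; simp; ring
  have hsum : Summable fun t : ℕ => 1 / (t : ℝ) ^ (3 / 2 : ℝ) :=
    Real.summable_one_div_nat_rpow.2 (by norm_num)
  refine ⟨C * (∑' t : ℕ, 1 / (t : ℝ) ^ (3 / 2 : ℝ)) + C, by positivity, fun N => ?_⟩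
  rcases Nat.eq_zero_or_pos N with rfl | hN
  · simp
  have hmain := sum_prod_one_add_le
    (fun v : HeightOneSpectrum (𝓞 K) => (1 + ((primeNorm v : ℝ) - 1)⁻¹) ^ 2 - 1)
    (fun v => sub_nonneg.2 (one_le_eulerFactor_term v)) o (fun m => primesOf (ξ ^ m - 1)) E hB hE N
  simp only [add_sub_cancel] at hmain
  rw [mul_comm _ (N : ℝ)]
  refine hmain.trans (mul_le_mul_of_nonneg_left (add_le_add ?_ ?_) (Nat.cast_nonneg N))
  · refine le_trans ?_ (mul_le_mul_of_nonneg_left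
      (hsum.sum_le_tsum (Icc 1 N) fun t _ => by positivity) hC.le)
    rw [Finset.mul_sum]
    refine Finset.sum_le_sum fun t ht => ?_
    rw [Finset.mem_Icc] at ht
    have ht0 : (0 : ℝ) < t := by exact_mod_cast ht.1
    refine (mul_le_mul_of_nonneg_left (hF t ht.1 (E t) (hEcard t)) (by positivity)).trans ?_
    have h1 : (t : ℝ) ^ (3 / 2 : ℝ) = t * √t := by
      rw [Real.sqrt_eq_rpow, ← Real.rpow_one_add' ht0.le (by norm_num)]
      norm_num
    have hs : 0 < √(t : ℝ) := Real.sqrt_pos.2 ht0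
    have hss : √(t : ℝ) * √t = t := Real.mul_self_sqrt ht0.le
    rw [h1, inv_mul_eq_div, ← mul_div_assoc, mul_one, div_le_div_iff₀ (by positivity)
      (by positivity)]
    calc C * √t * (t * √t) = C * t * (√t * √t) := by ring
      _ = C * t * t := by rw [hss]
      _ ≤ C * (t * (t + 1)) := by nlinarith [mul_pos hC ht0]
  · have hN1 : (1 : ℝ) ≤ N := by exact_mod_cast hN
    refine (mul_le_mul_of_nonneg_left (hF N hN (E N) (hEcard N)) (by positivity)).trans ?_
    have hs : √(N : ℝ) ≤ N := Real.sqrt_le_self_iff.2 (Or.inr hN1)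
    rw [inv_mul_le_iff₀ (by positivity)]
    nlinarith

end EulerFactorMean

section SecondMoment

open Finset IsDedekindDomain

lemma sum_sq_card_le {α β : Type*} [DecidableEq β] (S : Finset α) (M : Finset β)
    (R : α → Finset β) (hR : ∀ a, R a ⊆ M) :
    ∑ a ∈ S, #(R a) ^ 2 ≤
      #S + 2 * ∑ p ∈ M.offDiag, #{a ∈ S | p.1 ∈ R a ∧ p.2 ∈ R a} := by
  have h1 : ∀ a ∈ S, #(R a) ^ 2 ≤ 1 + 2 * #(R a).offDiag := by
    intro a _
    rw [Finset.offDiag_card]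
    rcases Nat.lt_or_ge #(R a) 2 with h | h
    · interval_cases #(R a) <;> simp
    · have : #(R a) ≤ #(R a) * #(R a) := Nat.le_mul_self _
      zify [this]
      have h' : (2 : ℤ) ≤ #(R a) := by exact_mod_cast h
      nlinarith
  refine (Finset.sum_le_sum h1).trans ?_
  rw [Finset.sum_add_distrib, ← Finset.mul_sum, Finset.sum_const, smul_eq_mul, mul_one]
  gcongr
  apply le_of_eq
  simp_rw [Finset.card_filter]
  rw [Finset.sum_comm]
  refine Finset.sum_congr rfl fun a _ => ?_
  rw [← Finset.card_filter]
  congr 1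
  ext ⟨i, j⟩
  simp only [Finset.mem_offDiag, Finset.mem_filter]
  exact ⟨fun h => ⟨⟨hR a h.1, hR a h.2.1, h.2.2⟩, h.1, h.2.1⟩, fun h => ⟨h.2.1, h.2.2, h.1.2.2⟩⟩

lemma sum_offDiag_dist_le (f : ℕ → ℝ) (hf : ∀ m, 0 ≤ f m) (N : ℕ) :
    ∑ p ∈ (Icc 1 N).offDiag, f (Nat.dist p.1 p.2) ≤ 2 * N * ∑ m ∈ Icc 1 N, f m := by
  have h1 : ∑ p ∈ (Icc 1 N).offDiag, f (Nat.dist p.1 p.2) =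
      ∑ k ∈ Icc 1 N, ∑ l ∈ Icc 1 N with k ≠ l, f (Nat.dist k l) := by
    have h0 : (Icc 1 N).offDiag = {p ∈ Icc 1 N ×ˢ Icc 1 N | p.1 ≠ p.2} := by
      ext p
      simp only [Finset.mem_offDiag, Finset.mem_filter, Finset.mem_product, and_assoc]
    rw [h0, Finset.sum_filter, Finset.sum_product]
    simp_rw [Finset.sum_filter]
  have h2 : ∀ k ∈ Icc 1 N, ∑ l ∈ Icc 1 N with k ≠ l, f (Nat.dist k l) ≤
      2 * ∑ m ∈ Icc 1 N, f m := by
    intro k hk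
    rw [← Finset.sum_filter_add_sum_filter_not _ (fun l => k < l), two_mul]
    refine add_le_add ?_ ?_ <;>
    · refine sum_le_sum_of_injOn (fun l => Nat.dist k l) ?_ ?_ (fun _ _ => le_rfl) fun m _ => hf m
      · intro l hl
        simp only [Finset.mem_filter, Finset.mem_Icc, Nat.dist] at hl hk ⊢
        omega
      · intro l hl l' hl' h
        simp only [Finset.coe_filter, Finset.mem_filter, Finset.mem_Icc, Set.mem_ofPred_eq,
          Nat.dist] at hl hl' hk h
        omega
  rw [h1]
  refine (Finset.sum_le_card_nsmul _ _ _ h2).trans_eq ?_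
  rw [Nat.card_Icc, nsmul_eq_mul, Nat.add_sub_cancel]
  ring

variable {K : Type*} [Field K] [NumberField K]

lemma one_lt_house_of_not_isUnit {ξ : 𝓞 K} (hξ0 : ξ ≠ 0) (hξ : ¬ IsUnit ξ) :
    1 < house (ξ : K) := by
  by_contra! h
  have h1 : (Ideal.absNorm (Ideal.span {ξ}) : ℝ) ≤ 1 := by
    rw [absNorm_span_eq_prod_norm]
    exact Finset.prod_le_one (fun σ _ => norm_nonneg _)
      fun σ _ => (norm_embedding_le_house _ σ).trans h
  have h2 : Ideal.absNorm (Ideal.span {ξ}) ≤ 1 := by exact_mod_cast h1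
  have h3 : Ideal.absNorm (Ideal.span {ξ}) ≠ 0 := fun h0 => hξ0 (by
    simpa using Ideal.absNorm_eq_zero_iff.1 h0)
  exact hξ (Ideal.span_singleton_eq_top.1 (Ideal.absNorm_eq_one_iff.1 (by omega)))

lemma pow_sub_pow_ne_zero {R : Type*} [CommRing R] [IsDomain R] {ξ : R} (hξ0 : ξ ≠ 0)
    (hξ : ¬ IsUnit ξ) {k l : ℕ} (hkl : k ≠ l) : ξ ^ k - ξ ^ l ≠ 0 := by
  wlog h : l < k generalizing k l
  · rw [← neg_sub, neg_ne_zero]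
    exact this hkl.symm (by omega)
  obtain ⟨m, rfl⟩ := Nat.exists_eq_add_of_lt h
  rw [show ξ ^ (l + m + 1) - ξ ^ l = ξ ^ l * (ξ ^ (m + 1) - 1) by ring]
  exact mul_ne_zero (pow_ne_zero _ hξ0) (pow_sub_one_ne_zero_of_not_isUnit hξ (by omega))

open Classical in
lemma primesOf_two_mul_pow_sub_pow_subset {ξ : 𝓞 K} (hξ0 : ξ ≠ 0) (hξ : ¬ IsUnit ξ) {k l : ℕ}
    (hkl : k ≠ l) : primesOf (2 * (ξ ^ k - ξ ^ l)) ⊆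
      primesOf (2 * ξ) ∪ primesOf (ξ ^ Nat.dist k l - 1) := by
  wlog h : l < k generalizing k l
  · intro v hv
    rw [Nat.dist_comm]
    refine this hkl.symm (by omega) ?_
    rw [mem_primesOf (mul_ne_zero two_ne_zero (pow_sub_pow_ne_zero hξ0 hξ hkl))] at hv
    rw [mem_primesOf (mul_ne_zero two_ne_zero (pow_sub_pow_ne_zero hξ0 hξ hkl.symm))]
    rw [← neg_sub, mul_neg]
    exact neg_mem hv
  obtain ⟨m, rfl⟩ := Nat.exists_eq_add_of_lt h
  intro v hv
  have hd : Nat.dist (l + m + 1) l = m + 1 := by simp only [Nat.dist]; omega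
  rw [mem_primesOf (mul_ne_zero two_ne_zero (pow_sub_pow_ne_zero hξ0 hξ hkl)),
    show ξ ^ (l + m + 1) - ξ ^ l = ξ ^ l * (ξ ^ (m + 1) - 1) by ring] at hv
  rw [hd, Finset.mem_union, mem_primesOf (mul_ne_zero two_ne_zero hξ0),
    mem_primesOf (pow_sub_one_ne_zero_of_not_isUnit hξ (by omega))]
  have := v.isPrime
  rcases this.mem_or_mem hv with h2 | h2
  · exact Or.inl (Ideal.mul_mem_right _ _ h2)
  rcases this.mem_or_mem h2 with h3 | h3
  · exact Or.inl (Ideal.mul_mem_left _ _ (this.mem_of_pow_mem _ h3))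
  · exact Or.inr h3

open Classical in
lemma eulerFactor_le_mul_of_subset_union {A B D : Finset (HeightOneSpectrum (𝓞 K))}
    (h : D ⊆ A ∪ B) : eulerFactor D ≤ eulerFactor A * eulerFactor B := by
  have hone : ∀ S : Finset (HeightOneSpectrum (𝓞 K)), 1 ≤ eulerFactor S := one_le_eulerFactor
  have h1 : eulerFactor D ≤ eulerFactor (A ∪ B) :=
    Finset.prod_le_prod_of_subset_of_one_le h (fun v _ => sq_nonneg _)
      fun v _ _ => one_le_eulerFactor_term v
  have h2 : eulerFactor (A ∪ B) * eulerFactor (A ∩ B) = eulerFactor A * eulerFactor B :=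
    Finset.prod_union_inter
  nlinarith [hone (A ∪ B), hone (A ∩ B)]

open Classical in
/-- The exponents `k ≤ N` for which `ζ - ξ ^ k` is a prime element of house at most `x`. -/
noncomputable def repExponents (ξ : 𝓞 K) (x : ℝ) (N : ℕ) (ζ : 𝓞 K) : Finset ℕ :=
  {k ∈ Icc 1 N | Prime (ζ - ξ ^ k) ∧ house ((ζ - ξ ^ k : 𝓞 K) : K) ≤ x}

lemma repCount_le_card_repExponents (ξ : 𝓞 K) (x : ℝ) (ζ : 𝓞 K) :
    repCount ξ x ζ ≤ #(repExponents ξ x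
      ⌊Real.log (Real.sqrt x / 2) / Real.log (house (ξ : K))⌋₊ ζ) := by
  rw [← Nat.card_eq_finsetCard]
  refine Nat.card_le_card_of_injective (fun pk => ⟨pk.1.2, ?_⟩) ?_
  · obtain ⟨⟨π, k⟩, hπ, hk, hζ, hx, hkN⟩ := pk
    have hsub : ζ - ξ ^ k = π := by rw [hζ, add_sub_cancel_right]
    simp only [repExponents, Finset.mem_filter, Finset.mem_Icc, hsub]
    exact ⟨⟨hk, Nat.le_floor hkN⟩, hπ, hx⟩
  · rintro ⟨⟨π, k⟩, _, _, hζ, _⟩ ⟨⟨π', k'⟩, _, _, hζ', _⟩ h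
    obtain rfl : k = k' := congrArg Subtype.val h
    obtain rfl : π = π' := add_right_cancel (hζ.symm.trans hζ')
    rfl

lemma card_repExponents_pair_le {ξ : 𝓞 K} {x : ℝ} (N : ℕ) (S : Finset (𝓞 K)) (k l : ℕ)
    (hfin : {α : 𝓞 K | house (α : K) ≤ x}.Finite) :
    #{ζ ∈ S | k ∈ repExponents ξ x N ζ ∧ l ∈ repExponents ξ x N ζ} ≤
      {π : 𝓞 K | (Prime π ∧ Prime (π + (ξ ^ k - ξ ^ l))) ∧ house (π : K) ≤ x}.ncard := by
  classical
  rw [← Set.ncard_coe_finset]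
  refine Set.ncard_le_ncard_of_injOn (fun ζ => ζ - ξ ^ k) ?_ (fun a _ b _ h => sub_left_injective h)
    (hfin.subset fun π hπ => hπ.2)
  intro ζ hζ
  simp only [Finset.coe_filter, Set.mem_ofPred_eq, repExponents, Finset.mem_filter] at hζ ⊢
  refine ⟨⟨hζ.2.1.2.1, ?_⟩, hζ.2.1.2.2⟩
  rw [sub_add_sub_cancel]
  exact hζ.2.2.2.1

end SecondMoment

/-- **Second moment bound.** The sum of `r_x(ζ, ξ)²` over algebraic integers `ζ` with
`house ζ ≤ x` is `O(xⁿ)`. -/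
theorem repCount_sq_sum_bound (K : Type*) [Field K] [NumberField K]
    (ξ : 𝓞 K) (hξ0 : ξ ≠ 0) (hξ : ¬ IsUnit ξ) :
    ∃ C : ℝ, 0 < C ∧ ∃ x₀ : ℝ, ∀ x : ℝ, x₀ ≤ x →
      (∑' ζ : {ζ : 𝓞 K // house ((ζ : 𝓞 K) : K) ≤ x}, (repCount ξ x ζ.1 : ℝ) ^ 2) ≤
        C * x ^ Module.finrank ℚ K := by
  classical
  obtain ⟨C₁, hC₁, hbox⟩ := exists_ncard_house_le K
  obtain ⟨C₂, hC₂, x₁, hpair⟩ := exists_ncard_prime_pairs_le K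
  obtain ⟨C₃, hC₃, hmean⟩ := exists_sum_eulerFactor_le hξ
  set G := eulerFactor (primesOf (2 * ξ)) with hG
  have hG1 : 1 ≤ G := one_le_eulerFactor _
  have hH : 0 < Real.log (house (ξ : K)) := Real.log_pos (one_lt_house_of_not_isUnit hξ0 hξ)
  set c := (2 * Real.log (house (ξ : K)))⁻¹ with hc
  refine ⟨C₁ + 4 * C₂ * G * C₃ * c ^ 2, by positivity, max 2 x₁, fun x hx => ?_⟩
  have hx2 : 2 ≤ x := (le_max_left _ _).trans hx
  have hlog : 0 < Real.log x := Real.log_pos (by linarith)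
  obtain ⟨hfin, hcard⟩ := hbox x (by linarith)
  set N := ⌊Real.log (Real.sqrt x / 2) / Real.log (house (ξ : K))⌋₊ with hN
  set n := Module.finrank ℚ K
  have hNlog : (N : ℝ) ≤ c * Real.log x := by
    refine le_trans (Nat.cast_le.2 (Nat.floor_le_floor ?_)) (Nat.floor_le (by positivity))
    have hs : 0 < √x := Real.sqrt_pos.2 (by linarith)
    have h1 : Real.log (√x / 2) ≤ Real.log x / 2 := by
      rw [← Real.log_sqrt (by linarith)]
      exact Real.log_le_log (by positivity) (by linarith)
    rw [hc, mul_inv, div_eq_mul_inv]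
    calc _ ≤ (Real.log x / 2) * (Real.log (house (ξ : K)))⁻¹ := by gcongr
      _ = _ := by ring
  set S := hfin.toFinset with hS
  have hpairs : ∀ p ∈ (Finset.Icc 1 N).offDiag,
      ((S.filter fun ζ => p.1 ∈ repExponents ξ x N ζ ∧ p.2 ∈ repExponents ξ x N ζ).card : ℝ) ≤
        C₂ * (x ^ n / Real.log x ^ 2) * G * eulerFactor (primesOf (ξ ^ Nat.dist p.1 p.2 - 1)) := by
    rintro ⟨k, l⟩ hp
    have hkl : k ≠ l := (Finset.mem_offDiag.1 hp).2.2
    refine (Nat.cast_le.2 (card_repExponents_pair_le N S k l hfin)).trans ?_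
    refine (hpair x ((le_max_right _ _).trans hx) _ (pow_sub_pow_ne_zero hξ0 hξ hkl)).trans ?_
    rw [mul_assoc _ G]
    exact mul_le_mul_of_nonneg_left (eulerFactor_le_mul_of_subset_union
      (primesOf_two_mul_pow_sub_pow_subset hξ0 hξ hkl)) (by positivity)
  have hoff := sum_offDiag_dist_le (fun m => eulerFactor (primesOf (ξ ^ m - 1)))
    (fun m => zero_le_one.trans (one_le_eulerFactor _)) N
  have htsum : (∑' ζ : {ζ : 𝓞 K // house ((ζ : 𝓞 K) : K) ≤ x}, (repCount ξ x ζ.1 : ℝ) ^ 2) =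
      ∑ ζ ∈ S, (repCount ξ x ζ : ℝ) ^ 2 := by
    have : Fintype {ζ : 𝓞 K // house ((ζ : 𝓞 K) : K) ≤ x} := hfin.fintype
    rw [tsum_fintype, ← Finset.sum_subtype S (by simp [hS]) fun ζ => (repCount ξ x ζ : ℝ) ^ 2]
  calc _ = ∑ ζ ∈ S, (repCount ξ x ζ : ℝ) ^ 2 := htsum
    _ ≤ ∑ ζ ∈ S, ((repExponents ξ x N ζ).card : ℝ) ^ 2 := by
        gcongr with ζ _
        exact repCount_le_card_repExponents ξ x ζ
    _ ≤ S.card + 2 * ∑ p ∈ (Finset.Icc 1 N).offDiag,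
        ((S.filter fun ζ => p.1 ∈ repExponents ξ x N ζ ∧ p.2 ∈ repExponents ξ x N ζ).card : ℝ) := by
        exact_mod_cast sum_sq_card_le S (Finset.Icc 1 N) (repExponents ξ x N)
          fun ζ => Finset.filter_subset _ _
    _ ≤ C₁ * x ^ n + 2 * (C₂ * (x ^ n / Real.log x ^ 2) * G * (2 * N * (C₃ * N))) := by
        gcongr
        · rwa [hS, ← Set.ncard_eq_toFinset_card _ hfin]
        · refine (Finset.sum_le_sum hpairs).trans ?_
          rw [← Finset.mul_sum]
          gcongr
          refine hoff.trans ?_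
          gcongr
          exact hmean N
    _ = C₁ * x ^ n + 4 * C₂ * G * C₃ * (x ^ n / Real.log x ^ 2) * (N : ℝ) ^ 2 := by ring
    _ ≤ C₁ * x ^ n + 4 * C₂ * G * C₃ * (x ^ n / Real.log x ^ 2) * (c * Real.log x) ^ 2 := by
        gcongr
    _ = _ := by
        field_simp
end

section
/- Let $K$ be a number field of degree $n$ with ring of integers $\mathcal{O}_K$ and let $\xi \in \mathcal{O}_K$ be a nonzero non-unit. Define $E(x) = \sum_{\mathfrak{a}} \frac{1}{\mathcal{N}(\mathfrak{a})}$, where the sum runs over all nonzero squarefree ideals $\mathfrak{a}$ of $\mathcal{O}_K$ coprime to $(\xi)$ that contain $\xi^k - 1$ for some positive integer $k$ and satisfy $\operatorname{ord}_{\xi}(\mathfrak{a}) \le x$. Then there exists a constant $C > 0$ such that $E(x) \le C (\log x)^n$ for all $x \ge 2$. -/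
open NumberField

/-- The weak form `∑_{p ≤ N} log p / p ≤ log N + log 4` of Mertens' first theorem. -/
theorem sum_primesLE_log_div_le (N : ℕ) (hN : 1 ≤ N) :
    ∑ p ∈ Nat.primesLE N, Real.log p / p ≤ Real.log N + Real.log 4 := by
  have hN0 : (0 : ℝ) < N := by exact_mod_cast hN
  have hdvd : ∏ p ∈ Nat.primesLE N, p ^ (N / p) ∣ N.factorial := by
    refine Finset.prod_dvd_of_isRelPrime ?_ ?_
    · intro p hp q hq hpq
      have hcop := (Nat.coprime_primes (Nat.prime_of_mem_primesLE hp)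
        (Nat.prime_of_mem_primesLE hq)).2 hpq
      exact Nat.coprime_iff_isRelPrime.1 (hcop.pow (N / p) (N / q))
    · intro p hp
      rw [(Nat.prime_of_mem_primesLE hp).pow_dvd_factorial_iff (Nat.lt_succ_self _)]
      have hmem : 1 ∈ Finset.Ico 1 (Nat.log p N).succ := by
        have := Nat.log_pos (Nat.one_lt_of_mem_primesLE hp) (Nat.le_of_mem_primesLE hp)
        exact Finset.mem_Ico.2 ⟨le_rfl, Nat.succ_lt_succ this⟩
      simpa using Finset.single_le_sum (f := fun i => N / p ^ i) (fun i _ => Nat.zero_le _) hmem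
  have hle : ∏ p ∈ Nat.primesLE N, p ^ (N / p) ≤ N ^ N :=
    (Nat.le_of_dvd (Nat.factorial_pos _) hdvd).trans (Nat.factorial_le_pow N)
  have hpos : 0 < ∏ p ∈ Nat.primesLE N, p ^ (N / p) :=
    Finset.prod_pos fun p hp => pow_pos (Nat.prime_of_mem_primesLE hp).pos _
  have hlog : ∑ p ∈ Nat.primesLE N, ((N / p : ℕ) : ℝ) * Real.log p ≤ N * Real.log N := by
    have := Real.log_le_log (by exact_mod_cast hpos) (Nat.cast_le (α := ℝ).2 hle)
    push_cast at this
    rw [Real.log_pow, Real.log_prod] at this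
    · simpa only [Real.log_pow] using this
    · intro p hp
      have := (Nat.prime_of_mem_primesLE hp).pos
      positivity
  have htheta := Chebyshev.theta_le_log4_mul_x hN0.le
  rw [Chebyshev.theta_eq_sum_primesLE_log] at htheta
  have hsum : N * ∑ p ∈ Nat.primesLE N, Real.log p / p ≤
      ∑ p ∈ Nat.primesLE N, ((N / p : ℕ) : ℝ) * Real.log p + ∑ p ∈ Nat.primesLE N, Real.log p := by
    rw [Finset.mul_sum, ← Finset.sum_add_distrib]
    refine Finset.sum_le_sum fun p hp => ?_
    have hfloor : (N : ℝ) / p ≤ ((N / p : ℕ) : ℝ) + 1 := by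
      rw [← Nat.floor_div_eq_div (K := ℝ)]
      exact (Nat.lt_floor_add_one _).le
    have := mul_le_mul_of_nonneg_right hfloor (Real.log_natCast_nonneg p)
    calc (N : ℝ) * (Real.log p / p) = N / p * Real.log p := by ring
      _ ≤ _ := this
      _ = _ := by ring
  refine le_of_mul_le_mul_left ?_ hN0
  linarith

/-- Upper bound in Mertens' second theorem: `∑_{p ≤ N} 1 / p ≤ log log N + O(1)`. -/
theorem sum_primesLE_inv_le (N : ℕ) (hN : 2 ≤ N) :
    ∑ p ∈ Nat.primesLE N, 1 / (p : ℝ) ≤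
      Real.log (Real.log N) + (3 - Real.log (Real.log 2)) := by
  have hlog4 : Real.log 4 = 2 * Real.log 2 := by
    rw [show (4 : ℝ) = 2 ^ 2 by norm_num, Real.log_pow]; norm_num
  have hlog2 : 0 < Real.log 2 := Real.log_pos one_lt_two
  have key : ∑ p ∈ Nat.primesLE N, 1 / (p : ℝ) -
      (∑ p ∈ Nat.primesLE N, Real.log p / p) / Real.log N ≤
      Real.log (Real.log N) - Real.log 4 / Real.log N + (2 - Real.log (Real.log 2)) := by
    induction N, hN using Nat.le_induction with
    | base =>
      have h2 : Nat.primesLE 2 = {2} := by decide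
      simp only [h2, Finset.sum_singleton, Nat.cast_ofNat, hlog4]
      field_simp
      linarith
    | succ N hN ih =>
      have hLpos : 0 < Real.log N := Real.log_pos (by exact_mod_cast hN)
      have hLlt : Real.log N < Real.log (N + 1 : ℕ) :=
        Real.log_lt_log (by positivity) (by push_cast; linarith)
      have hA := sum_primesLE_log_div_le N (by omega)
      have hstep : ∑ p ∈ Nat.primesLE (N + 1), 1 / (p : ℝ) -
          (∑ p ∈ Nat.primesLE (N + 1), Real.log p / p) / Real.log (N + 1 : ℕ) =
          ∑ p ∈ Nat.primesLE N, 1 / (p : ℝ) -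
          (∑ p ∈ Nat.primesLE N, Real.log p / p) / Real.log (N + 1 : ℕ) := by
        rw [Nat.primesLE_succ]
        split_ifs with h
        · rw [Finset.sum_insert (Nat.notMem_primesLE N), Finset.sum_insert (Nat.notMem_primesLE N)]
          have : Real.log (N + 1 : ℕ) ≠ 0 := (hLpos.trans hLlt).ne'
          field_simp
          ring
        · rfl
      rw [hstep]
      set A := ∑ p ∈ Nat.primesLE N, Real.log p / p
      set L := Real.log N
      set L' := Real.log (N + 1 : ℕ)
      have hL' : 0 < L' := hLpos.trans hLlt
      have hinv : 0 ≤ 1 / L - 1 / L' := sub_nonneg.2 (one_div_le_one_div_of_le hLpos hLlt.le)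
      have hmul := mul_le_mul_of_nonneg_right hA hinv
      have hratio : 1 - L / L' ≤ Real.log L' - Real.log L := by
        have := Real.one_sub_inv_le_log_of_pos (div_pos hL' hLpos)
        rwa [inv_div, Real.log_div hL'.ne' hLpos.ne'] at this
      have e1 : A * (1 / L - 1 / L') = A / L - A / L' := by ring
      have e2 : (L + Real.log 4) * (1 / L - 1 / L') =
          1 - L / L' + Real.log 4 / L - Real.log 4 / L' := by
        field_simp
        ring
      linarith
  have hLpos : 0 < Real.log N := Real.log_pos (by exact_mod_cast hN)
  have hA := (div_le_div_iff_of_pos_right hLpos).2 (sum_primesLE_log_div_le N (by omega))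
  rw [add_div, div_self hLpos.ne'] at hA
  linarith

theorem Nat.two_pow_card_primeFactors_le {M : ℕ} (hM : M ≠ 0) : 2 ^ M.primeFactors.card ≤ M :=
  calc 2 ^ M.primeFactors.card ≤ ∏ p ∈ M.primeFactors, p :=
        Finset.pow_card_le_prod _ _ _ fun _ hp => (Nat.prime_of_mem_primeFactors hp).two_le
    _ ≤ M := Nat.le_of_dvd (Nat.pos_of_ne_zero hM) (Nat.prod_primeFactors_dvd M)

theorem sum_primeFactors_inv_le {M B Y : ℕ} (hM : M ≠ 0) (hY : 2 ≤ Y) (hMB : M ≤ 2 ^ (B * Y)) :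
    ∑ q ∈ M.primeFactors, 1 / (q : ℝ) ≤
      Real.log (Real.log Y) + (3 - Real.log (Real.log 2)) + B := by
  have hY0 : (0 : ℝ) < Y := by positivity
  have hcard : M.primeFactors.card ≤ B * Y :=
    (Nat.pow_le_pow_iff_right one_lt_two).1 ((Nat.two_pow_card_primeFactors_le hM).trans hMB)
  rw [← Finset.sum_filter_add_sum_filter_not _ (· ≤ Y)]
  refine add_le_add (le_trans ?_ (sum_primesLE_inv_le Y hY)) ?_
  · refine Finset.sum_le_sum_of_subset_of_nonneg ?_ fun _ _ _ => by positivity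
    intro q hq
    rw [Finset.mem_filter] at hq
    exact Nat.mem_primesLE.2 ⟨hq.2, Nat.prime_of_mem_primeFactors hq.1⟩
  · calc ∑ q ∈ M.primeFactors with ¬ q ≤ Y, 1 / (q : ℝ)
        ≤ (M.primeFactors.filter (¬ · ≤ Y)).card • (1 / (Y : ℝ)) := by
          refine Finset.sum_le_card_nsmul _ _ _ fun q hq => ?_
          have hq := (Finset.mem_filter.1 hq).2
          exact one_div_le_one_div_of_le hY0 (by exact_mod_cast (not_le.1 hq).le)
      _ ≤ ((B * Y : ℕ) : ℝ) * (1 / Y) := by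
          rw [nsmul_eq_mul]
          gcongr
          exact (Finset.card_filter_le _ _).trans hcard
      _ = B := by
          push_cast
          field_simp

section

variable {K : Type*} [Field K] [NumberField K]

theorem NumberField.card_le_finrank_of_liesOver (q : ℕ) (hq : q.Prime)
    (s : Finset (Ideal (𝓞 K)))
    (hs : ∀ P ∈ s, P.IsPrime ∧ P.LiesOver (Ideal.span {(q : ℤ)})) :
    s.card ≤ Module.finrank ℚ K := by
  have hprime : (Ideal.span {(q : ℤ)}).IsPrime :=
    (Ideal.span_singleton_prime (by exact_mod_cast hq.ne_zero)).2 (Nat.prime_iff_prime_int.1 hq)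
  have : Finite ((Ideal.span {(q : ℤ)}).primesOver (𝓞 K)) :=
    Algebra.QuasiFinite.finite_primesOver _
  have := Fintype.ofFinite ((Ideal.span {(q : ℤ)}).primesOver (𝓞 K))
  rw [← RingOfIntegers.rank, ← Ideal.sum_ramification_inertia_eq_finrank (Ideal.span {(q : ℤ)})]
  calc s.card ≤ Fintype.card ((Ideal.span {(q : ℤ)}).primesOver (𝓞 K)) := by
        rw [← Set.toFinset_card]
        exact Finset.card_le_card fun P hP => Set.mem_toFinset.2 (hs P hP)
    _ = ∑ P : (Ideal.span {(q : ℤ)}).primesOver (𝓞 K), 1 := by simp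
    _ ≤ _ := Finset.sum_le_sum fun P _ => by
        have := P.2.1
        exact Nat.mul_pos (Ideal.ramificationIdx_pos P.1 ℤ) (Ideal.inertiaDeg_pos P.1 ℤ)

open UniqueFactorizationMonoid in
theorem NumberField.sum_inv_absNorm_prime_le [DecidableEq (Ideal (𝓞 K))]
    (I : Ideal (𝓞 K)) (hI : I ≠ ⊥) :
    ∑ P ∈ (normalizedFactors I).toFinset, 1 / (Ideal.absNorm P : ℝ) ≤
      Module.finrank ℚ K * ∑ q ∈ (Ideal.absNorm I).primeFactors, 1 / (q : ℝ) := by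
  have hprops : ∀ P ∈ (normalizedFactors I).toFinset,
      P.IsPrime ∧ (Ideal.absNorm (P.under ℤ)).Prime ∧ P ≠ ⊥ ∧ P ∣ I := by
    intro P hP
    rw [Multiset.mem_toFinset] at hP
    have hPp := prime_of_normalized_factor P hP
    have hPprime : P.IsPrime := Ideal.isPrime_of_prime hPp
    have : NeZero P := ⟨hPp.ne_zero⟩
    exact ⟨hPprime, Nat.absNorm_under_prime P, hPp.ne_zero, dvd_of_mem_normalizedFactors hP⟩
  have hI0 : Ideal.absNorm I ≠ 0 := Ideal.absNorm_eq_zero_iff.not.2 hI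
  have hmaps : ∀ P ∈ (normalizedFactors I).toFinset,
      Ideal.absNorm (P.under ℤ) ∈ (Ideal.absNorm I).primeFactors := fun P hP =>
    Nat.mem_primeFactors.2 ⟨(hprops P hP).2.1,
      (Int.absNorm_under_dvd_absNorm P).trans (map_dvd Ideal.absNorm (hprops P hP).2.2.2), hI0⟩
  rw [← Finset.sum_fiberwise_of_maps_to hmaps, Finset.mul_sum]
  refine Finset.sum_le_sum fun q hq => ?_
  have hqp := Nat.prime_of_mem_primeFactors hq
  have hcard := card_le_finrank_of_liesOver q hqp
    {P ∈ (normalizedFactors I).toFinset | Ideal.absNorm (P.under ℤ) = q} (by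
      intro P hP
      obtain ⟨hPI, hPq⟩ := Finset.mem_filter.1 hP
      exact ⟨(hprops P hPI).1, hPq ▸ inferInstance⟩)
  refine (Finset.sum_le_card_nsmul _ _ (1 / (q : ℝ)) ?_).trans ?_
  · intro P hP
    obtain ⟨hP, hPq⟩ := Finset.mem_filter.1 hP
    refine one_div_le_one_div_of_le (by exact_mod_cast hqp.pos) ?_
    rw [← hPq]
    exact_mod_cast Nat.le_of_dvd
      (Nat.pos_of_ne_zero (Ideal.absNorm_eq_zero_iff.not.2 (hprops P hP).2.2.1))
      (Int.absNorm_under_dvd_absNorm P)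
  · rw [nsmul_eq_mul]
    gcongr

open UniqueFactorizationMonoid in
theorem NumberField.sum_inv_absNorm_squarefree_dvd_le
    (I : Ideal (𝓞 K)) (hI : I ≠ ⊥) (s : Finset (Ideal (𝓞 K)))
    (hs : ∀ J ∈ s, Squarefree J ∧ J ∣ I) :
    ∑ J ∈ s, 1 / (Ideal.absNorm J : ℝ) ≤
      Real.exp (Module.finrank ℚ K * ∑ q ∈ (Ideal.absNorm I).primeFactors, 1 / (q : ℝ)) := by
  classical
  have hprod : ∀ J ∈ s, ∏ P ∈ (normalizedFactors J).toFinset, P = J := by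
    intro J hJ
    have hJ0 : J ≠ 0 := ne_zero_of_dvd_ne_zero hI (hs J hJ).2
    have hnodup := (squarefree_iff_nodup_normalizedFactors hJ0).1 (hs J hJ).1
    rw [Finset.prod, Multiset.toFinset_val, hnodup.dedup, Multiset.map_id']
    exact associated_iff_eq.1 (prod_normalizedFactors hJ0)
  have hinj : Set.InjOn (fun J => (normalizedFactors J).toFinset) (s : Set (Ideal (𝓞 K))) := by
    intro J hJ J' hJ' h
    rw [← hprod J hJ, ← hprod J' hJ']
    exact congrArg (fun t : Finset (Ideal (𝓞 K)) => ∏ P ∈ t, P) h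
  calc ∑ J ∈ s, 1 / (Ideal.absNorm J : ℝ)
      = ∑ J ∈ s, ∏ P ∈ (normalizedFactors J).toFinset, 1 / (Ideal.absNorm P : ℝ) := by
        refine Finset.sum_congr rfl fun J hJ => ?_
        conv_lhs => rw [← hprod J hJ]
        simp [map_prod]
    _ = ∑ t ∈ s.image fun J => (normalizedFactors J).toFinset,
          ∏ P ∈ t, 1 / (Ideal.absNorm P : ℝ) := by rw [Finset.sum_image hinj]
    _ ≤ ∑ t ∈ (normalizedFactors I).toFinset.powerset,
          ∏ P ∈ t, 1 / (Ideal.absNorm P : ℝ) := by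
        refine Finset.sum_le_sum_of_subset_of_nonneg ?_ fun _ _ _ => by positivity
        refine Finset.image_subset_iff.2 fun J hJ => Finset.mem_powerset.2 ?_
        have hJ0 : J ≠ 0 := ne_zero_of_dvd_ne_zero hI (hs J hJ).2
        exact Multiset.toFinset_subset.2 (Multiset.subset_of_le
          ((dvd_iff_normalizedFactors_le_normalizedFactors hJ0 hI).1 (hs J hJ).2))
    _ = ∏ P ∈ (normalizedFactors I).toFinset, (1 + 1 / (Ideal.absNorm P : ℝ)) :=
        (Finset.prod_one_add _).symm
    _ ≤ Real.exp (∑ P ∈ (normalizedFactors I).toFinset, 1 / (Ideal.absNorm P : ℝ)) :=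
        Real.prod_one_add_le_exp_sum _ fun _ => by positivity
    _ ≤ _ := Real.exp_le_exp.2 (sum_inv_absNorm_prime_le I hI)

/-- The norm of `ξ ^ k - 1` grows at most exponentially in `k`. -/
theorem NumberField.exists_absNorm_pow_sub_one_le (ξ : 𝓞 K) :
    ∃ B : ℕ, ∀ k : ℕ, 1 ≤ k → Ideal.absNorm (Ideal.span {ξ ^ k - 1}) ≤ 2 ^ (B * k) := by
  obtain ⟨b, hb⟩ := pow_unbounded_of_one_lt (house (ξ : K)) (one_lt_two (α := ℝ))
  refine ⟨(b + 1) * Module.finrank ℚ K, fun k hk => ?_⟩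
  have hσ : ∀ σ : K →ₐ[ℚ] ℂ, ‖σ ((ξ ^ k - 1 : 𝓞 K) : K)‖ ≤ 2 ^ ((b + 1) * k) := by
    intro σ
    have h1 : ‖σ (ξ : K)‖ ≤ 2 ^ b := (norm_embedding_le_house (ξ : K) σ.toRingHom).trans hb.le
    calc ‖σ ((ξ ^ k - 1 : 𝓞 K) : K)‖ = ‖σ (ξ : K) ^ k - 1‖ := by simp
      _ ≤ ‖σ (ξ : K)‖ ^ k + 1 := (norm_sub_le _ _).trans (by simp)
      _ ≤ (2 ^ b) ^ k + 1 := by gcongr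
      _ ≤ (2 ^ b) ^ k + (2 ^ b) ^ k := by
          gcongr
          exact one_le_pow₀ (one_le_pow₀ one_le_two)
      _ = 2 ^ (b * k + 1) := by ring
      _ ≤ 2 ^ ((b + 1) * k) := pow_le_pow_right₀ one_le_two (by linarith)
  have hnorm : (Ideal.absNorm (Ideal.span {ξ ^ k - 1}) : ℝ) =
      ∏ σ : K →ₐ[ℚ] ℂ, ‖σ ((ξ ^ k - 1 : 𝓞 K) : K)‖ := by
    rw [← norm_prod, ← Algebra.norm_eq_prod_embeddings, ← Algebra.coe_norm_int,
      Ideal.absNorm_span_singleton, Nat.cast_natAbs]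
    simp
  have : (Ideal.absNorm (Ideal.span {ξ ^ k - 1}) : ℝ) ≤
      2 ^ ((b + 1) * Module.finrank ℚ K * k) := by
    rw [hnorm]
    refine (Finset.prod_le_prod (fun _ _ => norm_nonneg _) fun σ _ => hσ σ).trans_eq ?_
    rw [Finset.prod_const, Finset.card_univ, AlgHom.card, ← pow_mul]
    ring
  exact_mod_cast this

end

/-- **Logarithmic bound for the truncated Romanov sum.** The sum `E(x)` of `1/𝒩(𝔞)` over
nonzero squarefree ideals `𝔞` coprime to `(ξ)` containing some `ξ^k - 1` (`k ≥ 1`) with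
`ord_ξ(𝔞) ≤ x` satisfies `E(x) ≤ C (log x)ⁿ` for all `x ≥ 2`. -/
theorem truncated_romanov_sum_log_bound (K : Type*) [Field K] [NumberField K]
    (ξ : 𝓞 K) (hξ0 : ξ ≠ 0) (hξ : ¬ IsUnit ξ) :
    ∃ C : ℝ, 0 < C ∧ ∀ x : ℝ, 2 ≤ x →
      (∑' 𝔞 : {𝔞 : Ideal (𝓞 K) // 𝔞 ≠ ⊥ ∧ Squarefree 𝔞 ∧
          IsCoprime 𝔞 (Ideal.span {ξ}) ∧ (∃ k : ℕ, 1 ≤ k ∧ ξ ^ k - 1 ∈ 𝔞) ∧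
          (ordXi ξ 𝔞 : ℝ) ≤ x}, 1 / (Ideal.absNorm 𝔞.1 : ℝ)) ≤
        C * Real.log x ^ Module.finrank ℚ K := by
  obtain ⟨B, hB⟩ := exists_absNorm_pow_sub_one_le ξ
  set c : ℝ := 3 - Real.log (Real.log 2) + B
  refine ⟨(2 * Real.exp c) ^ Module.finrank ℚ K, by positivity, fun x hx => ?_⟩
  set N := ⌊x⌋₊
  have hN : 2 ≤ N := Nat.le_floor (by exact_mod_cast hx)
  set I : Ideal (𝓞 K) := ∏ k ∈ Finset.Icc 1 N, Ideal.span {ξ ^ k - 1}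
  have hI : I ≠ ⊥ := by
    refine Finset.prod_ne_zero_iff.2 fun k hk => ?_
    rw [Ideal.zero_eq_bot, Ne, Ideal.span_singleton_eq_bot, sub_eq_zero]
    intro h
    exact hξ (IsUnit.of_pow_eq_one h (by have := (Finset.mem_Icc.1 hk).1; omega))
  have hM : Ideal.absNorm I ≠ 0 := Ideal.absNorm_eq_zero_iff.not.2 hI
  have hMB : Ideal.absNorm I ≤ 2 ^ (B * N ^ 2) := by
    calc Ideal.absNorm I = ∏ k ∈ Finset.Icc 1 N, Ideal.absNorm (Ideal.span {ξ ^ k - 1}) :=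
          map_prod _ _ _
      _ ≤ ∏ _k ∈ Finset.Icc 1 N, 2 ^ (B * N) := by
          refine Finset.prod_le_prod' fun k hk => (hB k (Finset.mem_Icc.1 hk).1).trans ?_
          exact Nat.pow_le_pow_right two_pos (Nat.mul_le_mul_left _ (Finset.mem_Icc.1 hk).2)
      _ = 2 ^ (B * N ^ 2) := by
          rw [Finset.prod_const, Nat.card_Icc, Nat.add_sub_cancel, ← pow_mul]
          ring
  have hlogN : 0 < Real.log N := Real.log_pos (by exact_mod_cast hN)
  have hlogx : Real.log N ≤ Real.log x :=
    Real.log_le_log (by positivity) (Nat.floor_le (by linarith))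
  have hbound : Real.exp (Module.finrank ℚ K *
      ∑ q ∈ (Ideal.absNorm I).primeFactors, 1 / (q : ℝ)) ≤
      (2 * Real.exp c) ^ Module.finrank ℚ K * Real.log x ^ Module.finrank ℚ K := by
    rw [Real.exp_nat_mul, ← mul_pow]
    refine pow_le_pow_left₀ (Real.exp_pos _).le ?_ _
    have h := Real.exp_le_exp.2 (sum_primeFactors_inv_le hM (Y := N ^ 2) (by nlinarith) hMB)
    refine h.trans ?_
    rw [add_assoc, Real.exp_add, Nat.cast_pow, Real.log_pow, Real.exp_log (by positivity)]
    push_cast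
    nlinarith [Real.exp_pos c]
  refine Real.tsum_le_of_sum_le (fun _ => by positivity) fun s => le_trans ?_ hbound
  refine (Finset.sum_map s (Function.Embedding.subtype _)
    (fun J : Ideal (𝓞 K) => 1 / (Ideal.absNorm J : ℝ))).symm.trans_le ?_
  refine sum_inv_absNorm_squarefree_dvd_le I hI _ fun J hJ => ?_
  obtain ⟨⟨J, hJ0, hsq, -, hk, hord⟩, -, rfl⟩ := Finset.mem_map.1 hJ
  obtain ⟨hpos, hmem⟩ : 1 ≤ ordXi ξ J ∧ ξ ^ ordXi ξ J - 1 ∈ J := Nat.sInf_mem hk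
  refine ⟨hsq, (Ideal.dvd_span_singleton.2 hmem).trans ?_⟩
  exact Finset.dvd_prod_of_mem _ (Finset.mem_Icc.2 ⟨hpos, Nat.le_floor hord⟩)
end
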